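/- arXiv:2511.12641 — 8 statements merged into one kernel-verified Lean document; each statement's English description precedes it below -/
import Mathlib

section
/- Let P be an m×m pattern and Q an n×n pattern, each of full term-rank, such that the bigraph of P and the bigraph of Q are each connected. Let E be an m×n pattern and F an n×m pattern such that the total number of 1 entries in E and F together is at least 2. Then there exists a real (m+n)×(m+n) matrix with pattern M = [[P, E],[F, Q]] (block form, with P in the top-left and Q in the bottom-right) having the SSVP and a multiple singular value. -/
open Matrix Polynomial

/-- A pattern is a matrix each of whose entries is `0` or `1`. -/
def IsPattern {α β : Type*} (P : Matrix α β ℝ) : Prop :=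
  ∀ i j, P i j = 0 ∨ P i j = 1

/-- `A` has pattern `P`: the entries of `A` are nonzero exactly where `P` has a `1`. -/
def HasPattern {α β : Type*} (A P : Matrix α β ℝ) : Prop :=
  ∀ i j, A i j ≠ 0 ↔ P i j = 1

/-- The Strong Singular Value Property. -/
def SSVP {α β : Type*} [Fintype α] [Fintype β] (A : Matrix α β ℝ) : Prop :=
  ∀ X : Matrix α β ℝ,
    (Aᵀ * X).IsSymm → (X * Aᵀ).IsSymm → (∀ i j, A i j * X i j = 0) → X = 0

/-- The multiplicity of `σ` as a singular value of `A`: the algebraic multiplicity of `σ²`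
as an eigenvalue (root of the characteristic polynomial) of `A * Aᵀ`. -/
noncomputable def singValMult {α β : Type*} [Fintype α] [DecidableEq α] [Fintype β]
    (A : Matrix α β ℝ) (σ : ℝ) : ℕ :=
  (A * Aᵀ).charpoly.rootMultiplicity (σ ^ 2)

/-- The bigraph of an `m × n` pattern: the bipartite graph on row vertices `Sum.inl i`
and column vertices `Sum.inr j`, with an edge `{i, j'}` exactly when `P i j = 1`. -/
def bigraph {m n : ℕ} (P : Matrix (Fin m) (Fin n) ℝ) : SimpleGraph (Fin m ⊕ Fin n) :=
  SimpleGraph.fromRel (fun x y => ∃ i j, x = Sum.inl i ∧ y = Sum.inr j ∧ P i j = 1)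

section TwoSingularVectors

variable {ι : Type*} [Fintype ι] [DecidableEq ι]

theorem two_le_singValMult_one {N : Matrix ι ι ℝ} {w : Fin 2 → ι → ℝ}
    (hw : LinearIndependent ℝ w) (hN : ∀ i, Nᵀ *ᵥ (N *ᵥ w i) = w i) :
    2 ≤ singValMult N 1 := by
  have h1 : singValMult N 1 = (Matrix.toLin' (Nᵀ * N)).charpoly.rootMultiplicity 1 := by
    rw [Matrix.charpoly_toLin', singValMult, Matrix.charpoly_mul_comm, one_pow]
  rw [h1]
  refine le_trans ?_ (LinearMap.finrank_eigenspace_le _ _)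
  have hmem : ∀ i, w i ∈ Module.End.eigenspace (Matrix.toLin' (Nᵀ * N)) 1 := by
    intro i
    rw [Module.End.mem_eigenspace_iff, Matrix.toLin'_apply, ← Matrix.mulVec_mulVec, hN, one_smul]
  have hli : LinearIndependent ℝ
      (fun i => (⟨w i, hmem i⟩ : Module.End.eigenspace (Matrix.toLin' (Nᵀ * N)) 1)) :=
    LinearIndependent.of_comp (Submodule.subtype _) hw
  simpa using hli.fintype_card_le_finrank

/-- The matrix `A` with the rows `α` and `β` replaced by zero. -/
def rowTrunc (α β : ι) (A : Matrix ι ι ℝ) : Matrix ι ι ℝ :=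
  fun p q => if p = α ∨ p = β then 0 else A p q

/-- The matrix `1 - Cᵀ C`, where `C` is `A` without the rows `α` and `β`. -/
def gramDefect (α β : ι) (A : Matrix ι ι ℝ) : Matrix ι ι ℝ :=
  1 - (rowTrunc α β A)ᵀ * rowTrunc α β A

/-- The bilinear form of the inverse of `gramDefect α β A`. -/
noncomputable def invForm (α β : ι) (A : Matrix ι ι ℝ) (x y : ι → ℝ) : ℝ :=
  (gramDefect α β A).det⁻¹ * (x ⬝ᵥ (gramDefect α β A).adjugate *ᵥ y)

theorem gramDefect_transpose (α β : ι) (A : Matrix ι ι ℝ) :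
    (gramDefect α β A)ᵀ = gramDefect α β A := by
  simp [gramDefect, Matrix.transpose_mul]

theorem invForm_comm (α β : ι) (A : Matrix ι ι ℝ) (x y : ι → ℝ) :
    invForm α β A x y = invForm α β A y x := by
  unfold invForm
  rw [Matrix.dotProduct_mulVec, ← Matrix.mulVec_transpose, Matrix.adjugate_transpose,
    gramDefect_transpose, dotProduct_comm]

theorem invForm_sub_left (α β : ι) (A : Matrix ι ι ℝ) (x y z : ι → ℝ) :
    invForm α β A (x - y) z = invForm α β A x z - invForm α β A y z := by
  simp [invForm, sub_dotProduct, mul_sub]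

theorem invForm_smul_left (α β : ι) (A : Matrix ι ι ℝ) (c : ℝ) (x y : ι → ℝ) :
    invForm α β A (c • x) y = c * invForm α β A x y := by
  simp [invForm, smul_dotProduct]; ring

theorem invForm_smul_right (α β : ι) (A : Matrix ι ι ℝ) (c : ℝ) (x y : ι → ℝ) :
    invForm α β A x (c • y) = c * invForm α β A x y := by
  rw [invForm_comm, invForm_smul_left, invForm_comm]

theorem transpose_mul_self_eq_gramDefect {α β : ι} (hαβ : α ≠ β) (N : Matrix ι ι ℝ) :
    Nᵀ * N = 1 - gramDefect α β N + vecMulVec (N α) (N α) + vecMulVec (N β) (N β) := by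
  ext p q
  simp only [gramDefect, sub_sub_cancel, Matrix.add_apply, Matrix.mul_apply,
    Matrix.transpose_apply, vecMulVec_apply, rowTrunc]
  rw [← Finset.add_sum_erase _ _ (Finset.mem_univ α),
    ← Finset.add_sum_erase _ _ (show β ∈ Finset.univ.erase α by simp [hαβ.symm]),
    ← Finset.add_sum_erase Finset.univ (fun x => (if x = α ∨ x = β then (0 : ℝ) else N x p) *
        if x = α ∨ x = β then 0 else N x q) (Finset.mem_univ α),
    ← Finset.add_sum_erase (Finset.univ.erase α) (fun x => (if x = α ∨ x = β then (0 : ℝ) else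
      N x p) * if x = α ∨ x = β then 0 else N x q) (show β ∈ Finset.univ.erase α by simp [hαβ.symm])]
  have : ∑ x ∈ (Finset.univ.erase α).erase β, ((if x = α ∨ x = β then (0 : ℝ) else N x p) *
        if x = α ∨ x = β then 0 else N x q) = ∑ x ∈ (Finset.univ.erase α).erase β, N x p * N x q := by
    refine Finset.sum_congr rfl fun x hx => ?_
    simp only [Finset.mem_erase, Finset.mem_univ, and_true] at hx
    simp [hx.1, hx.2]
  rw [this]
  simp
  ring

theorem exists_linearIndependent_of_invForm {α β : ι} (hαβ : α ≠ β) {N : Matrix ι ι ℝ}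
    (hdet : (gramDefect α β N).det ≠ 0) (hα : invForm α β N (N α) (N α) = 1)
    (hβ : invForm α β N (N β) (N β) = 1) (h : invForm α β N (N α) (N β) = 0) :
    ∃ w : Fin 2 → ι → ℝ, LinearIndependent ℝ w ∧ ∀ i, Nᵀ *ᵥ (N *ᵥ w i) = w i := by
  set S := gramDefect α β N with hS
  set W : (ι → ℝ) → (ι → ℝ) := fun x => S.det⁻¹ • (S.adjugate *ᵥ x) with hW
  have hform : ∀ x y, x ⬝ᵥ W y = invForm α β N x y := by
    intro x y; simp [hW, invForm, dotProduct_smul, ← hS]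
  have hSW : ∀ x, S *ᵥ W x = x := by
    intro x
    simp only [hW, Matrix.mulVec_smul, Matrix.mulVec_mulVec, Matrix.mul_adjugate,
      Matrix.smul_mulVec, Matrix.one_mulVec, smul_smul, inv_mul_cancel₀ hdet, one_smul]
  have h' : invForm α β N (N β) (N α) = 0 := by rw [invForm_comm, h]
  have key : ∀ x, Nᵀ *ᵥ (N *ᵥ W x) =
      W x - x + invForm α β N (N α) x • N α + invForm α β N (N β) x • N β := by
    intro x
    rw [Matrix.mulVec_mulVec, transpose_mul_self_eq_gramDefect hαβ]
    simp only [Matrix.add_mulVec, Matrix.sub_mulVec, Matrix.one_mulVec, vecMulVec_mulVec, ← hS, hSW,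
      hform]
    simp
  refine ⟨![W (N α), W (N β)], ?_, ?_⟩
  · rw [LinearIndependent.pair_iff]
    intro s t hst
    have e1 := congrArg (N α ⬝ᵥ ·) hst
    have e2 := congrArg (N β ⬝ᵥ ·) hst
    simp only [dotProduct_add, dotProduct_smul, hform, hα, hβ, h, h', dotProduct_zero] at e1 e2
    exact ⟨by simpa using e1, by simpa using e2⟩
  · intro i
    fin_cases i
    · simp [key, hα, h']
    · simp [key, hβ, h]

end TwoSingularVectors

section PathMatrix

variable {ι : Type*} [Fintype ι] [DecidableEq ι]

omit [DecidableEq ι] in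
theorem mulVec_apply_eq_add {A : Matrix ι ι ℝ} {x : ι → ℝ} {p q : ι} (hpq : p ≠ q)
    (h : ∀ r, r ≠ p → r ≠ q → A p r = 0 ∨ x r = 0) :
    (A *ᵥ x) p = A p p * x p + A p q * x q := by
  rw [Matrix.mulVec, dotProduct]
  refine Finset.sum_eq_add p q hpq (fun r _ hr => ?_) (by simp) (by simp)
  rcases h r hr.1 hr.2 with h | h <;> simp [h]

omit [DecidableEq ι] in
theorem mulVec_apply_eq_diag {A : Matrix ι ι ℝ} {x : ι → ℝ} {p : ι}
    (h : ∀ r, r ≠ p → A p r = 0 ∨ x r = 0) :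
    (A *ᵥ x) p = A p p * x p := by
  rw [Matrix.mulVec, dotProduct]
  refine Finset.sum_eq_single p (fun r _ hr => ?_) (by simp)
  rcases h r hr with h | h <;> simp [h]

/-- A matrix whose off-diagonal entries form an oriented path `f 0, …, f s` has only simple
singular values equal to one: a right singular vector vanishing at the end of the path is zero. -/
theorem eq_zero_of_path {N : Matrix ι ι ℝ} {f : ℕ → ι} {s : ℕ}
    (hf : Set.InjOn f {i | i ≤ s})
    (hor : ∀ t < s, (N (f t) (f (t + 1)) ≠ 0 ∧ N (f (t + 1)) (f t) = 0) ∨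
      (N (f (t + 1)) (f t) ≠ 0 ∧ N (f t) (f (t + 1)) = 0))
    (hoff : ∀ p q, p ≠ q → N p q ≠ 0 →
      ∃ t < s, (p = f t ∧ q = f (t + 1)) ∨ (p = f (t + 1) ∧ q = f t))
    (hdiag : ∀ p, N p p ≠ 0) (hone : ∀ p, (∀ t ≤ s, p ≠ f t) → N p p ^ 2 ≠ 1)
    {v : ι → ℝ} (hv : Nᵀ *ᵥ (N *ᵥ v) = v) (hv0 : v (f 0) = 0) : v = 0 := by
  set u := N *ᵥ v with hu
  have hinj : ∀ {i j}, i ≤ s → j ≤ s → f i = f j → i = j := fun hi hj h => hf hi hj h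
  have hoffT : ∀ p q, p ≠ q → Nᵀ p q ≠ 0 →
      ∃ t < s, (p = f t ∧ q = f (t + 1)) ∨ (p = f (t + 1) ∧ q = f t) := by
    intro p q hpq h
    obtain ⟨t, ht, h⟩ := hoff q p hpq.symm h
    exact ⟨t, ht, by tauto⟩
  have row : ∀ (A : Matrix ι ι ℝ) (x : ι → ℝ) (t : ℕ), t < s → (∀ i < t, x (f i) = 0) →
      (∀ p q, p ≠ q → A p q ≠ 0 →
        ∃ t < s, (p = f t ∧ q = f (t + 1)) ∨ (p = f (t + 1) ∧ q = f t)) →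
      (A *ᵥ x) (f t) = A (f t) (f t) * x (f t) + A (f t) (f (t + 1)) * x (f (t + 1)) := by
    intro A x t ht hx hA
    refine mulVec_apply_eq_add (fun h => ?_) fun r hr hr' => ?_
    · have := hinj ht.le ht h
      omega
    · by_contra! hc
      obtain ⟨i, hi, h | h⟩ := hA _ _ hr.symm hc.1
      · have := hinj ht.le hi.le h.1
        subst this
        exact hr' h.2
      · have := hinj ht.le hi h.1
        subst this
        exact hc.2 (by rw [h.2]; exact hx i (by omega))
  have rowEnd : ∀ (A : Matrix ι ι ℝ) (x : ι → ℝ), (∀ i < s, x (f i) = 0) →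
      (∀ p q, p ≠ q → A p q ≠ 0 →
        ∃ t < s, (p = f t ∧ q = f (t + 1)) ∨ (p = f (t + 1) ∧ q = f t)) →
      (A *ᵥ x) (f s) = A (f s) (f s) * x (f s) := by
    intro A x hx hA
    refine mulVec_apply_eq_diag fun r hr => ?_
    by_contra! hc
    obtain ⟨i, hi, h | h⟩ := hA _ _ hr.symm hc.1
    · have := hinj le_rfl hi.le h.1
      omega
    · exact hc.2 (by rw [h.2]; exact hx i hi)
  have both : ∀ t ≤ s, (∀ i < t, u (f i) = 0 ∧ v (f i) = 0) → (u (f t) = 0 ∨ v (f t) = 0) →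
      u (f t) = 0 ∧ v (f t) = 0 := by
    intro t ht hlt h0
    have hd := hdiag (f t)
    have hor' : u (f t) = N (f t) (f t) * v (f t) ∨ v (f t) = N (f t) (f t) * u (f t) := by
      rcases ht.lt_or_eq with ht' | rfl
      · have e1 := row N v t ht' (fun i hi => (hlt i hi).2) hoff
        have e2 := row Nᵀ u t ht' (fun i hi => (hlt i hi).1) hoffT
        rw [hv] at e2
        rw [← hu] at e1
        simp only [Matrix.transpose_apply] at e2
        rcases hor t ht' with h | h
        · right; rw [e2, h.2]; ring
        · left; rw [e1, h.2]; ring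
      · left
        exact rowEnd N v (fun i hi => (hlt i hi).2) hoff
    rcases hor' with h | h <;> rcases h0 with h0 | h0
    · exact ⟨h0, (mul_eq_zero.1 (h.symm.trans h0)).resolve_left hd⟩
    · exact ⟨by rw [h, h0, mul_zero], h0⟩
    · exact ⟨h0, by rw [h, h0, mul_zero]⟩
    · exact ⟨(mul_eq_zero.1 (h.symm.trans h0)).resolve_left hd, h0⟩
  have next : ∀ t < s, (∀ i ≤ t, u (f i) = 0 ∧ v (f i) = 0) →
      (u (f (t + 1)) = 0 ∨ v (f (t + 1)) = 0) := by
    intro t ht h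
    have e1 := row N v t ht (fun i hi => (h i hi.le).2) hoff
    have e2 := row Nᵀ u t ht (fun i hi => (h i hi.le).1) hoffT
    rw [hv] at e2
    rw [← hu] at e1
    simp only [Matrix.transpose_apply, (h t le_rfl).1, (h t le_rfl).2] at e1 e2
    rcases hor t ht with h' | h'
    · right; simpa [h'.1] using e1
    · left; simpa [h'.1] using e2
  have all : ∀ t ≤ s, ∀ i ≤ t, u (f i) = 0 ∧ v (f i) = 0 := by
    intro t
    induction t with
    | zero =>
      intro _ i hi
      obtain rfl : i = 0 := by omega
      exact both 0 (by omega) (by simp) (Or.inr hv0)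
    | succ t ih =>
      intro ht i hi
      have ih' := ih (by omega)
      rcases hi.lt_or_eq with hi | rfl
      · exact ih' i (by omega)
      · exact both _ ht (fun i hi => ih' i (by omega)) (next t (by omega) ih')
  funext p
  by_cases hp : ∃ t ≤ s, p = f t
  · obtain ⟨t, ht, rfl⟩ := hp
    exact (all t ht t le_rfl).2
  · push Not at hp
    have off : ∀ A : Matrix ι ι ℝ, (∀ p q, p ≠ q → A p q ≠ 0 →
        ∃ t < s, (p = f t ∧ q = f (t + 1)) ∨ (p = f (t + 1) ∧ q = f t)) →
        ∀ x : ι → ℝ, (A *ᵥ x) p = A p p * x p := by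
      intro A hA x
      refine mulVec_apply_eq_diag fun r hr => Or.inl ?_
      by_contra hc
      obtain ⟨i, hi, h | h⟩ := hA _ _ hr.symm hc
      · exact hp i hi.le h.1
      · exact hp _ hi h.1
    have e1 := off N hoff v
    have e2 := off Nᵀ hoffT u
    rw [hv] at e2
    rw [← hu] at e1
    rw [e1, Matrix.transpose_apply] at e2
    have : (N p p ^ 2 - 1) * v p = 0 := by linear_combination -e2
    rcases mul_eq_zero.1 this with h | h
    · exact absurd (by linarith) (hone p hp)
    · simpa using h

theorem not_linearIndependent_of_path {N : Matrix ι ι ℝ} {f : ℕ → ι} {s : ℕ}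
    (hf : Set.InjOn f {i | i ≤ s})
    (hor : ∀ t < s, (N (f t) (f (t + 1)) ≠ 0 ∧ N (f (t + 1)) (f t) = 0) ∨
      (N (f (t + 1)) (f t) ≠ 0 ∧ N (f t) (f (t + 1)) = 0))
    (hoff : ∀ p q, p ≠ q → N p q ≠ 0 →
      ∃ t < s, (p = f t ∧ q = f (t + 1)) ∨ (p = f (t + 1) ∧ q = f t))
    (hdiag : ∀ p, N p p ≠ 0) (hone : ∀ p, (∀ t ≤ s, p ≠ f t) → N p p ^ 2 ≠ 1)
    {w : Fin 2 → ι → ℝ} (hN : ∀ i, Nᵀ *ᵥ (N *ᵥ w i) = w i) : ¬ LinearIndependent ℝ w := by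
  intro hw
  have key : ∀ {v : ι → ℝ}, Nᵀ *ᵥ (N *ᵥ v) = v → v (f 0) = 0 → v = 0 :=
    fun hv hv0 => eq_zero_of_path hf hor hoff hdiag hone hv hv0
  have h0 : w 1 (f 0) • w 0 + (-w 0 (f 0)) • w 1 = 0 := by
    refine key ?_ ?_
    · simp only [Matrix.mulVec_add, Matrix.mulVec_smul, hN]
    · simp; ring
  have h1 : w 1 (f 0) = 0 := by
    have := Fintype.linearIndependent_iff.1 hw ![w 1 (f 0), -w 0 (f 0)]
      (by rw [Fin.sum_univ_two]; exact h0) 0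
    simpa using this
  exact hw.ne_zero 1 (key (hN 1) h1)

end PathMatrix

section Stability

open Filter Topology

variable {ι : Type*} [Fintype ι] [DecidableEq ι]

omit [DecidableEq ι] in
theorem eventually_ssvp_restricted (R : ι → ι → Prop) (N₀ : Matrix ι ι ℝ)
    (h₀ : ∀ X : Matrix ι ι ℝ, (∀ p q, R p q → X p q = 0) →
      (N₀ᵀ * X).IsSymm → (X * N₀ᵀ).IsSymm → X = 0) :
    ∀ᶠ N in 𝓝 N₀, ∀ X : Matrix ι ι ℝ, (∀ p q, R p q → X p q = 0) →
      (Nᵀ * X).IsSymm → (X * Nᵀ).IsSymm → X = 0 := by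
  let K : Set (ι → ι → ℝ) := Metric.sphere 0 1 ∩ {X | ∀ p q, R p q → X p q = 0}
  have hK : IsCompact K := by
    refine (isCompact_sphere _ _).inter_right ?_
    simp only [Set.ofPred_forall]
    exact isClosed_iInter fun p => isClosed_iInter fun q => isClosed_iInter fun _ =>
      isClosed_eq (by fun_prop) continuous_const
  have hev : ∀ᶠ N : Matrix ι ι ℝ in 𝓝 N₀, ∀ X ∈ K,
      ¬ ((Nᵀ * Matrix.of X).IsSymm ∧ (Matrix.of X * Nᵀ).IsSymm) := by
    refine hK.eventually_forall_of_forall_eventually fun X hX => ?_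
    have hcl : IsClosed {z : Matrix ι ι ℝ × (ι → ι → ℝ) |
        (z.1ᵀ * Matrix.of z.2).IsSymm ∧ (Matrix.of z.2 * z.1ᵀ).IsSymm} := by
      have c1 : Continuous fun z : Matrix ι ι ℝ × (ι → ι → ℝ) => z.1ᵀ :=
        continuous_fst.matrix_transpose
      have c2 : Continuous fun z : Matrix ι ι ℝ × (ι → ι → ℝ) => Matrix.of z.2 :=
        continuous_snd
      exact (isClosed_eq (c1.matrix_mul c2).matrix_transpose (c1.matrix_mul c2)).inter
        (isClosed_eq (c2.matrix_mul c1).matrix_transpose (c2.matrix_mul c1))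
    refine hcl.isOpen_compl.mem_nhds ?_
    rintro ⟨h1, h2⟩
    have : X = 0 := h₀ X hX.2 h1 h2
    have h3 := hX.1
    rw [this] at h3
    simp at h3
  refine hev.mono fun N hN X hR h1 h2 => ?_
  by_contra hX
  obtain ⟨Y, rfl⟩ := (Matrix.of (m := ι) (n := ι) (α := ℝ)).surjective X
  have hY : Y ≠ 0 := hX
  have hn : ‖Y‖ ≠ 0 := norm_ne_zero_iff.2 hY
  refine hN (‖Y‖⁻¹ • Y) ⟨?_, fun p q h => ?_⟩ ⟨?_, ?_⟩
  · simp [norm_smul, hn]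
  · have : Y p q = 0 := hR p q h
    simp [this]
  · rw [← Matrix.smul_of, Matrix.mul_smul]
    exact h1.smul _
  · rw [← Matrix.smul_of, Matrix.smul_mul]
    exact h2.smul _

theorem diagonal_ssvp_restricted {d : ι → ℝ} {α β : ι} {R : ι → ι → Prop}
    (hd : ∀ p q, d p ^ 2 = d q ^ 2 → p = q ∨ (p = α ∧ q = β) ∨ (p = β ∧ q = α))
    (hdiag : ∀ p, R p p) (hR : R α β) (hα : d α = 1) (hβ : d β = 1)
    (X : Matrix ι ι ℝ) (hX : ∀ p q, R p q → X p q = 0)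
    (h1 : ((diagonal d)ᵀ * X).IsSymm) (h2 : (X * (diagonal d)ᵀ).IsSymm) : X = 0 := by
  ext p q
  have e1 := h1.apply p q
  have e2 := h2.apply p q
  simp only [diagonal_transpose, diagonal_mul, mul_diagonal] at e1 e2
  by_cases h : d p ^ 2 = d q ^ 2
  · rcases hd p q h with rfl | ⟨rfl, rfl⟩ | ⟨rfl, rfl⟩
    · exact hX _ _ (hdiag _)
    · exact hX _ _ hR
    · rw [hα, hβ, hX _ _ hR] at e1
      simpa using e1.symm
  · have : (d p ^ 2 - d q ^ 2) * X p q = 0 := by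
      linear_combination (-d p) * e1 + d q * e2
    rcases mul_eq_zero.1 this with h' | h'
    · exact absurd (by linarith) h
    · simpa using h'

end Stability

section Tuning

open Filter Topology

variable {ι : Type*} [Fintype ι] [DecidableEq ι]

/-- The row `α` of `A`, shifted along the coordinate `β` so as to become orthogonal to the row `β`
for `invForm α β A`. -/
noncomputable def shiftedRow (α β : ι) (A : Matrix ι ι ℝ) : ι → ℝ :=
  A α - (invForm α β A (A α) (A β) / invForm α β A (Pi.single β 1) (A β)) • Pi.single β 1

/-- The matrix `A` with the rows `α` and `β` modified so as to become orthonormal for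
`invForm α β A`. -/
noncomputable def tune (α β : ι) (A : Matrix ι ι ℝ) : Matrix ι ι ℝ := fun p =>
  if p = α then (√(invForm α β A (shiftedRow α β A) (shiftedRow α β A)))⁻¹ • shiftedRow α β A
  else if p = β then (√(invForm α β A (A β) (A β)))⁻¹ • A β
  else A p

/-- The nondegeneracy conditions under which `tune α β A` has a double singular value `1`. -/
structure Tunable (α β : ι) (A : Matrix ι ι ℝ) : Prop where
  det_ne : (gramDefect α β A).det ≠ 0
  single_ne : invForm α β A (Pi.single β 1) (A β) ≠ 0
  row_pos : 0 < invForm α β A (A β) (A β)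
  shifted_pos : 0 < invForm α β A (shiftedRow α β A) (shiftedRow α β A)

theorem gramDefect_tune (α β : ι) (A : Matrix ι ι ℝ) :
    gramDefect α β (tune α β A) = gramDefect α β A := by
  have : rowTrunc α β (tune α β A) = rowTrunc α β A := by
    ext p q
    unfold rowTrunc tune
    split_ifs <;> simp_all
  rw [gramDefect, this, gramDefect]

theorem invForm_tune (α β : ι) (A : Matrix ι ι ℝ) :
    invForm α β (tune α β A) = invForm α β A := by
  funext x y
  rw [invForm, gramDefect_tune, invForm]

theorem invForm_shiftedRow {α β : ι} {A : Matrix ι ι ℝ}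
    (h : invForm α β A (Pi.single β 1) (A β) ≠ 0) :
    invForm α β A (shiftedRow α β A) (A β) = 0 := by
  rw [shiftedRow, invForm_sub_left, invForm_smul_left, div_mul_cancel₀ _ h, sub_self]

theorem Tunable.exists_linearIndependent {α β : ι} (hαβ : α ≠ β) {A : Matrix ι ι ℝ}
    (h : Tunable α β A) :
    ∃ w : Fin 2 → ι → ℝ, LinearIndependent ℝ w ∧
      ∀ i, (tune α β A)ᵀ *ᵥ (tune α β A *ᵥ w i) = w i := by
  have hα : tune α β A α =
      (√(invForm α β A (shiftedRow α β A) (shiftedRow α β A)))⁻¹ • shiftedRow α β A := by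
    simp [tune]
  have hβ : tune α β A β = (√(invForm α β A (A β) (A β)))⁻¹ • A β := by
    simp [tune, hαβ.symm]
  have norm_one : ∀ {x : ℝ}, 0 < x → (√x)⁻¹ * ((√x)⁻¹ * x) = 1 := by
    intro x hx
    have h0 : √x ≠ 0 := (Real.sqrt_pos.2 hx).ne'
    have h1 : √x * √x = x := Real.mul_self_sqrt hx.le
    field_simp
    nlinarith
  refine exists_linearIndependent_of_invForm hαβ ?_ ?_ ?_ ?_
  · rw [gramDefect_tune]; exact h.det_ne
  · rw [invForm_tune, hα, invForm_smul_left, invForm_smul_right, norm_one h.shifted_pos]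
  · rw [invForm_tune, hβ, invForm_smul_left, invForm_smul_right, norm_one h.row_pos]
  · rw [invForm_tune, hα, hβ, invForm_smul_left, invForm_smul_right,
      invForm_shiftedRow h.single_ne, mul_zero, mul_zero]

theorem continuous_gramDefect (α β : ι) : Continuous (gramDefect α β) := by
  have h : Continuous (rowTrunc α β) := by
    refine continuous_matrix fun p q => ?_
    unfold rowTrunc
    split_ifs
    · exact continuous_const
    · exact continuous_id.matrix_elem p q
  exact continuous_const.sub (h.matrix_transpose.matrix_mul h)

theorem continuousAt_invForm {α β : ι} {A : Matrix ι ι ℝ} (hA : (gramDefect α β A).det ≠ 0)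
    {x y : Matrix ι ι ℝ → ι → ℝ} (hx : ContinuousAt x A) (hy : ContinuousAt y A) :
    ContinuousAt (fun B => invForm α β B (x B) (y B)) A := by
  have hS := continuous_gramDefect α β
  refine (hS.matrix_det.continuousAt.inv₀ hA).mul ?_
  have hc : Continuous fun z : (ι → ℝ) × Matrix ι ι ℝ × (ι → ℝ) =>
      z.1 ⬝ᵥ (gramDefect α β z.2.1).adjugate *ᵥ z.2.2 :=
    continuous_fst.dotProduct ((hS.comp continuous_snd.fst).matrix_adjugate.matrix_mulVec
      continuous_snd.snd)
  exact hc.continuousAt.comp (f := fun B => (x B, B, y B)) (hx.prodMk (continuousAt_id.prodMk hy))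

omit [Fintype ι] [DecidableEq ι] in
theorem continuousAt_row (A : Matrix ι ι ℝ) (p : ι) :
    ContinuousAt (fun B : Matrix ι ι ℝ => B p) A :=
  (continuous_apply p).continuousAt

theorem continuousAt_shiftedRow {α β : ι} {A : Matrix ι ι ℝ} (hA : (gramDefect α β A).det ≠ 0)
    (h : invForm α β A (Pi.single β 1) (A β) ≠ 0) : ContinuousAt (shiftedRow α β) A :=
  (continuousAt_row A α).sub (((continuousAt_invForm hA (continuousAt_row A α)
    (continuousAt_row A β)).div (continuousAt_invForm hA continuousAt_const
      (continuousAt_row A β)) h).smul continuousAt_const)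

theorem Tunable.eventually {α β : ι} {A : Matrix ι ι ℝ} (h : Tunable α β A) :
    ∀ᶠ B in 𝓝 A, Tunable α β B := by
  have hs := continuousAt_shiftedRow h.det_ne h.single_ne
  filter_upwards [(continuous_gramDefect α β).matrix_det.continuousAt.eventually_ne h.det_ne,
    (continuousAt_invForm h.det_ne continuousAt_const (continuousAt_row A β)).eventually_ne
      h.single_ne,
    (continuousAt_invForm h.det_ne (continuousAt_row A β) (continuousAt_row A β)).eventually_const_lt
      h.row_pos,
    (continuousAt_invForm h.det_ne hs hs).eventually_const_lt h.shifted_pos] with B h1 h2 h3 h4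
  exact ⟨h1, h2, h3, h4⟩

theorem Tunable.continuousAt_tune {α β : ι} {A : Matrix ι ι ℝ} (h : Tunable α β A) :
    ContinuousAt (tune α β) A := by
  have hs := continuousAt_shiftedRow h.det_ne h.single_ne
  refine continuousAt_pi.2 fun p => ?_
  unfold tune
  split_ifs
  · exact ((continuousAt_invForm h.det_ne hs hs).sqrt.inv₀
      (Real.sqrt_pos.2 h.shifted_pos).ne').smul hs
  · exact ((continuousAt_invForm h.det_ne (continuousAt_row A β)
      (continuousAt_row A β)).sqrt.inv₀ (Real.sqrt_pos.2 h.row_pos).ne').smul (continuousAt_row A β)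
  · exact continuousAt_row A p

theorem gramDefect_diagonal {α β : ι} {d : ι → ℝ} :
    gramDefect α β (diagonal d) =
      diagonal fun p => if p = α ∨ p = β then 1 else 1 - d p ^ 2 := by
  have : rowTrunc α β (diagonal d) = diagonal fun p => if p = α ∨ p = β then 0 else d p := by
    ext p q
    rcases eq_or_ne p q with rfl | h
    · simp [rowTrunc]
    · simp [rowTrunc, h]
  rw [gramDefect, this, diagonal_transpose, diagonal_mul_diagonal, ← diagonal_one, diagonal_sub]
  congr 1
  funext p
  split_ifs <;> ring

theorem invForm_single {α β : ι} {A : Matrix ι ι ℝ} {c : ι → ℝ}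
    (h : gramDefect α β A = diagonal c) (hc : ∀ p, c p ≠ 0) (p q : ι) :
    invForm α β A (Pi.single p 1) (Pi.single q 1) = if p = q then (c p)⁻¹ else 0 := by
  have hdet : (diagonal c).det ≠ 0 := by
    rw [det_diagonal]
    exact Finset.prod_ne_zero_iff.2 fun i _ => hc i
  have hinv : (diagonal c).det⁻¹ • (diagonal c).adjugate = diagonal c⁻¹ := by
    have : (diagonal c)⁻¹ = diagonal c⁻¹ := by
      refine Matrix.inv_eq_right_inv ?_
      rw [diagonal_mul_diagonal, ← diagonal_one]
      congr 1
      funext i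
      simp [hc i]
    rw [← this, Matrix.inv_def, Ring.inverse_eq_inv']
  rw [invForm, h, ← smul_eq_mul, ← dotProduct_smul, ← Matrix.smul_mulVec, hinv]
  rcases eq_or_ne p q with rfl | hpq <;> simp [*]

theorem tunable_diagonal {α β : ι} (hαβ : α ≠ β) {d : ι → ℝ} (hα : d α = 1) (hβ : d β = 1)
    (hd : ∀ p, p ≠ α → p ≠ β → d p ^ 2 ≠ 1) :
    Tunable α β (diagonal d) ∧ tune α β (diagonal d) = diagonal d := by
  have hc : ∀ p, (if p = α ∨ p = β then 1 else 1 - d p ^ 2 : ℝ) ≠ 0 := by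
    intro p
    split_ifs with h
    · exact one_ne_zero
    · push Not at h
      exact sub_ne_zero.2 (hd p h.1 h.2).symm
  have hform := invForm_single (gramDefect_diagonal (α := α) (β := β) (d := d)) hc
  have row : ∀ p, d p = 1 → diagonal d p = Pi.single p 1 := by
    intro p hp
    funext q
    rcases eq_or_ne p q with rfl | h
    · simp [hp]
    · simp [h, h.symm]
  have hshift : shiftedRow α β (diagonal d) = Pi.single α 1 := by
    rw [shiftedRow, row α hα, row β hβ, hform, if_neg hαβ, zero_div, zero_smul, sub_zero]
  have hdet : (gramDefect α β (diagonal d)).det ≠ 0 := by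
    rw [gramDefect_diagonal, det_diagonal]
    exact Finset.prod_ne_zero_iff.2 fun p _ => hc p
  refine ⟨⟨hdet, ?_, ?_, ?_⟩, ?_⟩
  · rw [row β hβ, hform]; simp
  · rw [row β hβ, hform]; simp
  · rw [hshift, hform]; simp
  · funext p
    unfold tune
    split_ifs with h1 h2
    · subst h1
      rw [hshift, hform, row p hα]; simp
    · subst h2
      rw [row p hβ, hform]; simp
    · rfl

end Tuning

section Existence

open Filter Topology

variable {ι : Type*} [Fintype ι] [DecidableEq ι]

theorem exists_diagonal_values {α β : ι} :
    ∃ d : ι → ℝ, d α = 1 ∧ d β = 1 ∧ (∀ p, d p ≠ 0) ∧ (∀ p, p ≠ α → p ≠ β → d p ^ 2 ≠ 1) ∧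
      ∀ p q, d p ^ 2 = d q ^ 2 → p = q ∨ (p = α ∧ q = β) ∨ (p = β ∧ q = α) := by
  have hpos : ∀ p : ι, (0 : ℝ) ≤ (Fintype.equivFin ι p : ℕ) := fun p => Nat.cast_nonneg _
  refine ⟨fun p => if p = α ∨ p = β then 1 else 2 + (Fintype.equivFin ι p : ℕ),
    by simp, by simp, fun p => ?_, fun p h1 h2 => ?_, fun p q h => ?_⟩
  · have := hpos p
    dsimp only
    split_ifs <;> positivity
  · have := hpos p
    simp only [h1, h2, or_self, if_false]
    nlinarith
  · have h1 := hpos p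
    have h2 := hpos q
    dsimp only at h
    split_ifs at h with hp hq hq
    · grind
    · nlinarith
    · nlinarith
    · have := (sq_eq_sq₀ (by positivity) (by positivity)).1 h
      left
      have h3 : (Fintype.equivFin ι p : ℕ) = (Fintype.equivFin ι q : ℕ) := by
        exact_mod_cast (add_left_cancel this)
      exact (Fintype.equivFin ι).injective (Fin.ext h3)

theorem Tunable.invForm_rows_ne_zero {α β : ι} (hαβ : α ≠ β) {A : Matrix ι ι ℝ}
    (hA : Tunable α β A) {f : ℕ → ι} {s : ℕ} (hf : Set.InjOn f {i | i ≤ s})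
    (h0 : f 0 = β) (hs : f s = α)
    (hor : ∀ t < s, (A (f t) (f (t + 1)) ≠ 0 ∧ A (f (t + 1)) (f t) = 0) ∨
      (A (f (t + 1)) (f t) ≠ 0 ∧ A (f t) (f (t + 1)) = 0))
    (hoff : ∀ p q, p ≠ q → A p q ≠ 0 →
      ∃ t < s, (p = f t ∧ q = f (t + 1)) ∨ (p = f (t + 1) ∧ q = f t))
    (hdiag : ∀ p, A p p ≠ 0) (hone : ∀ p, p ≠ α → p ≠ β → A p p ^ 2 ≠ 1) :
    invForm α β A (A α) (A β) ≠ 0 := by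
  intro h
  have hshift : shiftedRow α β A = A α := by
    rw [shiftedRow, h, zero_div, zero_smul, sub_zero]
  obtain ⟨w, hw, hN⟩ := hA.exists_linearIndependent hαβ
  have hne : ∀ p q, tune α β A p q ≠ 0 ↔ A p q ≠ 0 := by
    intro p q
    have h3 := (Real.sqrt_pos.2 hA.shifted_pos).ne'
    have h4 := (Real.sqrt_pos.2 hA.row_pos).ne'
    rw [hshift] at h3
    unfold tune
    rw [hshift]
    split_ifs with h1 h2
    · subst h1; simp [h3]
    · subst h2; simp [h4]
    · rfl
  have heq : ∀ p q, tune α β A p q = 0 ↔ A p q = 0 := fun p q => not_iff_not.1 (hne p q)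
  refine not_linearIndependent_of_path hf (fun t ht => ?_) (fun p q hpq hp => ?_)
    (fun p => (hne p p).2 (hdiag p)) (fun p hp => ?_) hN hw
  · simp only [hne, heq]; exact hor t ht
  · exact hoff p q hpq ((hne p q).1 hp)
  · have h1 : p ≠ β := h0 ▸ hp 0 (Nat.zero_le _)
    have h2 : p ≠ α := hs ▸ hp s le_rfl
    have : tune α β A p p = A p p := by simp [tune, h1, h2]
    rw [this]
    exact hone p h2 h1

theorem exists_ssvp_of_reachable {R : ι → ι → Prop} (hdiag : ∀ p, R p p) {α β : ι} (hαβ : α ≠ β)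
    (hR : R α β)
    (hconn : (SimpleGraph.fromRel fun p q => R p q ∧ ¬ (p = α ∧ q = β)).Reachable β α) :
    ∃ N : Matrix ι ι ℝ, (∀ p q, N p q ≠ 0 ↔ R p q) ∧ SSVP N ∧ 2 ≤ singValMult N 1 := by
  classical
  obtain ⟨d, hdα, hdβ, hd0, hd1, hd⟩ := exists_diagonal_values (α := α) (β := β)
  obtain ⟨htun, htune⟩ := tunable_diagonal hαβ hdα hdβ hd1
  let Good : Matrix ι ι ℝ → Prop := fun A => Tunable α β A ∧
    ∀ X : Matrix ι ι ℝ, (∀ p q, R p q → X p q = 0) →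
      ((tune α β A)ᵀ * X).IsSymm → (X * (tune α β A)ᵀ).IsSymm → X = 0
  have hgood : ∀ᶠ A in 𝓝 (diagonal d), Good A := by
    have hcont := htun.continuousAt_tune
    rw [ContinuousAt, htune] at hcont
    exact htun.eventually.and (hcont.eventually (eventually_ssvp_restricted R (diagonal d)
      (diagonal_ssvp_restricted hd hdiag hR hdα hdβ)))
  obtain ⟨w, hw⟩ := hconn.exists_isPath
  set f := w.getVert with hf
  set s := w.length with hs
  have hinj : Set.InjOn f {i | i ≤ s} := hw.getVert_injOn
  have hf0 : f 0 = β := w.getVert_zero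
  have hfs : f s = α := w.getVert_length
  have hadj : ∀ t < s, f t ≠ f (t + 1) ∧
      ((R (f t) (f (t + 1)) ∧ ¬ (f t = α ∧ f (t + 1) = β)) ∨
        (R (f (t + 1)) (f t) ∧ ¬ (f (t + 1) = α ∧ f t = β))) := by
    intro t ht
    have := w.adj_getVert_succ ht
    rwa [SimpleGraph.fromRel_adj] at this
  let o : ℕ → Prop := fun t => R (f t) (f (t + 1)) ∧ ¬ (f t = α ∧ f (t + 1) = β)
  let B : ι → ι → Prop := fun p q =>
    ∃ t < s, (o t ∧ p = f t ∧ q = f (t + 1)) ∨ (¬ o t ∧ p = f (t + 1) ∧ q = f t)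
  have hBR : ∀ p q, B p q → R p q ∧ ¬ (p = α ∧ q = β) := by
    rintro p q ⟨t, ht, ⟨ho, rfl, rfl⟩ | ⟨ho, rfl, rfl⟩⟩
    · exact ho
    · exact (hadj t ht).2.resolve_left ho
  let W : ℝ → ℝ → Matrix ι ι ℝ := fun δ ε p q =>
    if p = q then d p else if B p q then δ
    else if R p q ∧ ¬ (p = α ∧ q = β) then ε else 0
  have hW0 : W 0 0 = diagonal d := by
    ext p q
    rcases eq_or_ne p q with rfl | h
    · simp [W]
    · simp [W, h]
  have hWδ : Continuous fun δ => W δ 0 := by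
    refine continuous_matrix fun p q => ?_
    dsimp only [W]
    split_ifs <;> fun_prop
  have hWε : ∀ δ, Continuous fun ε => W δ ε := by
    intro δ
    refine continuous_matrix fun p q => ?_
    dsimp only [W]
    split_ifs <;> fun_prop
  have hW : ∀ {δ ε}, δ ≠ 0 → ε ≠ 0 → ∀ p q, ¬ (p = α ∧ q = β) → (W δ ε p q ≠ 0 ↔ R p q) := by
    intro δ ε hδ hε p q hpq
    dsimp only [W]
    split_ifs with h1 h2 h3
    · subst h1; simp [hd0, hdiag]
    · simp [hδ, (hBR p q h2).1]
    · simp [hε, h3.1]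
    · simpa using fun h => h3 ⟨h, hpq⟩
  have hWαβ : ∀ δ ε, W δ ε α β = 0 := by
    intro δ ε
    have : ¬ B α β := fun h => (hBR _ _ h).2 ⟨rfl, rfl⟩
    simp [W, hαβ, this]
  obtain ⟨δ, hδ, hδ0⟩ : ∃ δ, (∀ᶠ A in 𝓝 (W δ 0), Good A) ∧ δ ≠ 0 := by
    have h1 : Tendsto (fun δ => W δ 0) (𝓝[≠] 0) (𝓝 (diagonal d)) := by
      rw [← hW0]
      exact hWδ.continuousAt.tendsto.mono_left nhdsWithin_le_nhds
    exact ((h1.eventually hgood.eventually_nhds).and eventually_mem_nhdsWithin).exists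
  have hrows : invForm α β (W δ 0) (W δ 0 α) (W δ 0 β) ≠ 0 := by
    have hB : ∀ p q, p ≠ q → (W δ 0 p q ≠ 0 ↔ B p q) := by
      intro p q hpq
      simp [W, hpq, hδ0]
    have hB' : ∀ p q, p ≠ q → (W δ 0 p q = 0 ↔ ¬ B p q) := fun p q hpq => by
      rw [← hB p q hpq, not_not]
    refine hδ.self_of_nhds.1.invForm_rows_ne_zero hαβ hinj hf0 hfs (fun t ht => ?_)
      (fun p q hpq h => ?_) (fun p => by simp [W, hd0]) (fun p h1 h2 => by simpa [W] using hd1 p h1 h2)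
    · have hne := (hadj t ht).1
      rw [hB _ _ hne, hB _ _ hne.symm, hB' _ _ hne, hB' _ _ hne.symm]
      have aux : ∀ {i j}, i ≤ s → j ≤ s → f i = f j → i = j := fun hi hj h => hinj hi hj h
      by_cases ho : o t
      · refine Or.inl ⟨⟨t, ht, Or.inl ⟨ho, rfl, rfl⟩⟩, ?_⟩
        rintro ⟨i, hi, ⟨-, h1, h2⟩ | ⟨ho', h1, h2⟩⟩
        · have := aux ht hi.le h1
          have := aux ht.le hi h2
          omega
        · obtain rfl := aux ht.le hi.le h2
          exact ho' ho
      · refine Or.inr ⟨⟨t, ht, Or.inr ⟨ho, rfl, rfl⟩⟩, ?_⟩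
        rintro ⟨i, hi, ⟨ho', h1, h2⟩ | ⟨-, h1, h2⟩⟩
        · obtain rfl := aux ht.le hi.le h1
          exact ho ho'
        · have := aux ht.le hi h1
          have := aux ht hi.le h2
          omega
    · obtain ⟨t, ht, h⟩ := (hB p q hpq).1 h
      exact ⟨t, ht, by tauto⟩
  obtain ⟨ε, ⟨⟨hA, hX⟩, hρ⟩, hε0⟩ : ∃ ε, (Good (W δ ε) ∧
      invForm α β (W δ ε) (W δ ε α) (W δ ε β) ≠ 0) ∧ ε ≠ 0 := by
    have h1 : Tendsto (fun ε => W δ ε) (𝓝[≠] 0) (𝓝 (W δ 0)) :=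
      (hWε δ).continuousAt.tendsto.mono_left nhdsWithin_le_nhds
    have h2 := (continuousAt_invForm hδ.self_of_nhds.1.det_ne (continuousAt_row _ α)
      (continuousAt_row _ β)).eventually_ne hrows
    exact ((h1.eventually (hδ.and h2)).and eventually_mem_nhdsWithin).exists
  have hpat : ∀ p q, tune α β (W δ ε) p q ≠ 0 ↔ R p q := by
    intro p q
    have h3 := (Real.sqrt_pos.2 hA.shifted_pos).ne'
    have h4 := (Real.sqrt_pos.2 hA.row_pos).ne'
    unfold tune
    split_ifs with h1 h2
    · subst h1
      rw [Pi.smul_apply, smul_eq_mul, mul_ne_zero_iff_left (inv_ne_zero h3)]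
      by_cases hq : q = β
      · subst hq
        simp [shiftedRow, hWαβ, hρ, hA.single_ne, hR]
      · rw [← hW hδ0 hε0 p q (by tauto)]
        simp [shiftedRow, hq]
    · subst h2
      rw [Pi.smul_apply, smul_eq_mul, mul_ne_zero_iff_left (inv_ne_zero h4)]
      exact hW hδ0 hε0 p q (by tauto)
    · exact hW hδ0 hε0 p q (by tauto)
  obtain ⟨v, hv, hN⟩ := hA.exists_linearIndependent hαβ
  refine ⟨tune α β (W δ ε), hpat, fun X h1 h2 h3 => hX X (fun p q h => ?_) h1 h2,
    two_le_singValMult_one hv hN⟩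
  exact (mul_eq_zero.1 (h3 p q)).resolve_left ((hpat p q).2 h)

end Existence

section Blocks

theorem SSVP.submatrix_right {ι : Type*} [Fintype ι] {N : Matrix ι ι ℝ}
    (hN : SSVP N) (σ : Equiv.Perm ι) : SSVP (N.submatrix id σ) := by
  intro X h1 h2 h3
  have hX : X = (X.submatrix id σ.symm).submatrix id σ := by
    ext i j; simp
  have h0 : X.submatrix id σ.symm = 0 := by
    refine hN _ ?_ ?_ fun i j => ?_
    · have := h1.submatrix σ.symm
      have heq : ((N.submatrix id σ)ᵀ * X).submatrix σ.symm σ.symm =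
          Nᵀ * X.submatrix id σ.symm := by
        ext i j; simp [Matrix.mul_apply]
      rwa [heq] at this
    · rw [hX, Matrix.transpose_submatrix, Matrix.submatrix_mul_equiv] at h2
      exact h2
    · simpa using h3 i (σ.symm j)
  rw [hX, h0, Matrix.submatrix_zero]
  rfl

theorem singValMult_submatrix_right {ι : Type*} [Fintype ι] [DecidableEq ι]
    (N : Matrix ι ι ℝ) (σ : Equiv.Perm ι) (x : ℝ) :
    singValMult (N.submatrix id σ) x = singValMult N x := by
  rw [singValMult, Matrix.transpose_submatrix, Matrix.submatrix_mul_equiv, Matrix.submatrix_id_id,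
    singValMult]

theorem reachable_of_bigraph_connected {m : ℕ} {P : Matrix (Fin m) (Fin m) ℝ}
    (hP : (bigraph P).Connected) (σ : Equiv.Perm (Fin m)) {V : Type*} {G : SimpleGraph V}
    {e : Fin m → V} (he : ∀ i j, P i (σ j) = 1 → G.Reachable (e i) (e j)) (i j : Fin m) :
    G.Reachable (e i) (e j) := by
  have key : ∀ {x y : Fin m ⊕ Fin m}, (bigraph P).Walk x y →
      G.Reachable (Sum.elim e (e ∘ σ.symm) x) (Sum.elim e (e ∘ σ.symm) y) := by
    intro x y w
    induction w with
    | nil => rfl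
    | cons hadj _ ih =>
      refine SimpleGraph.Reachable.trans ?_ ih
      obtain ⟨-, ⟨i, j, rfl, rfl, hij⟩ | ⟨i, j, rfl, rfl, hij⟩⟩ :=
        (SimpleGraph.fromRel_adj _ _ _).1 hadj
      · exact he i (σ.symm j) (by simpa using hij)
      · exact (he i (σ.symm j) (by simpa using hij)).symm
  obtain ⟨w⟩ := hP.preconnected (Sum.inl i) (Sum.inl j)
  exact key w

end Blocks

/-- If `P` and `Q` are square patterns of full term-rank with connected bigraphs, and the
patterns `E`, `F` carry at least two `1` entries total, then the block pattern
`[[P, E], [F, Q]]` allows a matrix with the SSVP and a multiple singular value. -/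
theorem sumplus {m n : ℕ}
    (P : Matrix (Fin m) (Fin m) ℝ) (Q : Matrix (Fin n) (Fin n) ℝ)
    (E : Matrix (Fin m) (Fin n) ℝ) (F : Matrix (Fin n) (Fin m) ℝ)
    (hP : IsPattern P) (hQ : IsPattern Q) (hE : IsPattern E) (hF : IsPattern F)
    (hPtr : ∃ σ : Equiv.Perm (Fin m), ∀ i, P i (σ i) = 1)
    (hQtr : ∃ σ : Equiv.Perm (Fin n), ∀ i, Q i (σ i) = 1)
    (hPc : (bigraph P).Connected) (hQc : (bigraph Q).Connected)
    (hEF : 2 ≤ Fintype.card {p : Fin m × Fin n // E p.1 p.2 = 1}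
            + Fintype.card {p : Fin n × Fin m // F p.1 p.2 = 1}) :
    ∃ A : Matrix (Fin m ⊕ Fin n) (Fin m ⊕ Fin n) ℝ,
      HasPattern A (Matrix.fromBlocks P E F Q) ∧ SSVP A ∧
      ∃ σ : ℝ, 0 ≤ σ ∧ 2 ≤ singValMult A σ := by
  obtain ⟨σP, hσP⟩ := hPtr
  obtain ⟨σQ, hσQ⟩ := hQtr
  let σ : Equiv.Perm (Fin m ⊕ Fin n) := Equiv.sumCongr σP σQ
  let R : Fin m ⊕ Fin n → Fin m ⊕ Fin n → Prop := fun p q =>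
    Matrix.fromBlocks P E F Q p (σ q) = 1
  have hdiag : ∀ p, R p p := by
    rintro (i | i)
    · exact hσP i
    · exact hσQ i
  have hblock : ∀ {α β x y : Fin m ⊕ Fin n}, α.isLeft ≠ β.isLeft → x.isLeft = y.isLeft →
      (SimpleGraph.fromRel fun p q => R p q ∧ ¬ (p = α ∧ q = β)).Reachable x y := by
    intro α β x y hαβ hxy
    have hadj : ∀ p q, p.isLeft = q.isLeft → R p q →
        (SimpleGraph.fromRel fun p q => R p q ∧ ¬ (p = α ∧ q = β)).Reachable p q := by
      intro p q hpq h
      by_cases hne : p = q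
      · rw [hne]
      · refine SimpleGraph.Adj.reachable ((SimpleGraph.fromRel_adj _ _ _).2 ⟨hne, Or.inl ⟨h, ?_⟩⟩)
        rintro ⟨rfl, rfl⟩
        exact hαβ hpq
    rcases x with x | x <;> rcases y with y | y
    · exact reachable_of_bigraph_connected hPc σP (e := Sum.inl) (fun i j h => hadj _ _ rfl h) x y
    · simp at hxy
    · simp at hxy
    · exact reachable_of_bigraph_connected hQc σQ (e := Sum.inr) (fun i j h => hadj _ _ rfl h) x y
  obtain ⟨α, β, γ, δ, hαβ, hγδ, hRαβ, hRγδ, hne⟩ : ∃ α β γ δ : Fin m ⊕ Fin n,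
      α.isLeft ≠ β.isLeft ∧ γ.isLeft ≠ δ.isLeft ∧ R α β ∧ R γ δ ∧ ¬ (γ = α ∧ δ = β) := by
    rw [← Fintype.card_sum] at hEF
    obtain ⟨a, b, hab⟩ := Fintype.one_lt_card_iff.1 hEF
    rcases a with ⟨⟨i, j⟩, h⟩ | ⟨⟨i, j⟩, h⟩ <;> rcases b with ⟨⟨k, l⟩, h'⟩ | ⟨⟨k, l⟩, h'⟩
    · refine ⟨Sum.inl i, Sum.inr (σQ.symm j), Sum.inl k, Sum.inr (σQ.symm l), by simp, by simp,
        by simpa [R, σ] using h, by simpa [R, σ] using h', ?_⟩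
      simp only [Sum.inl.injEq, Sum.inr.injEq, EmbeddingLike.apply_eq_iff_eq]
      rintro ⟨rfl, rfl⟩
      exact hab rfl
    · exact ⟨Sum.inl i, Sum.inr (σQ.symm j), Sum.inr k, Sum.inl (σP.symm l), by simp, by simp,
        by simpa [R, σ] using h, by simpa [R, σ] using h', by simp⟩
    · exact ⟨Sum.inr i, Sum.inl (σP.symm j), Sum.inl k, Sum.inr (σQ.symm l), by simp, by simp,
        by simpa [R, σ] using h, by simpa [R, σ] using h', by simp⟩
    · refine ⟨Sum.inr i, Sum.inl (σP.symm j), Sum.inr k, Sum.inl (σP.symm l), by simp, by simp,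
        by simpa [R, σ] using h, by simpa [R, σ] using h', ?_⟩
      simp only [Sum.inl.injEq, Sum.inr.injEq, EmbeddingLike.apply_eq_iff_eq]
      rintro ⟨rfl, rfl⟩
      exact hab rfl
  have hconn : (SimpleGraph.fromRel fun p q => R p q ∧ ¬ (p = α ∧ q = β)).Reachable β α := by
    have h : (SimpleGraph.fromRel fun p q => R p q ∧ ¬ (p = α ∧ q = β)).Reachable γ δ :=
      SimpleGraph.Adj.reachable ((SimpleGraph.fromRel_adj _ _ _).2
        ⟨fun h => hγδ (congrArg _ h), Or.inl ⟨hRγδ, hne⟩⟩)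
    by_cases hγ : γ.isLeft = α.isLeft
    · have hδ : β.isLeft = δ.isLeft := by grind
      exact ((hblock hαβ hδ).trans h.symm).trans (hblock hαβ hγ)
    · have hβ : β.isLeft = γ.isLeft := by grind
      have hδ : δ.isLeft = α.isLeft := by grind
      exact ((hblock hαβ hβ).trans h).trans (hblock hαβ hδ)
  obtain ⟨N, hpat, hS, hmult⟩ :=
    exists_ssvp_of_reachable hdiag (fun h => hαβ (congrArg _ h)) hRαβ hconn
  refine ⟨N.submatrix id σ.symm, fun i j => ?_, hS.submatrix_right σ.symm, 1, zero_le_one, ?_⟩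
  · rw [Matrix.submatrix_apply, hpat]
    simp [R]
  · rwa [singValMult_submatrix_right]
end

section
/- Let W be an n×n pattern in standard form whose digraph contains a weak cycle. Then there exists a real matrix in Z(W) with the SSVP and a multiple singular value. -/
open Matrix Polynomial

/-- The digraph of an `n × n` pattern in standard form contains a weak cycle:
there are `k ≥ 2` distinct vertices `u 0, …, u (k-1)` and, between each pair of cyclically
consecutive vertices, an arc (in the direction recorded by `d`), these `k` arcs being
pairwise distinct.  Ignoring orientations this is a cycle (length `2` is allowed, in which
case the two arcs `i→j` and `j→i` must both be present). -/
def HasWeakCycle {n : ℕ} (P : Matrix (Fin n) (Fin n) ℝ) : Prop :=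
  ∃ k : ℕ, 2 ≤ k ∧ ∃ (u : ZMod k → Fin n) (d : ZMod k → Bool),
    Function.Injective u ∧
    Function.Injective (fun t : ZMod k =>
      if d t then (u t, u (t + 1)) else (u (t + 1), u t)) ∧
    ∀ t : ZMod k, P (if d t then u t else u (t + 1)) (if d t then u (t + 1) else u t) = 1

section Kernel

variable {ι : Type*} [Fintype ι] [DecidableEq ι]

/-- Singular vectors of a matrix whose off-diagonal entries lie along a path vanish on the whole
path as soon as they vanish at its initial vertex. -/
lemma singularVector_eq_zero_of_path (A : Matrix ι ι ℝ) (m : ℕ) (v : ℕ → ι) (dir : ℕ → Prop)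
    (hinj : ∀ s ≤ m, ∀ t ≤ m, v s = v t → s = t) (hdiag : ∀ i, A i i ≠ 0)
    (hsupp : ∀ i j, i ≠ j → A i j ≠ 0 → ∃ t < m,
      (dir t ∧ i = v t ∧ j = v (t + 1)) ∨ (¬ dir t ∧ i = v (t + 1) ∧ j = v t))
    (hout : ∀ t < m, dir t → A (v t) (v (t + 1)) ≠ 0)
    (hin : ∀ t < m, ¬ dir t → A (v (t + 1)) (v t) ≠ 0)
    (x y : ι → ℝ) (hrow : ∀ i, ∑ j, A i j * y j = x i) (hcol : ∀ j, ∑ i, A i j * x i = y j)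
    (h0 : x (v 0) = 0) : ∀ t ≤ m, x (v t) = 0 ∧ y (v t) = 0 := by
  have link : ∀ t ≤ m, (∀ s < t, x (v s) = 0 ∧ y (v s) = 0) →
      A (v t) (v t) * y (v t) = x (v t) ∨ A (v t) (v t) * x (v t) = y (v t) := by
    intro t ht hs
    by_cases hd : dir t
    · right
      rw [← hcol, Finset.sum_eq_single (v t)]
      · intro i _ hi
        by_contra hne
        obtain ⟨s, hsm, ⟨-, h1, h2⟩ | ⟨hds, h1, h2⟩⟩ := hsupp i (v t) hi (left_ne_zero_of_mul hne)
        · have := hinj _ ht _ hsm h2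
          exact right_ne_zero_of_mul hne (h1 ▸ (hs s (by omega)).1)
        · have := hinj _ ht _ hsm.le h2
          exact hds (this ▸ hd)
      · simp
    · left
      rw [← hrow, Finset.sum_eq_single (v t)]
      · intro j _ hj
        by_contra hne
        obtain ⟨s, hsm, ⟨hds, h1, h2⟩ | ⟨-, h1, h2⟩⟩ :=
          hsupp (v t) j hj.symm (left_ne_zero_of_mul hne)
        · have := hinj _ ht _ hsm.le h1
          exact hd (this ▸ hds)
        · have := hinj _ ht _ hsm h1
          exact right_ne_zero_of_mul hne (h2 ▸ (hs s (by omega)).2)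
      · simp
  have both : ∀ t ≤ m, (∀ s < t, x (v s) = 0 ∧ y (v s) = 0) →
      (x (v t) = 0 ∨ y (v t) = 0) → x (v t) = 0 ∧ y (v t) = 0 := by
    intro t ht hs hxy
    have hd := hdiag (v t)
    rcases link t ht hs with h | h <;> rcases hxy with h' | h' <;> simp_all
  intro t
  induction t using Nat.strong_induction_on with
  | _ t ih =>
    intro ht
    have hs : ∀ s < t, x (v s) = 0 ∧ y (v s) = 0 := fun s hst => ih s hst (hst.le.trans ht)
    refine both t ht hs ?_
    cases t with
    | zero => exact Or.inl h0
    | succ t =>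
      have htm : t < m := ht
      have hvt := hs t (Nat.lt_succ_self t)
      by_cases hd : dir t
      · right
        have h := hrow (v t)
        rw [Finset.sum_eq_single (v (t + 1)), hvt.1] at h
        · exact (mul_eq_zero.1 h).resolve_left (hout t htm hd)
        · intro j _ hj
          by_contra hne
          by_cases hjt : v t = j
          · exact right_ne_zero_of_mul hne (hjt ▸ hvt.2)
          obtain ⟨s, hsm, ⟨-, h1, h2⟩ | ⟨-, h1, h2⟩⟩ :=
            hsupp (v t) j hjt (left_ne_zero_of_mul hne)
          · exact hj (hinj _ htm.le _ hsm.le h1 ▸ h2)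
          · have := hinj _ htm.le _ hsm h1
            exact right_ne_zero_of_mul hne (h2 ▸ (hs s (by omega)).2)
        · simp
      · left
        have h := hcol (v t)
        rw [Finset.sum_eq_single (v (t + 1)), hvt.2] at h
        · exact (mul_eq_zero.1 h).resolve_left (hin t htm hd)
        · intro j _ hj
          by_contra hne
          by_cases hjt : j = v t
          · exact right_ne_zero_of_mul hne (hjt ▸ hvt.1)
          obtain ⟨s, hsm, ⟨-, h1, h2⟩ | ⟨-, h1, h2⟩⟩ :=
            hsupp j (v t) hjt (left_ne_zero_of_mul hne)
          · have := hinj _ htm.le _ hsm h2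
            exact right_ne_zero_of_mul hne (h1 ▸ (hs s (by omega)).1)
          · exact hj (hinj _ htm.le _ hsm.le h2 ▸ h1)
        · simp

lemma two_le_singValMult_one_s2 (A : Matrix ι ι ℝ) {p q : ι} (x x' : ι → ℝ)
    (hx : (A * Aᵀ) *ᵥ x = x) (hx' : (A * Aᵀ) *ᵥ x' = x')
    (hp : x p = 1) (hq : x q = 0) (hp' : x' p = 0) (hq' : x' q = 1) :
    2 ≤ singValMult A 1 := by
  have hli : LinearIndependent ℝ ![x, x'] := by
    rw [LinearIndependent.pair_iff]
    intro s t h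
    have h1 := congrFun h p
    have h2 := congrFun h q
    simp [hp, hq, hp', hq'] at h1 h2
    exact ⟨h1, h2⟩
  have hle := LinearMap.finrank_eigenspace_le (Matrix.toLin' (A * Aᵀ)) (1 : ℝ)
  rw [Matrix.charpoly_toLin'] at hle
  rw [singValMult, one_pow]
  refine le_trans ?_ hle
  have hspan : Submodule.span ℝ (Set.range ![x, x']) ≤
      Module.End.eigenspace (Matrix.toLin' (A * Aᵀ)) (1 : ℝ) := by
    rw [Submodule.span_le]
    rintro _ ⟨i, rfl⟩
    fin_cases i <;> simp [hx, hx']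
  calc 2 = Module.finrank ℝ (Submodule.span ℝ (Set.range ![x, x'])) := by
        rw [finrank_span_eq_card hli]; simp
    _ ≤ _ := Submodule.finrank_mono hspan

/-- The bordered Gram matrix `A Aᵀ - 1 + P`, with `P` the coordinate projection onto `{p, q}`. -/
def borderedGram (p q : ι) (A : Matrix ι ι ℝ) : Matrix ι ι ℝ :=
  A * Aᵀ - 1 + diagonal fun i => if i = p ∨ i = q then 1 else 0

lemma gram_mulVec_inverse_col {p q : ι} (hpq : p ≠ q) (A G : Matrix ι ι ℝ)
    (hG : borderedGram p q A * G = 1) (hGp : G p p = 1) (hGq : G q q = 1)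
    (hGpq : G p q = 0) (hGqp : G q p = 0) {r : ι} (hr : r = p ∨ r = q) :
    (A * Aᵀ) *ᵥ (fun i => G i r) = fun i => G i r := by
  ext i
  have h := congrFun (congrFun hG i) r
  rw [borderedGram, add_mul, sub_mul, one_mul, Matrix.add_apply, Matrix.sub_apply, diagonal_mul,
    Matrix.one_apply] at h
  have h2 : ((A * Aᵀ) *ᵥ (fun i => G i r)) i = ((A * Aᵀ) * G) i r := by
    simp only [mulVec, dotProduct, Matrix.mul_apply]
  rw [h2]
  rcases hr with hr | hr <;> subst hr <;> split_ifs at h with h3 h4 h4 <;> grind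

lemma borderedGram_isSymm (p q : ι) (A : Matrix ι ι ℝ) : (borderedGram p q A).IsSymm := by
  simp [Matrix.IsSymm, borderedGram, transpose_mul]

end Kernel

section Analysis

open scoped Matrix.Norms.Operator

variable {ι : Type*} [Fintype ι] [DecidableEq ι]

/-- The linear conditions whose only common solution is zero when `A` has the strong singular
value property and nonzero entries on the diagonal and at `(p, q)`. -/
noncomputable def strongCondition (p q : ι) (A : Matrix ι ι ℝ) :
    Matrix ι ι ℝ →ₗ[ℝ] Matrix ι ι ℝ × Matrix ι ι ℝ × (ι → ℝ) × ℝ where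
  toFun X := (Aᵀ * X - Xᵀ * A, X * Aᵀ - A * Xᵀ, fun i => X i i, X p q)
  map_add' X Y := by
    ext <;> simp [mul_add, add_mul] <;> ring
  map_smul' c X := by
    ext <;> simp [mul_sub]

lemma SSVP.of_strongCondition_injective {p q : ι} {A : Matrix ι ι ℝ}
    (h : Function.Injective (strongCondition p q A)) (hdiag : ∀ i, A i i ≠ 0)
    (hpq : A p q ≠ 0) : SSVP A := by
  intro X h1 h2 h3
  apply h
  rw [map_zero]
  rw [Matrix.IsSymm, transpose_mul, transpose_transpose] at h1 h2
  have h4 : ∀ i, X i i = 0 := fun i => (mul_eq_zero.1 (h3 i i)).resolve_left (hdiag i)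
  have h5 : X p q = 0 := (mul_eq_zero.1 (h3 p q)).resolve_left hpq
  simp only [strongCondition, LinearMap.coe_mk, AddHom.coe_mk, h1, h2, h4, h5, sub_self]
  rfl

lemma isOpen_strongCondition_injective (p q : ι) :
    IsOpen {A : Matrix ι ι ℝ | Function.Injective (strongCondition p q A)} := by
  have hc : Continuous fun A : Matrix ι ι ℝ =>
      LinearMap.toContinuousLinearMap (strongCondition p q A) := by
    refine continuous_clm_apply.2 fun X => ?_
    change Continuous fun A : Matrix ι ι ℝ =>
      (Aᵀ * X - Xᵀ * A, X * Aᵀ - A * Xᵀ, (fun i => X i i), X p q)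
    fun_prop
  exact (ContinuousLinearMap.isOpen_injective (𝕜 := ℝ)).preimage hc

lemma strongCondition_diagonal_injective {p q : ι} {d : ι → ℝ}
    (hp : d p = 1) (hq : d q = 1)
    (hd : ∀ i j, i ≠ j → d i ^ 2 = d j ^ 2 → (i = p ∧ j = q) ∨ (i = q ∧ j = p)) :
    Function.Injective (strongCondition p q (diagonal d)) := by
  rw [injective_iff_map_eq_zero]
  intro X hX
  simp only [strongCondition, LinearMap.coe_mk, AddHom.coe_mk, Prod.mk_eq_zero,
    diagonal_transpose] at hX
  obtain ⟨h1, h2, h3, h4⟩ := hX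
  have e1 : ∀ i j, d i * X i j = d j * X j i := by
    intro i j
    have := congrFun (congrFun h1 i) j
    simp [sub_eq_zero] at this
    linarith
  have e2 : ∀ i j, X i j * d j = d i * X j i := by
    intro i j
    have := congrFun (congrFun h2 i) j
    simp [sub_eq_zero] at this
    linarith
  ext i j
  by_cases hij : i = j
  · exact hij ▸ congrFun h3 i
  by_cases hdd : d i ^ 2 = d j ^ 2
  · rcases hd i j hij hdd with ⟨rfl, rfl⟩ | ⟨rfl, rfl⟩
    · exact h4
    · have := e1 i j
      rw [hp, hq, h4] at this
      simpa using this
  · have : (d i ^ 2 - d j ^ 2) * X i j = 0 := by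
      have h5 := e1 i j
      have h6 := e2 i j
      linear_combination d i * h5 - d j * h6
    exact (mul_eq_zero.1 this).resolve_left (sub_ne_zero.2 hdd)

/-- The positions carrying the conditions for a double unit singular value. -/
def blockMask (p q i j : ι) : Prop :=
  (i = p ∧ j = p) ∨ (i = q ∧ j = q) ∨ (i = p ∧ j = q)

instance (p q i j : ι) : Decidable (blockMask p q i j) := by
  unfold blockMask; infer_instance

/-- Replace the entries of `A` at the positions in `blockMask p q` by those of `G`. -/
noncomputable def blockReplace (p q : ι) :
    Matrix ι ι ℝ × Matrix ι ι ℝ →L[ℝ] Matrix ι ι ℝ :=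
  LinearMap.toContinuousLinearMap
    { toFun := fun Y => Matrix.of fun i j => if blockMask p q i j then Y.1 i j else Y.2 i j
      map_add' := by
        intro Y Z; ext i j; simp only [of_apply, Matrix.add_apply, Prod.fst_add, Prod.snd_add]
        split_ifs <;> rfl
      map_smul' := by
        intro c Y; ext i j
        simp only [of_apply, Matrix.smul_apply, Prod.smul_fst, Prod.smul_snd, RingHom.id_apply]
        split_ifs <;> rfl }

lemma blockReplace_apply (p q : ι) (G A : Matrix ι ι ℝ) (i j : ι) :
    blockReplace p q (G, A) i j = if blockMask p q i j then G i j else A i j := rfl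

/-- The map whose value records the entries of `A` outside `blockMask p q` and the entries of the
inverse of the bordered Gram matrix inside it. -/
noncomputable def gramChart (p q : ι) (A : Matrix ι ι ℝ) : Matrix ι ι ℝ :=
  blockReplace p q (Ring.inverse (borderedGram p q A), A)

lemma hasStrictFDerivAt_borderedGram (p q : ι) (A : Matrix ι ι ℝ) :
    ∃ L : Matrix ι ι ℝ →L[ℝ] Matrix ι ι ℝ, (∀ E, L E = A * Eᵀ + E * Aᵀ) ∧
      HasStrictFDerivAt (borderedGram p q) L A := by
  let T : Matrix ι ι ℝ →L[ℝ] Matrix ι ι ℝ :=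
    LinearMap.toContinuousLinearMap (Matrix.transposeLinearEquiv ι ι ℝ ℝ).toLinearMap
  have h := ((hasStrictFDerivAt_id (𝕜 := ℝ) A).mul' (T.hasStrictFDerivAt (x := A)))
  have h2 := (h.sub_const 1).add_const (diagonal fun i => if i = p ∨ i = q then (1 : ℝ) else 0)
  refine ⟨_, ?_, h2⟩
  intro E
  rfl

lemma exists_gramChart_localInverse {p q : ι} (hpq : p ≠ q) {d : ι → ℝ}
    (hp : d p = 1) (hq : d q = 1) (hd : ∀ i, i ≠ p → i ≠ q → d i ^ 2 ≠ 1)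
    {U : Set (Matrix ι ι ℝ)} (hU : IsOpen U) (hDU : diagonal d ∈ U) :
    ∃ (V : Set (Matrix ι ι ℝ)) (g : Matrix ι ι ℝ → Matrix ι ι ℝ), IsOpen V ∧ diagonal d ∈ V ∧
      ContinuousOn g V ∧ ∀ B ∈ V, g B ∈ U ∧ IsUnit (borderedGram p q (g B)) ∧
        gramChart p q (g B) = B := by
  set k : ι → ℝ := fun i => if i = p ∨ i = q then 1 else d i ^ 2 - 1 with hk
  have hk0 : ∀ i, k i ≠ 0 := by
    intro i
    simp only [hk]
    split_ifs with h
    · exact one_ne_zero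
    · push Not at h
      exact sub_ne_zero.2 (hd i h.1 h.2)
  have hK : borderedGram p q (diagonal d) = diagonal k := by
    rw [borderedGram, diagonal_transpose, diagonal_mul_diagonal, ← diagonal_one,
      diagonal_sub, diagonal_add]
    congr 1
    ext i
    simp only [hk]
    split_ifs with h
    · rcases h with rfl | rfl <;> simp [hp, hq]
    · ring
  let K : (Matrix ι ι ℝ)ˣ :=
    ⟨diagonal k, diagonal fun i => (k i)⁻¹, by simp [hk0], by simp [hk0]⟩
  have hKu : borderedGram p q (diagonal d) = (K : Matrix ι ι ℝ) := hK
  have hKi : ((K⁻¹ : (Matrix ι ι ℝ)ˣ) : Matrix ι ι ℝ) = diagonal fun i => (k i)⁻¹ := rfl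
  obtain ⟨L, hL, hLd⟩ := hasStrictFDerivAt_borderedGram p q (diagonal d)
  have hinv := hasStrictFDerivAt_ringInverse (𝕜 := ℝ) K
  rw [← hKu] at hinv
  have hchart := (blockReplace p q).hasStrictFDerivAt.comp (diagonal d)
    ((hinv.comp (diagonal d) hLd).prodMk (hasStrictFDerivAt_id (𝕜 := ℝ) (diagonal d)))
  set Φ' := (blockReplace p q).comp
    (((-ContinuousLinearMap.mulLeftRight ℝ (Matrix ι ι ℝ) ↑K⁻¹ ↑K⁻¹).comp L).prod
      (ContinuousLinearMap.id ℝ (Matrix ι ι ℝ))) with hΦ'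
  have happ : ∀ E i j, Φ' E i j = if blockMask p q i j then
      -((k i)⁻¹ * (d i * E j i + E i j * d j) * (k j)⁻¹) else E i j := by
    intro E i j
    change (if blockMask p q i j then
      (-(((K⁻¹ : (Matrix ι ι ℝ)ˣ) : Matrix ι ι ℝ) * L E *
        ((K⁻¹ : (Matrix ι ι ℝ)ˣ) : Matrix ι ι ℝ))) i j else E i j) = _
    simp only [hL, hKi, Matrix.neg_apply, mul_diagonal, diagonal_mul, Matrix.add_apply,
      diagonal_transpose, transpose_apply]
  have hinj : Function.Injective Φ' := by
    rw [injective_iff_map_eq_zero]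
    intro E hE
    have h0 : ∀ i j, Φ' E i j = 0 := fun i j => by rw [hE]; rfl
    simp only [happ] at h0
    have hout : ∀ i j, ¬ blockMask p q i j → E i j = 0 := by
      intro i j hij
      have := h0 i j
      rwa [if_neg hij] at this
    have hqp : E q p = 0 := hout q p (by simp [blockMask, hpq, hpq.symm])
    have e1 := h0 p p
    have e2 := h0 q q
    have e3 := h0 p q
    simp [blockMask, hk, hp, hq, hqp] at e1 e2 e3
    ext i j
    by_cases hij : blockMask p q i j
    · rcases hij with ⟨rfl, rfl⟩ | ⟨rfl, rfl⟩ | ⟨rfl, rfl⟩ <;> simp <;> linarith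
    · exact hout i j hij
  let e : Matrix ι ι ℝ ≃L[ℝ] Matrix ι ι ℝ :=
    (LinearEquiv.ofInjectiveEndo (Φ' : Matrix ι ι ℝ →ₗ[ℝ] Matrix ι ι ℝ)
      hinj).toContinuousLinearEquiv
  have he : (e : Matrix ι ι ℝ →L[ℝ] Matrix ι ι ℝ) = Φ' := by ext; rfl
  have hmain : HasStrictFDerivAt (gramChart p q)
      (e : Matrix ι ι ℝ →L[ℝ] Matrix ι ι ℝ) (diagonal d) := by
    rw [he]; exact hchart
  have hfix : gramChart p q (diagonal d) = diagonal d := by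
    ext i j
    rw [gramChart, blockReplace_apply, hKu, Ring.inverse_unit, hKi]
    split_ifs with h
    · rcases h with ⟨rfl, rfl⟩ | ⟨rfl, rfl⟩ | ⟨rfl, rfl⟩ <;> simp [hk, hp, hq, hpq]
    · rfl
  set H := hmain.toOpenPartialHomeomorph (gramChart p q) with hH
  have hHc : ⇑H = gramChart p q := rfl
  have hsrc : diagonal d ∈ H.source := hmain.mem_toOpenPartialHomeomorph_source
  have hUo : IsOpen (U ∩ borderedGram p q ⁻¹' {M | IsUnit M}) := by
    refine hU.inter (Units.isOpen.preimage ?_)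
    unfold borderedGram
    fun_prop
  refine ⟨H.target ∩ H.symm ⁻¹' (U ∩ borderedGram p q ⁻¹' {M | IsUnit M}), H.symm,
    H.symm.isOpen_inter_preimage hUo, ⟨?_, ?_⟩,
    H.continuousOn_symm.mono Set.inter_subset_left, ?_⟩
  · have := H.map_source hsrc
    rwa [hHc, hfix] at this
  · have := H.left_inv hsrc
    rw [hHc, hfix] at this
    rw [Set.mem_preimage, this]
    exact ⟨hDU, (congrArg IsUnit hKu).mpr K.isUnit⟩
  · rintro B ⟨hB1, hB2, hB3⟩
    exact ⟨hB2, hB3, H.right_inv hB1⟩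

end Analysis

section Cycle

/-- Opening a weak cycle at one of its arcs `(p, q)` leaves a path between `p` and `q`. -/
lemma HasWeakCycle.exists_arc_and_path {n : ℕ} {W : Matrix (Fin n) (Fin n) ℝ}
    (h : HasWeakCycle W) :
    ∃ (p q : Fin n) (m : ℕ) (v : ℕ → Fin n) (dir : ℕ → Prop),
      p ≠ q ∧ W p q = 1 ∧ ((v 0 = p ∧ v m = q) ∨ (v 0 = q ∧ v m = p)) ∧
      (∀ s ≤ m, ∀ t ≤ m, v s = v t → s = t) ∧
      (∀ t < m, dir t → W (v t) (v (t + 1)) = 1 ∧ ¬ (v t = p ∧ v (t + 1) = q)) ∧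
      (∀ t < m, ¬ dir t → W (v (t + 1)) (v t) = 1 ∧ ¬ (v (t + 1) = p ∧ v t = q)) := by
  obtain ⟨k, hk, u, d, hu, harc, hW⟩ := h
  have hcast : ∀ s < k, ∀ t < k, ((s : ℕ) : ZMod k) = t → s = t := by
    intro s hs t ht hst
    rw [ZMod.natCast_eq_natCast_iff'] at hst
    rwa [Nat.mod_eq_of_lt hs, Nat.mod_eq_of_lt ht] at hst
  have h01 : u 0 ≠ u (0 + 1) := by
    intro h
    have := hcast 0 (by omega) 1 (by omega) (by simpa using hu h)
    omega
  have hlast : u (((k - 1 : ℕ) : ZMod k) + 1) = u 0 := by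
    congr 1
    have : (((k - 1 + 1 : ℕ)) : ZMod k) = 0 := by
      rw [Nat.sub_add_cancel (by omega)]; exact ZMod.natCast_self k
    exact_mod_cast this
  have hne : ∀ t < k - 1, ((t : ZMod k) + 1) ≠ 0 := by
    intro t ht h
    have := hcast (t + 1) (by omega) 0 (by omega) (by exact_mod_cast h)
    omega
  refine ⟨if d 0 then u 0 else u (0 + 1), if d 0 then u (0 + 1) else u 0, k - 1,
    fun t => u ((t : ZMod k) + 1), fun t => d ((t : ZMod k) + 1) = true, ?_, hW 0, ?_, ?_, ?_, ?_⟩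
  · split_ifs
    exacts [h01, h01.symm]
  · beta_reduce
    rw [hlast, Nat.cast_zero]
    split_ifs
    exacts [Or.inr ⟨rfl, rfl⟩, Or.inl ⟨rfl, rfl⟩]
  · intro s hs t ht hst
    exact hcast s (by omega) t (by omega) (add_right_cancel (hu hst))
  · intro t ht hd
    have h1 := hW ((t : ZMod k) + 1)
    simp only [hd, if_true] at h1
    refine ⟨by push_cast; exact h1, fun h2 => hne t ht (harc ?_)⟩
    push_cast at h2
    beta_reduce
    rw [if_pos hd]
    split_ifs with h0 <;> simp_all
  · intro t ht hd
    have h1 := hW ((t : ZMod k) + 1)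
    simp only [hd] at h1
    refine ⟨by push_cast; exact h1, fun h2 => hne t ht (harc ?_)⟩
    push_cast at h2
    beta_reduce
    rw [if_neg hd]
    split_ifs with h0 <;> simp_all

lemma exists_ne_zero_mem_of_isOpen {S : Set ℝ} (hS : IsOpen S) (h0 : (0 : ℝ) ∈ S) :
    ∃ s ∈ S, s ≠ 0 := by
  have h1 : S ∈ nhdsWithin (0 : ℝ) {0}ᶜ := mem_nhdsWithin_of_mem_nhds (hS.mem_nhds h0)
  exact Filter.nonempty_of_mem (Filter.inter_mem h1 self_mem_nhdsWithin)

/-- If the chart value of `A` is the identity on the `{p, q}` block, then `A` has two independent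
left singular vectors for the singular value `1`. -/
lemma exists_unit_singular_pair {ι : Type*} [Fintype ι] [DecidableEq ι] {p q : ι} (hpq : p ≠ q)
    {A B : Matrix ι ι ℝ} (hu : IsUnit (borderedGram p q A)) (hA : gramChart p q A = B)
    (hp : B p p = 1) (hq : B q q = 1) (hB : B p q = 0) :
    ∃ x x' : ι → ℝ, (A * Aᵀ) *ᵥ x = x ∧ (A * Aᵀ) *ᵥ x' = x' ∧
      x p = 1 ∧ x q = 0 ∧ x' p = 0 ∧ x' q = 1 := by
  set G := Ring.inverse (borderedGram p q A) with hG
  have hmul : borderedGram p q A * G = 1 := Ring.mul_inverse_cancel _ hu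
  have hmul' : G * borderedGram p q A = 1 := Ring.inverse_mul_cancel _ hu
  have hmask : ∀ i j, blockMask p q i j → G i j = B i j := by
    intro i j hij
    rw [← hA, gramChart, blockReplace_apply, if_pos hij]
  have hGp : G p p = 1 := by rw [hmask p p (Or.inl ⟨rfl, rfl⟩), hp]
  have hGq : G q q = 1 := by rw [hmask q q (Or.inr (Or.inl ⟨rfl, rfl⟩)), hq]
  have hGpq : G p q = 0 := by rw [hmask p q (Or.inr (Or.inr ⟨rfl, rfl⟩)), hB]
  have hsymm : Gᵀ = G := by
    have h1 : Gᵀ * borderedGram p q A = 1 := by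
      have := congrArg transpose hmul
      rwa [transpose_mul, (borderedGram_isSymm p q A).eq, transpose_one] at this
    exact left_inv_eq_right_inv h1 hmul
  have hGqp : G q p = 0 := by rw [← hsymm, transpose_apply, hGpq]
  exact ⟨_, _, gram_mulVec_inverse_col hpq A G hmul hGp hGq hGpq hGqp (Or.inl rfl),
    gram_mulVec_inverse_col hpq A G hmul hGp hGq hGpq hGqp (Or.inr rfl), hGp, hGqp, hGpq, hGq⟩

end Cycle

/-- If `W` is an `n × n` pattern in standard form (all diagonal entries equal to `1`) whose
digraph contains a weak cycle, then some matrix with pattern `W` has the SSVP and a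
multiple singular value. -/
theorem weakCycle_allows_multiple {n : ℕ} (W : Matrix (Fin n) (Fin n) ℝ)
    (hW : IsPattern W) (hdiag : ∀ i, W i i = 1) (hcyc : HasWeakCycle W) :
    ∃ A : Matrix (Fin n) (Fin n) ℝ,
      HasPattern A W ∧ SSVP A ∧ ∃ σ : ℝ, 0 ≤ σ ∧ 2 ≤ singValMult A σ := by
  classical
  obtain ⟨p, q, m, v, dir, hpq, hWpq, hends, hinj, hout, hin⟩ := hcyc.exists_arc_and_path
  set C : Fin n → Fin n → Prop := fun i j => ∃ t < m,
    (dir t ∧ i = v t ∧ j = v (t + 1)) ∨ (¬ dir t ∧ i = v (t + 1) ∧ j = v t) with hC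
  have hCne : ∀ i j, C i j → i ≠ j := by
    rintro i j ⟨t, ht, ⟨-, rfl, rfl⟩ | ⟨-, rfl, rfl⟩⟩ h
    · have := hinj _ ht.le _ ht h; omega
    · have := hinj _ ht _ ht.le h; omega
  have hCW : ∀ i j, C i j → W i j = 1 ∧ ¬ (i = p ∧ j = q) := by
    rintro i j ⟨t, ht, ⟨hd, rfl, rfl⟩ | ⟨hd, rfl, rfl⟩⟩
    exacts [hout t ht hd, hin t ht hd]
  set d : Fin n → ℝ := fun i => if i = p ∨ i = q then 1 else (i : ℝ) + 2 with hd
  have hdp : d p = 1 := by simp [hd]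
  have hdq : d q = 1 := by simp [hd]
  have hdpos : ∀ i, 0 < d i := by
    intro i; simp only [hd]; split_ifs <;> positivity
  have hd1 : ∀ i, i ≠ p → i ≠ q → d i ^ 2 ≠ 1 := by
    intro i h1 h2 h
    have h3 : d i = (i : ℝ) + 2 := by simp [hd, h1, h2]
    have h4 : (0 : ℝ) ≤ (i : ℝ) := by positivity
    rw [h3] at h
    nlinarith
  have hdd : ∀ i j, i ≠ j → d i ^ 2 = d j ^ 2 → (i = p ∧ j = q) ∨ (i = q ∧ j = p) := by
    intro i j hij h
    by_cases hi : i = p ∨ i = q <;> by_cases hj : j = p ∨ j = q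
    · grind
    · push Not at hj
      rcases hi with rfl | rfl
      · exact absurd (by rw [← h, hdp, one_pow]) (hd1 j hj.1 hj.2)
      · exact absurd (by rw [← h, hdq, one_pow]) (hd1 j hj.1 hj.2)
    · push Not at hi
      rcases hj with rfl | rfl
      · exact absurd (by rw [h, hdp, one_pow]) (hd1 i hi.1 hi.2)
      · exact absurd (by rw [h, hdq, one_pow]) (hd1 i hi.1 hi.2)
    · have h2 := (pow_left_inj₀ (hdpos i).le (hdpos j).le two_ne_zero).1 h
      simp only [hd, if_neg hi, if_neg hj, add_left_inj, Nat.cast_inj] at h2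
      exact absurd (Fin.ext h2) hij
  have hUopen : IsOpen
      ({A : Matrix (Fin n) (Fin n) ℝ | Function.Injective (strongCondition p q A)} ∩
        ⋂ i, {A | A i i ≠ 0}) := by
    refine (isOpen_strongCondition_injective p q).inter (isOpen_iInter_of_finite fun i => ?_)
    exact isOpen_ne_fun (by fun_prop) continuous_const
  obtain ⟨V, g, hVopen, hDV, hg, hV⟩ := exists_gramChart_localInverse hpq hdp hdq hd1 hUopen
    ⟨strongCondition_diagonal_injective hdp hdq hdd,
      Set.mem_iInter.2 fun i => by simpa using (hdpos i).ne'⟩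
  set M : ℝ → ℝ → Matrix (Fin n) (Fin n) ℝ := fun s r => Matrix.of fun i j =>
    if i = j then d i else if C i j then s else if W i j = 1 ∧ ¬ (i = p ∧ j = q) then r else 0
    with hM
  have hMs : Continuous fun s => M s 0 := by
    refine continuous_matrix fun i j => ?_
    simp only [hM, of_apply]
    split_ifs <;> fun_prop
  have hMr : ∀ s, Continuous (M s) := by
    intro s
    refine continuous_matrix fun i j => ?_
    simp only [hM, of_apply]
    split_ifs <;> fun_prop
  have hM0 : M 0 0 = diagonal d := by
    ext i j
    simp only [hM, of_apply, diagonal_apply, ite_self]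
  have hMpq : ∀ s r, M s r p q = 0 := by
    intro s r
    simp only [hM, of_apply, if_neg hpq, if_neg fun h => (hCW p q h).2 ⟨rfl, rfl⟩]
    simp
  have hentry : ∀ s r, M s r ∈ V → ∀ i j, i ≠ j → ¬ (i = p ∧ j = q) →
      g (M s r) i j = M s r i j := by
    intro s r hV' i j hij hpq'
    conv_rhs => rw [← (hV _ hV').2.2]
    rw [gramChart, blockReplace_apply, if_neg]
    rintro (⟨rfl, rfl⟩ | ⟨rfl, rfl⟩ | h)
    exacts [hij rfl, hij rfl, hpq' h]
  have hpair : ∀ s r, M s r ∈ V → ∃ x x' : Fin n → ℝ,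
      (g (M s r) * (g (M s r))ᵀ) *ᵥ x = x ∧ (g (M s r) * (g (M s r))ᵀ) *ᵥ x' = x' ∧
      x p = 1 ∧ x q = 0 ∧ x' p = 0 ∧ x' q = 1 := by
    intro s r hV'
    exact exists_unit_singular_pair hpq (hV _ hV').2.1 (hV _ hV').2.2
      (by simp [hM, hdp]) (by simp [hM, hdq]) (hMpq s r)
  have hgdiag : ∀ s r, M s r ∈ V → ∀ i, g (M s r) i i ≠ 0 := fun s r hV' =>
    Set.mem_iInter.1 (hV _ hV').1.2
  obtain ⟨s, hsV, hs0⟩ := exists_ne_zero_mem_of_isOpen (hVopen.preimage hMs)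
    (by rw [Set.mem_preimage, hM0]; exact hDV)
  have hspq : g (M s 0) p q ≠ 0 := by
    intro hzero
    have hval : ∀ i j, i ≠ j → g (M s 0) i j = if C i j then s else 0 := by
      intro i j hij
      by_cases hij' : i = p ∧ j = q
      · rw [hij'.1, hij'.2, hzero, if_neg fun h => (hCW p q h).2 ⟨rfl, rfl⟩]
      · rw [hentry s 0 hsV i j hij hij']
        simp only [hM, of_apply, if_neg hij, ite_self]
    have hnz : ∀ i j, C i j → g (M s 0) i j ≠ 0 := by
      intro i j h
      rwa [hval i j (hCne i j h), if_pos h]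
    have hker : ∀ x : Fin n → ℝ, (g (M s 0) * (g (M s 0))ᵀ) *ᵥ x = x → x (v 0) = 0 →
        x (v m) = 0 := by
      intro x hx h0
      refine (singularVector_eq_zero_of_path (g (M s 0)) m v dir hinj (hgdiag s 0 hsV) ?_
        (fun t ht h => hnz _ _ ⟨t, ht, Or.inl ⟨h, rfl, rfl⟩⟩)
        (fun t ht h => hnz _ _ ⟨t, ht, Or.inr ⟨h, rfl, rfl⟩⟩) x ((g (M s 0))ᵀ *ᵥ x)
        (fun i => ?_) (fun j => rfl) h0 m le_rfl).1
      · intro i j hij hne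
        rw [hval i j hij] at hne
        by_contra h
        exact hne (if_neg h)
      · have := congrFun hx i
        rwa [← mulVec_mulVec] at this
    obtain ⟨x, x', hx, hx', h1, h2, h3, h4⟩ := hpair s 0 hsV
    rcases hends with ⟨e1, e2⟩ | ⟨e1, e2⟩
    · have := hker x' hx' (e1 ▸ h3)
      rw [e2, h4] at this
      exact one_ne_zero this
    · have := hker x hx (e1 ▸ h2)
      rw [e2, h1] at this
      exact one_ne_zero this
  have hVpq : IsOpen (V ∩ g ⁻¹' {A | A p q ≠ 0}) :=
    hg.isOpen_inter_preimage hVopen (isOpen_ne_fun (by fun_prop) continuous_const)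
  obtain ⟨r, ⟨hrV, hrpq⟩, hr0⟩ := exists_ne_zero_mem_of_isOpen (hVpq.preimage (hMr s))
    ⟨hsV, hspq⟩
  refine ⟨g (M s r), ?_, SSVP.of_strongCondition_injective (hV _ hrV).1.1 (hgdiag s r hrV) hrpq,
    1, zero_le_one, ?_⟩
  · intro i j
    by_cases hij : i = j
    · subst hij
      exact iff_of_true (hgdiag s r hrV i) (hdiag i)
    by_cases hij' : i = p ∧ j = q
    · rw [hij'.1, hij'.2]
      exact iff_of_true hrpq hWpq
    rw [hentry s r hrV i j hij hij']
    simp only [hM, of_apply, if_neg hij]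
    split_ifs with h1 h2
    · exact iff_of_true hs0 (hCW i j h1).1
    · exact iff_of_true hr0 h2.1
    · exact iff_of_false (fun h => h rfl) fun h => h2 ⟨h, hij'⟩
  · obtain ⟨x, x', hx, hx', h1, h2, h3, h4⟩ := hpair s r hrV
    exact two_le_singValMult_one_s2 _ x x' hx hx' h1 h2 h3 h4
end

section
/- There exists a 4×4 real matrix with pattern P = [[1,1,1,1],[0,1,0,0],[0,0,1,0],[0,0,0,1]] that has the SSVP and a multiple singular value. (In fact, the 0-1 matrix P itself has 1 as a singular value of multiplicity 2 and has the SSVP.) -/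
open Matrix Polynomial

/-- The pattern of Lemma 2.6. -/
def P3 : Matrix (Fin 4) (Fin 4) ℝ :=
  !![1, 1, 1, 1;
     0, 1, 0, 0;
     0, 0, 1, 0;
     0, 0, 0, 1]

theorem charpoly_P3_mul_transpose :
    (P3 * P3ᵀ).charpoly = (X - C 1) ^ 2 * (X ^ 2 - 5 * X + 1) := by
  have h : P3 * P3ᵀ = !![4, 1, 1, 1; 1, 1, 0, 0; 1, 0, 1, 0; 1, 0, 0, 1] := by
    ext i j
    fin_cases i <;> fin_cases j <;>
      simp [P3, Matrix.mul_apply, Fin.sum_univ_four] <;> norm_num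
  have hc : charmatrix (P3 * P3ᵀ) =
      !![X - 4, -1, -1, -1; -1, X - 1, 0, 0; -1, 0, X - 1, 0; -1, 0, 0, X - 1] := by
    rw [h]
    ext1 i j
    fin_cases i <;> fin_cases j <;> simp [map_ofNat]
  rw [Matrix.charpoly, hc]
  simp [Matrix.det_succ_row_zero, Fin.sum_univ_succ, Fin.succAbove]
  ring

theorem singValMult_P3_one : singValMult P3 1 = 2 := by
  have hq : ¬ (X ^ 2 - 5 * X + 1 : ℝ[X]).IsRoot 1 := by
    norm_num [Polynomial.IsRoot.def]
  have h0 : (X ^ 2 - 5 * X + 1 : ℝ[X]) ≠ 0 := by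
    intro h
    simp [h] at hq
  rw [singValMult, charpoly_P3_mul_transpose, one_pow, Polynomial.rootMultiplicity_mul
    (mul_ne_zero (pow_ne_zero _ (Polynomial.X_sub_C_ne_zero 1)) h0),
    Polynomial.rootMultiplicity_X_sub_C_pow, Polynomial.rootMultiplicity_eq_zero hq]

theorem ssvp_P3 : SSVP P3 := by
  intro X h1 h2 h3
  have e1 := fun i j => h1.apply i j
  have e2 := fun i j => h2.apply i j
  simp only [Fin.forall_fin_succ, Matrix.mul_apply, Fin.sum_univ_four, P3] at e1 e2 h3
  simp at e1 e2 h3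
  ext i j
  fin_cases i <;> fin_cases j <;> simp <;> grind

theorem hasPattern_self {α β : Type*} {P : Matrix α β ℝ} (hP : IsPattern P) : HasPattern P P := by
  intro i j
  rcases hP i j with h | h <;> simp [h]

theorem isPattern_P3 : IsPattern P3 := by
  intro i j
  fin_cases i <;> fin_cases j <;> simp [P3]

/-- The pattern `P3` allows a matrix with the SSVP and a multiple singular value; in fact
the `0`-`1` matrix `P3` itself has `1` as a singular value of multiplicity `2` and has the
SSVP. -/
theorem deg4_allows_multiple :
    (∃ A : Matrix (Fin 4) (Fin 4) ℝ,
      HasPattern A P3 ∧ SSVP A ∧ ∃ σ : ℝ, 0 ≤ σ ∧ 2 ≤ singValMult A σ) ∧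
    singValMult P3 1 = 2 ∧ SSVP P3 := by
  exact ⟨⟨P3, hasPattern_self isPattern_P3, ssvp_P3, 1, zero_le_one, singValMult_P3_one.ge⟩,
    singValMult_P3_one, ssvp_P3⟩
end

section
/- There exists a 4×4 real matrix with pattern [[1,1,0,0],[0,1,1,1],[0,0,1,0],[0,0,0,1]] that has the SSVP and a multiple singular value. (In fact, the matrix A = [[1,1,0,0],[0,1,1,1],[0,0,√2,0],[0,0,0,√2]] has √2 as a singular value of multiplicity at least 2 and has the SSVP.) -/
open Matrix Polynomial

/-- The pattern of Lemma 2.7. -/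
def P4 : Matrix (Fin 4) (Fin 4) ℝ :=
  !![1, 1, 0, 0;
     0, 1, 1, 1;
     0, 0, 1, 0;
     0, 0, 0, 1]

/-- The witness matrix of Lemma 2.7. -/
noncomputable def A4 : Matrix (Fin 4) (Fin 4) ℝ :=
  !![1, 1, 0,           0;
     0, 1, 1,           1;
     0, 0, Real.sqrt 2, 0;
     0, 0, 0,           Real.sqrt 2]

lemma hasPattern_A4 : HasPattern A4 P4 := by
  intro i j
  fin_cases i <;> fin_cases j <;> simp [A4, P4]

lemma charpoly_A4_mul_transpose :
    (A4 * A4ᵀ).charpoly = (X - C 2) ^ 2 * (X ^ 2 - C 5 * X + C 1) := by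
  have hs : (C (Real.sqrt 2) : ℝ[X]) * C (Real.sqrt 2) = C 2 := by
    rw [← C_mul, Real.mul_self_sqrt (by norm_num)]
  have hM : A4 * A4ᵀ = !![2, 1, 0, 0;
      1, 3, Real.sqrt 2, Real.sqrt 2;
      0, Real.sqrt 2, 2, 0;
      0, Real.sqrt 2, 0, 2] := by
    ext i j
    fin_cases i <;> fin_cases j <;>
      simp [A4, Matrix.mul_apply, Fin.sum_univ_four] <;> norm_num
  have h2 : (C 2 : ℝ[X]) = 2 := rfl
  have h3 : (C 3 : ℝ[X]) = 3 := rfl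
  have h5 : (C 5 : ℝ[X]) = 5 := rfl
  rw [hM, Matrix.charpoly, Matrix.det_succ_row_zero]
  simp [Fin.sum_univ_succ, Matrix.det_fin_three, Matrix.charmatrix_apply, Fin.succAbove,
    Matrix.diagonal_apply, h2, h3, h5] at hs ⊢
  linear_combination (-2 * (X - 2) ^ 2) * hs

lemma two_le_singValMult_A4 : 2 ≤ singValMult A4 (Real.sqrt 2) := by
  rw [singValMult, Real.sq_sqrt (by norm_num),
    Polynomial.le_rootMultiplicity_iff (Matrix.charpoly_monic _).ne_zero,
    charpoly_A4_mul_transpose]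
  exact dvd_mul_right _ _

lemma ssvp_A4 : SSVP A4 := by
  intro X hL hR h0
  have hs0 : Real.sqrt 2 ≠ 0 := by positivity
  have supp : ∀ i j, P4 i j = 1 → X i j = 0 := fun i j h =>
    (mul_eq_zero.mp (h0 i j)).resolve_left ((hasPattern_A4 i j).mpr h)
  have x00 := supp 0 0 (by simp [P4])
  have x01 := supp 0 1 (by simp [P4])
  have x11 := supp 1 1 (by simp [P4])
  have x12 := supp 1 2 (by simp [P4])
  have x13 := supp 1 3 (by simp [P4])
  have x22 := supp 2 2 (by simp [P4])
  have x33 := supp 3 3 (by simp [P4])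
  have l01 := hL.apply 0 1
  have l12 := hL.apply 1 2
  have l13 := hL.apply 1 3
  have r01 := hR.apply 0 1
  have r02 := hR.apply 0 2
  have r03 := hR.apply 0 3
  have r12 := hR.apply 1 2
  have r13 := hR.apply 1 3
  have r23 := hR.apply 2 3
  simp [A4, Matrix.mul_apply, Fin.sum_univ_four, x00, x01, x11, x12, x13, x22, x33]
    at l01 l12 l13 r01 r02 r03 r12 r13 r23
  have h : Real.sqrt 2 * (X 2 1 + X 3 1) = 0 := by linarith
  have h' := (mul_eq_zero.mp h).resolve_left hs0
  have x21 : X 2 1 = 0 := by linarith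
  have x31 : X 3 1 = 0 := by linarith
  have x23 : X 2 3 = 0 := by linarith
  have x32 : X 3 2 = 0 := by linarith
  have x02 : X 0 2 = 0 := by rw [← l12, x21, mul_zero]
  have x03 : X 0 3 = 0 := by rw [← l13, x31, mul_zero]
  have x20 : X 2 0 = 0 := by simpa [x21, x02] using r02
  have x30 : X 3 0 = 0 := by simpa [x31, x03] using r03
  ext i j
  fin_cases i <;> fin_cases j <;> simpa

/-- The pattern `P4` allows a matrix with the SSVP and a multiple singular value; in fact
the matrix `A4` has pattern `P4`, has `√2` as a singular value of multiplicity at least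
`2`, and has the SSVP. -/
theorem inout_allows_multiple :
    (∃ A : Matrix (Fin 4) (Fin 4) ℝ,
      HasPattern A P4 ∧ SSVP A ∧ ∃ σ : ℝ, 0 ≤ σ ∧ 2 ≤ singValMult A σ) ∧
    HasPattern A4 P4 ∧ 2 ≤ singValMult A4 (Real.sqrt 2) ∧ SSVP A4 := by
  exact ⟨⟨A4, hasPattern_A4, ssvp_A4, Real.sqrt 2, Real.sqrt_nonneg 2, two_le_singValMult_A4⟩,
    hasPattern_A4, two_le_singValMult_A4, ssvp_A4⟩
end

section
/- Let P be an n×n pattern in standard form such that the digraph of P contains a vertex whose in-degree and out-degree sum to at least 3. Then there exists a real matrix in Z(P) with a multiple singular value. -/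
open Matrix Polynomial

open NormedSpace Filter Topology in
theorem map_nhds_exp_mul_mul_exp_add {𝔸 : Type*} [NormedRing 𝔸] [NormedAlgebra ℝ 𝔸]
    [CompleteSpace 𝔸] (a : 𝔸) (s m : 𝔸 →L[ℝ] 𝔸)
    (h : ∀ y, ∃ k l b, s k * a + a * s l + m b = y) :
    map (fun x : 𝔸 × 𝔸 × 𝔸 => exp (s x.1) * a * exp (s x.2.1) + m x.2.2) (𝓝 0) = 𝓝 a := by
  let _ : NormedAlgebra ℚ 𝔸 := NormedAlgebra.restrictScalars ℚ ℝ 𝔸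
  have hexp (t : 𝔸 × 𝔸 × 𝔸 →L[ℝ] 𝔸) : HasStrictFDerivAt (fun x => exp (s (t x))) (s ∘L t) 0 := by
    have h0 : HasStrictFDerivAt (exp : 𝔸 → 𝔸) (1 : 𝔸 →L[ℝ] 𝔸) ((s ∘L t) 0) := by
      rw [map_zero]
      exact hasStrictFDerivAt_exp_zero
    exact h0.comp 0 (s ∘L t).hasStrictFDerivAt
  let p₁ : 𝔸 × 𝔸 × 𝔸 →L[ℝ] 𝔸 := ContinuousLinearMap.fst ℝ 𝔸 (𝔸 × 𝔸)
  let p₂ : 𝔸 × 𝔸 × 𝔸 →L[ℝ] 𝔸 :=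
    ContinuousLinearMap.fst ℝ 𝔸 𝔸 ∘L ContinuousLinearMap.snd ℝ 𝔸 (𝔸 × 𝔸)
  let p₃ : 𝔸 × 𝔸 × 𝔸 →L[ℝ] 𝔸 :=
    ContinuousLinearMap.snd ℝ 𝔸 𝔸 ∘L ContinuousLinearMap.snd ℝ 𝔸 (𝔸 × 𝔸)
  have hd := (((hexp p₁).mul_const' a).mul' (hexp p₂)).add (m ∘L p₃).hasStrictFDerivAt
  have := hd.map_nhds_eq_of_surj <| by
    refine LinearMap.range_eq_top.2 fun y => ?_
    obtain ⟨k, l, b, rfl⟩ := h y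
    refine ⟨(k, l, b), ?_⟩
    simp [p₁, p₂, p₃, add_comm]
  convert this using 2
  · rfl
  · change a = exp (s 0) * a * exp (s 0) + m 0
    simp


theorem SSVP.exists_tangent_eq {α : Type*} [Fintype α] [DecidableEq α] {A : Matrix α α ℝ}
    (hA : SSVP A) (Y : Matrix α α ℝ) :
    ∃ K L B : Matrix α α ℝ, (K - Kᵀ) * A + A * (L - Lᵀ) + A ⊙ B = Y := by
  let f : Matrix α α ℝ × Matrix α α ℝ × Matrix α α ℝ →ₗ[ℝ] Matrix α α ℝ :=
    { toFun := fun x => (x.1 - x.1ᵀ) * A + A * (x.2.1 - x.2.1ᵀ) + A ⊙ x.2.2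
      map_add' := fun x y => by
        simp only [Prod.fst_add, Prod.snd_add, transpose_add, hadamard_add, Matrix.sub_mul,
          Matrix.mul_sub, Matrix.add_mul, Matrix.mul_add]
        abel
      map_smul' := fun c x => by simp [smul_add, ← smul_sub] }
  suffices hf : LinearMap.range f = ⊤ by
    obtain ⟨x, hx⟩ := LinearMap.range_eq_top.1 hf Y
    exact ⟨x.1, x.2.1, x.2.2, hx⟩
  by_contra hf
  obtain ⟨φ, hφ, hle⟩ := Submodule.exists_le_ker_of_lt_top _ (lt_top_iff_ne_top.2 hf)
  have hφf (x) : φ (f x) = 0 := hle ⟨x, rfl⟩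
  let Z : Matrix α α ℝ := of fun i j => φ (single i j 1)
  have hφZ (M : Matrix α α ℝ) : φ M = trace (Mᵀ * Z) := by
    conv_lhs => rw [matrix_eq_sum_single M]
    simp only [map_sum, trace, Matrix.mul_apply, diag_apply, transpose_apply]
    rw [Finset.sum_comm]
    refine Finset.sum_congr rfl fun j _ => Finset.sum_congr rfl fun i _ => ?_
    rw [← mul_one (M i j), ← smul_eq_mul, ← smul_single, map_smul]
    simp [Z]
  have hZ : Z = 0 := by
    apply hA
    · ext i j
      have := hφf (0, single i j 1, 0)
      simp only [f, LinearMap.coe_mk, AddHom.coe_mk, hφZ] at this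
      rw [transpose_apply, eq_comm, ← sub_eq_zero]
      simpa [Matrix.sub_mul, Matrix.mul_assoc, trace_single_mul] using this
    · ext i j
      have := hφf (single i j 1, 0, 0)
      simp only [f, LinearMap.coe_mk, AddHom.coe_mk, hφZ] at this
      rw [transpose_apply, eq_comm, ← sub_eq_zero]
      simpa [Matrix.mul_assoc, trace_mul_comm Aᵀ, Matrix.sub_mul, trace_single_mul] using this
    · intro i j
      have := hφf (0, 0, single i j 1)
      simp only [f, LinearMap.coe_mk, AddHom.coe_mk, hφZ] at this
      have hA : A ⊙ single i j 1 = single i j (A i j) := by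
        ext a b
        by_cases h : i = a ∧ j = b <;> simp [single, h]
      simpa [hA, trace_single_mul] using this
  exact hφ (LinearMap.ext fun M => by simp [hφZ, hZ])

open NormedSpace Filter Topology in
open scoped Matrix.Norms.Operator in
/-- The superpattern theorem: a matrix with the strong singular value property can be perturbed,
without changing its singular values, so that it acquires any larger pattern. -/
theorem SSVP.exists_hasPattern_charpoly_eq {α : Type*} [Fintype α] [DecidableEq α]
    {A P : Matrix α α ℝ} (hA : SSVP A) (hP : IsPattern P) (hAP : ∀ i j, A i j ≠ 0 → P i j = 1) :
    ∃ M : Matrix α α ℝ, HasPattern M P ∧ (M * Mᵀ).charpoly = (A * Aᵀ).charpoly := by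
  let s : Matrix α α ℝ →L[ℝ] Matrix α α ℝ := LinearMap.toContinuousLinearMap
    (LinearMap.id - (transposeLinearEquiv α α ℝ ℝ).toLinearMap)
  let m : Matrix α α ℝ →L[ℝ] Matrix α α ℝ := LinearMap.toContinuousLinearMap
    { toFun := fun B => A ⊙ B
      map_add' := fun B C => hadamard_add A B C
      map_smul' := fun c B => hadamard_smul A B c }
  have hs (K) : s K = K - Kᵀ := rfl
  have hmap := map_nhds_exp_mul_mul_exp_add A s m fun y => hA.exists_tangent_eq y
  have hexp (K) : exp (s K) * (exp (s K))ᵀ = 1 ∧ (exp (s K))ᵀ * exp (s K) = 1 := by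
    have h : (exp (s K))ᵀ = (exp (s K))⁻¹ := by
      rw [← exp_transpose, ← Matrix.exp_neg, hs]
      simp
    have hu := (Matrix.isUnit_iff_isUnit_det _).1 (Matrix.isUnit_exp (s K))
    rw [h]
    exact ⟨mul_nonsing_inv _ hu, nonsing_inv_mul _ hu⟩
  have hS : {x : Matrix α α ℝ × Matrix α α ℝ × Matrix α α ℝ | ∀ i j, x.2.2 i j ≠ 1} ∈ 𝓝 0 := by
    have (i j : α) : ∀ᶠ x : Matrix α α ℝ × Matrix α α ℝ × Matrix α α ℝ in 𝓝 0, x.2.2 i j ≠ 1 := by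
      have hc : Continuous fun x : Matrix α α ℝ × Matrix α α ℝ × Matrix α α ℝ => x.2.2 i j := by
        fun_prop
      exact hc.continuousAt.eventually_ne (by simp)
    exact eventually_all.2 fun i => eventually_all.2 (this i)
  let E : Matrix α α ℝ := of fun i j => if A i j = 0 then P i j else 0
  have hE : ∀ᶠ t : ℝ in 𝓝[≠] 0, A + t • E ∈ _ '' _ :=
    ((by fun_prop : Continuous fun t : ℝ => A + t • E).tendsto' 0 A (by simp)).mono_left
      nhdsWithin_le_nhds (hmap ▸ image_mem_map hS)
  obtain ⟨t, ⟨⟨K, L, B⟩, hB, hKLB⟩, ht⟩ := (hE.and self_mem_nhdsWithin).exists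
  have hM : A + t • E - A ⊙ B = exp (s K) * A * exp (s L) := (eq_sub_of_add_eq hKLB).symm
  refine ⟨A + t • E - A ⊙ B, fun i j => ?_, ?_⟩
  · have hB' : B i j ≠ 1 := hB i j
    have ht' : t ≠ 0 := ht
    by_cases h : A i j = 0
    · rcases hP i j with h1 | h1 <;> simp [E, h, h1, ht']
    · have : A i j - A i j * B i j = A i j * (1 - B i j) := by ring
      simp [E, h, hAP i j h, this, sub_eq_zero, hB'.symm]
  · have : exp (s K) * A * exp (s L) * (exp (s K) * A * exp (s L))ᵀ
        = exp (s K) * ((A * Aᵀ) * (exp (s K))ᵀ) := by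
      simp only [transpose_mul]
      calc _ = exp (s K) * A * (exp (s L) * (exp (s L))ᵀ) * Aᵀ * (exp (s K))ᵀ := by
            simp only [Matrix.mul_assoc]
        _ = _ := by simp only [(hexp L).1, Matrix.mul_one, Matrix.mul_assoc]
    rw [hM, this, Matrix.charpoly_mul_comm, Matrix.mul_assoc, (hexp K).2, Matrix.mul_one]

theorem SSVP.fromBlocks_diagonal {β ρ : Type*} [Fintype β] [DecidableEq β] [Fintype ρ]
    [DecidableEq ρ] {A : Matrix β β ℝ} (hA : SSVP A) {d : ρ → ℝ} (hd : ∀ k, d k ≠ 0)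
    (hd_inj : Function.Injective fun k => d k ^ 2)
    (hroot : ∀ k, ¬ (A * Aᵀ).charpoly.IsRoot (d k ^ 2)) :
    SSVP (fromBlocks A 0 0 (diagonal d)) := by
  intro Z h1 h2 h3
  obtain ⟨Z₁₁, Z₁₂, Z₂₁, Z₂₂, rfl⟩ : ∃ Z₁₁ Z₁₂ Z₂₁ Z₂₂, Z = fromBlocks Z₁₁ Z₁₂ Z₂₁ Z₂₂ :=
    ⟨_, _, _, _, (fromBlocks_toBlocks Z).symm⟩
  simp only [fromBlocks_transpose, fromBlocks_multiply, transpose_zero, diagonal_transpose,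
    Matrix.zero_mul, Matrix.mul_zero, add_zero, zero_add, IsSymm, fromBlocks_inj] at h1 h2
  obtain ⟨h11, h12, h13, h14⟩ := h1
  obtain ⟨h21, h22, h23, h24⟩ := h2
  simp only [transpose_mul, diagonal_transpose, transpose_transpose] at h12 h13 h22 h23
  have hZ₁₁ : Z₁₁ = 0 := hA _ h11 h21 fun i j => by simpa using h3 (.inl i) (.inl j)
  have hZ₁₂ : Z₁₂ = 0 := by
    have h : A * Aᵀ * Z₁₂ = Z₁₂ * diagonal (fun k => d k ^ 2) := by
      rw [Matrix.mul_assoc, ← h12, ← Matrix.mul_assoc, h22, Matrix.mul_assoc, diagonal_mul_diagonal]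
      simp only [sq]
    ext i k
    refine congr_fun (eq_zero_of_mulVec_eq_zero (M := scalar β (d k ^ 2) - A * Aᵀ)
      (v := fun i => Z₁₂ i k) ?_ ?_) i
    · rw [← eval_charpoly]
      exact hroot k
    · ext j
      have := congr_fun₂ h j k
      rw [mul_diagonal, Matrix.mul_apply] at this
      simp only [sub_mulVec, Pi.sub_apply, scalar_apply, mulVec_diagonal, Pi.zero_apply]
      rw [mulVec, dotProduct, this]
      ring
  have hZ₂₁ : Z₂₁ = 0 := by
    ext k i
    have := congr_fun₂ h12 i k
    simpa [hZ₁₂, hd k] using this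
  have hZ₂₂ : Z₂₂ = 0 := by
    ext k l
    have e1 := congr_fun₂ h14 k l
    have e2 := congr_fun₂ h24 k l
    simp only [transpose_apply, diagonal_mul, mul_diagonal] at e1 e2
    rcases eq_or_ne k l with rfl | hkl
    · simpa [hd k] using h3 (.inr k) (.inr k)
    · refine (mul_eq_zero.1 ?_).resolve_left (sub_ne_zero.2 <| hd_inj.ne hkl)
      linear_combination -d k * e1 + d l * e2
  rw [hZ₁₁, hZ₁₂, hZ₂₁, hZ₂₂, fromBlocks_zero]

theorem SSVP.exists_fromBlocks_diagonal {β : Type*} (ρ : Type*) [Fintype β] [DecidableEq β]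
    [Fintype ρ] [DecidableEq ρ] {A : Matrix β β ℝ} (hA : SSVP A) :
    ∃ d : ρ → ℝ, SSVP (fromBlocks A 0 0 (diagonal d)) := by
  obtain ⟨N, hN⟩ := Filter.eventually_atTop.1
    (Polynomial.eventually_atTop_not_isRoot (A * Aᵀ).charpoly (charpoly_monic _).ne_zero)
  let d : ρ → ℝ := fun k => max N 1 + (Fintype.equivFin ρ k : ℕ)
  have hd1 (k) : 1 ≤ d k := le_add_of_le_of_nonneg (le_max_right _ _) (Nat.cast_nonneg _)
  have hdN (k) : N ≤ d k := le_add_of_le_of_nonneg (le_max_left _ _) (Nat.cast_nonneg _)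
  refine ⟨d, hA.fromBlocks_diagonal (fun k => ?_) (fun k l hkl => ?_) fun k => hN _ ?_⟩
  · linarith [hd1 k]
  · have := (sq_eq_sq₀ (zero_le_one.trans (hd1 k)) (zero_le_one.trans (hd1 l))).1 hkl
    simpa [d, Fin.val_inj] using this
  · nlinarith [hd1 k, hdN k]

/-- If the pattern `P`, with unit diagonal, contains on some set of indices the pattern of a matrix
with the strong singular value property and the multiple singular value `σ`, then some matrix with
pattern `P` has the multiple singular value `σ`. -/
theorem SSVP.exists_hasPattern_two_le_singValMult {α β : Type*} [Fintype α] [DecidableEq α]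
    [Fintype β] [DecidableEq β] {P : Matrix α α ℝ} (hP : IsPattern P) (hdiag : ∀ i, P i i = 1)
    {f : β → α} (hf : Function.Injective f) {A : Matrix β β ℝ} (hA : SSVP A)
    (hAP : ∀ i j, A i j ≠ 0 → P (f i) (f j) = 1) {σ : ℝ}
    (hσ : (X - C (σ ^ 2)) ^ 2 ∣ (A * Aᵀ).charpoly) :
    ∃ M : Matrix α α ℝ, HasPattern M P ∧ 2 ≤ singValMult M σ := by
  classical
  let e : β ⊕ {a // a ∉ Set.range f} ≃ α :=
    ((Equiv.ofInjective f hf).sumCongr (Equiv.refl _)).trans (Equiv.Set.sumCompl (Set.range f))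
  have hel (b) : e (.inl b) = f b := Equiv.Set.sumCompl_apply_inl _ _
  obtain ⟨d, hd⟩ := hA.exists_fromBlocks_diagonal {a // a ∉ Set.range f}
  obtain ⟨M, hM, hMc⟩ := hd.exists_hasPattern_charpoly_eq (P := P.submatrix e e)
    (fun i j => hP _ _) (by
      rintro (i | i) (j | j) h
      · simpa [hel] using hAP i j h
      · simp at h
      · simp at h
      · obtain rfl : i = j := by
          by_contra hij
          simp [hij] at h
        exact hdiag _)
  refine ⟨M.submatrix e.symm e.symm, fun i j => by simpa using hM (e.symm i) (e.symm j), ?_⟩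
  have hc : (M.submatrix e.symm e.symm * (M.submatrix e.symm e.symm)ᵀ).charpoly
      = (A * Aᵀ).charpoly * (diagonal d * diagonal d).charpoly := by
    rw [transpose_submatrix, submatrix_mul_equiv, ← reindex_apply, charpoly_reindex, hMc]
    simp [fromBlocks_transpose, fromBlocks_multiply]
  rw [singValMult, hc, le_rootMultiplicity_iff]
  · exact hσ.mul_right _
  · exact ((charpoly_monic _).mul (charpoly_monic _)).ne_zero

theorem ssvp_outStar : SSVP !![1, 1, 1, 1; 0, 1, 0, 0; 0, 0, 1, 0; (0 : ℝ), 0, 0, 1] := by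
  intro Z h1 h2 h3
  have h1' (i j) := congr_fun₂ h1 i j
  have h2' (i j) := congr_fun₂ h2 i j
  simp [Fin.forall_fin_succ, Matrix.mul_apply, Fin.sum_univ_succ] at h1' h2' h3
  ext i j
  fin_cases i <;> fin_cases j <;> simp <;> grind

theorem ssvp_mixedStar : SSVP !![1, 1, 1, 0; 0, 5, 0, 0; 0, 0, 5, 0; (3 : ℝ), 0, 0, 4] := by
  intro Z h1 h2 h3
  have h1' (i j) := congr_fun₂ h1 i j
  have h2' (i j) := congr_fun₂ h2 i j
  simp [Fin.forall_fin_succ, Matrix.mul_apply, Fin.sum_univ_succ] at h1' h2' h3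
  ext i j
  fin_cases i <;> fin_cases j <;> simp <;> grind

theorem ssvp_twoCycle : SSVP !![3, -3, 4; 1, 1, 0; (0 : ℝ), 0, 2] := by
  intro Z h1 h2 h3
  have h1' (i j) := congr_fun₂ h1 i j
  have h2' (i j) := congr_fun₂ h2 i j
  simp [Fin.forall_fin_succ, Matrix.mul_apply, Fin.sum_univ_succ] at h1' h2' h3
  ext i j
  fin_cases i <;> fin_cases j <;> simp <;> grind

theorem sub_C_sq_dvd_charpoly_star {R : Type*} [CommRing R] (a b c d s : R) :
    (X - C s) ^ 2 ∣ (!![a, b, c, d; b, s, 0, 0; c, 0, s, 0; d, 0, 0, s]).charpoly := by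
  refine ⟨(X - C a) * (X - C s) - C (b ^ 2 + c ^ 2 + d ^ 2), ?_⟩
  simp [charpoly, charmatrix, Matrix.det_succ_row_zero, Fin.sum_univ_succ, Fin.succAbove]
  ring

theorem sub_C_sq_dvd_charpoly_twoCycle :
    (X - C (2 : ℝ)) ^ 2 ∣ (!![(34 : ℝ), 0, 8; 0, 2, 0; 8, 0, 4]).charpoly := by
  refine ⟨X - C 36, ?_⟩
  simp [charpoly, charmatrix, Matrix.det_fin_three, map_ofNat]
  ring

/-- A vertex with at least two out-neighbours and total degree at least three. -/
theorem exists_two_le_singValMult_of_two_le_outDegree {α : Type*} [Fintype α] [DecidableEq α]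
    {P : Matrix α α ℝ} (hP : IsPattern P) (hdiag : ∀ i, P i i = 1) (i : α)
    (hout : 2 ≤ Nat.card {j // j ≠ i ∧ P i j = 1})
    (hdeg : 3 ≤ Nat.card {j // j ≠ i ∧ P i j = 1} + Nat.card {j // j ≠ i ∧ P j i = 1}) :
    ∃ M : Matrix α α ℝ, HasPattern M P ∧ ∃ σ : ℝ, 0 ≤ σ ∧ 2 ≤ singValMult M σ := by
  classical
  simp only [Nat.card_eq_fintype_card, Fintype.card_subtype] at hout hdeg
  by_cases h3 : 3 ≤ (Finset.univ.filter fun j => j ≠ i ∧ P i j = 1).card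
  · obtain ⟨j, hj, k, hk, l, hl, hjk, hjl, hkl⟩ := Finset.two_lt_card.1 h3
    simp only [Finset.mem_filter, Finset.mem_univ, true_and] at hj hk hl
    obtain ⟨M, hM, h⟩ := ssvp_outStar.exists_hasPattern_two_le_singValMult hP hdiag
      (f := ![i, j, k, l]) (σ := 1)
      (by simp [Function.Injective, Fin.forall_fin_succ]; grind)
      (by simp [Fin.forall_fin_succ, hdiag, hj, hk, hl])
      (by
        convert sub_C_sq_dvd_charpoly_star (4 : ℝ) 1 1 1 1 using 2
        · simp
        · ext a b
          rw [Matrix.mul_apply]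
          fin_cases a <;> fin_cases b <;> simp [Fin.sum_univ_succ]; norm_num)
    exact ⟨M, hM, 1, zero_le_one, h⟩
  obtain ⟨t, ht⟩ : (Finset.univ.filter fun j => j ≠ i ∧ P j i = 1).Nonempty := by
    rw [← Finset.card_pos]
    omega
  simp only [Finset.mem_filter, Finset.mem_univ, true_and] at ht
  by_cases hti : P i t = 1
  · obtain ⟨k, hk, hkt⟩ := Finset.exists_mem_ne hout t
    simp only [Finset.mem_filter, Finset.mem_univ, true_and] at hk
    obtain ⟨M, hM, h⟩ := ssvp_twoCycle.exists_hasPattern_two_le_singValMult hP hdiag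
      (f := ![i, t, k]) (σ := √2)
      (by simp [Function.Injective, Fin.forall_fin_succ]; grind)
      (by simp [Fin.forall_fin_succ, hdiag, ht, hk, hti])
      (by
        convert sub_C_sq_dvd_charpoly_twoCycle using 2
        · simp
        · ext a b
          rw [Matrix.mul_apply]
          fin_cases a <;> fin_cases b <;> simp [Fin.sum_univ_succ] <;> norm_num)
    exact ⟨M, hM, √2, Real.sqrt_nonneg 2, h⟩
  · obtain ⟨j, hj, k, hk, hjk⟩ := Finset.one_lt_card.1 hout
    simp only [Finset.mem_filter, Finset.mem_univ, true_and] at hj hk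
    obtain ⟨M, hM, h⟩ := ssvp_mixedStar.exists_hasPattern_two_le_singValMult hP hdiag
      (f := ![i, j, k, t]) (σ := 5)
      (by simp [Function.Injective, Fin.forall_fin_succ]; grind)
      (by simp [Fin.forall_fin_succ, hdiag, hj, hk, ht])
      (by
        convert sub_C_sq_dvd_charpoly_star (3 : ℝ) 5 5 3 25 using 2
        · norm_num
        · ext a b
          rw [Matrix.mul_apply]
          fin_cases a <;> fin_cases b <;> simp [Fin.sum_univ_succ] <;> norm_num)
    exact ⟨M, hM, 5, by norm_num, h⟩

/-- If `P` is an `n × n` pattern in standard form (all diagonal entries `1`) whose digraph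
has a vertex whose in-degree and out-degree sum to at least `3`, then some matrix with
pattern `P` has a multiple singular value. -/
theorem degree_three_allows_multiple {n : ℕ} (P : Matrix (Fin n) (Fin n) ℝ)
    (hP : IsPattern P) (hdiag : ∀ i, P i i = 1)
    (hdeg : ∃ i : Fin n,
      3 ≤ Fintype.card {j : Fin n // j ≠ i ∧ P i j = 1}
          + Fintype.card {j : Fin n // j ≠ i ∧ P j i = 1}) :
    ∃ A : Matrix (Fin n) (Fin n) ℝ,
      HasPattern A P ∧ ∃ σ : ℝ, 0 ≤ σ ∧ 2 ≤ singValMult A σ := by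
  obtain ⟨i, hi⟩ := hdeg
  simp only [← Nat.card_eq_fintype_card] at hi
  by_cases hout : 2 ≤ Nat.card {j // j ≠ i ∧ P i j = 1}
  · exact exists_two_le_singValMult_of_two_le_outDegree hP hdiag i hout hi
  · obtain ⟨M, hM, σ, hσ, h⟩ := exists_two_le_singValMult_of_two_le_outDegree (P := Pᵀ)
      (fun a b => hP b a) hdiag i (by simp only [transpose_apply]; omega)
      (by simp only [transpose_apply]; omega)
    refine ⟨Mᵀ, fun a b => hM b a, σ, hσ, ?_⟩
    rwa [singValMult, transpose_transpose, charpoly_mul_comm]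
end

section
/- Let P be an n×n pattern with term-rank n in standard form. If no real matrix in Z(P) has a multiple singular value (i.e., every matrix with pattern P has only simple singular values), then the digraph of P is a weak path. -/
open Matrix Polynomial

/-- The digraph of the `n × n` pattern `P` (in standard form) is a weak path: there is an
ordering `v 0, v 1, …, v (n-1)` of the vertices such that between consecutive vertices
exactly one of the two possible arcs is present, and there are no other arcs. -/
def IsWeakPath {n : ℕ} (P : Matrix (Fin n) (Fin n) ℝ) : Prop :=
  ∃ v : Fin n ≃ Fin n, ∀ a b : Fin n, a ≠ b →
    (((a : ℕ) + 1 = (b : ℕ) ∨ (b : ℕ) + 1 = (a : ℕ)) →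
        Xor' (P (v a) (v b) = 1) (P (v b) (v a) = 1)) ∧
    (¬((a : ℕ) + 1 = (b : ℕ) ∨ (b : ℕ) + 1 = (a : ℕ)) → P (v a) (v b) = 0)

section Bordered

variable {ι : Type*} [Fintype ι] [DecidableEq ι] {M : Matrix ι ι ℝ} {U V : Matrix ι (Fin 2) ℝ}

theorem isUnit_bordered (hM : Mᵀ = M) (hVU : Vᵀ * U = 1) (hU : M * U = 0)
    (hker : ∀ x, M *ᵥ x = 0 → ∃ z, x = U *ᵥ z) : IsUnit (fromBlocks M V Vᵀ 0) := by
  have hUV : Uᵀ * V = 1 := by rw [← transpose_inj]; simpa using hVU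
  have hUM : Uᵀ * M = 0 := by rw [← transpose_inj]; simpa [hM] using hU
  rw [← mulVec_injective_iff_isUnit, ← coe_mulVecLin, ← LinearMap.ker_eq_bot,
    LinearMap.ker_eq_bot']
  intro w hw
  obtain ⟨x, y, rfl⟩ : ∃ x y, w = Sum.elim x y := ⟨w ∘ Sum.inl, w ∘ Sum.inr, by simp⟩
  simp only [mulVecLin_apply, fromBlocks_mulVec] at hw
  have h1 : M *ᵥ x + V *ᵥ y = 0 := by
    funext i; simpa using congrFun hw (Sum.inl i)
  have h2 : Vᵀ *ᵥ x = 0 := by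
    funext i; simpa using congrFun hw (Sum.inr i)
  have hy : y = 0 := by
    have := congrArg (fun v => Uᵀ *ᵥ v) h1
    simpa [mulVec_add, hUM, hUV] using this
  subst hy
  obtain ⟨z, rfl⟩ := hker x (by simpa using h1)
  have hz : z = 0 := by simpa [hVU] using h2
  subst hz
  funext i; cases i <;> simp

theorem apply_inr_inr_eq {m n : Type*} [Fintype m] [DecidableEq m] [Fintype n] [DecidableEq n]
    (X : Matrix (m ⊕ n) (m ⊕ n) ℝ) (a b : n) :
    X (Sum.inr a) (Sum.inr b) = ((fromCols 0 1 : Matrix n (m ⊕ n) ℝ) * X *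
      (fromRows 0 1 : Matrix (m ⊕ n) n ℝ)) a b := by
  obtain ⟨A, B, C, D, rfl⟩ : ∃ A B C D, X = fromBlocks A B C D :=
    ⟨_, _, _, _, (fromBlocks_toBlocks X).symm⟩
  simp [fromCols_mul_fromBlocks, fromCols_mul_fromRows]

variable {J : Matrix (ι ⊕ Fin 2) (ι ⊕ Fin 2) ℝ}

theorem bordered_inv_mul_fromRows (hVU : Vᵀ * U = 1) (hU : M * U = 0)
    (hJ : J * fromBlocks M V Vᵀ 0 = 1) :
    J * (fromRows 0 1 : Matrix (ι ⊕ Fin 2) (Fin 2) ℝ) = fromRows U 0 := by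
  have : fromBlocks M V Vᵀ 0 * (fromRows U 0 : Matrix (ι ⊕ Fin 2) (Fin 2) ℝ) = fromRows 0 1 := by
    simp [fromBlocks_mul_fromRows, hU, hVU]
  rw [← this, ← Matrix.mul_assoc, hJ, Matrix.one_mul]

theorem bordered_inv_apply_inr_inr (hVU : Vᵀ * U = 1) (hU : M * U = 0)
    (hJ : J * fromBlocks M V Vᵀ 0 = 1) (a b : Fin 2) : J (Sum.inr a) (Sum.inr b) = 0 := by
  rw [apply_inr_inr_eq J, Matrix.mul_assoc, bordered_inv_mul_fromRows hVU hU hJ]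
  simp [fromCols_mul_fromRows]

theorem bordered_inv_mul_mul_apply_inr_inr (hM : Mᵀ = M) (hVU : Vᵀ * U = 1) (hU : M * U = 0)
    (hJ : J * fromBlocks M V Vᵀ 0 = 1) (N : Matrix ι ι ℝ) (a b : Fin 2) :
    (J * (fromBlocks N 0 0 0 : Matrix (ι ⊕ Fin 2) (ι ⊕ Fin 2) ℝ) * J : Matrix _ _ ℝ)
      (Sum.inr a) (Sum.inr b) = (Uᵀ * N * U) a b := by
  have hUV : Uᵀ * V = 1 := by rw [← transpose_inj]; simpa using hVU
  have hUM : Uᵀ * M = 0 := by rw [← transpose_inj]; simpa [hM] using hU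
  have hrow : (fromCols 0 1 : Matrix (Fin 2) (ι ⊕ Fin 2) ℝ) * J = fromCols Uᵀ 0 := by
    have : (fromCols Uᵀ 0 : Matrix (Fin 2) (ι ⊕ Fin 2) ℝ) * fromBlocks M V Vᵀ 0 = fromCols 0 1 := by
      simp [fromCols_mul_fromBlocks, hUM, hUV]
    rw [← this, Matrix.mul_assoc, mul_eq_one_comm.mp hJ, Matrix.mul_one]
  rw [apply_inr_inr_eq (J * _ * J), Matrix.mul_assoc, Matrix.mul_assoc, Matrix.mul_assoc,
    bordered_inv_mul_fromRows hVU hU hJ, ← Matrix.mul_assoc, ← Matrix.mul_assoc, hrow]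
  simp [fromCols_mul_fromBlocks, fromCols_mul_fromRows]

theorem exists_mul_eq_zero_of_bordered_inv (hM : Mᵀ = M)
    (hJ : J * fromBlocks M V Vᵀ 0 = 1) (h00 : J (Sum.inr 0) (Sum.inr 0) = 0)
    (h01 : J (Sum.inr 0) (Sum.inr 1) = 0) (h11 : J (Sum.inr 1) (Sum.inr 1) = 0) :
    ∃ W : Matrix ι (Fin 2) ℝ, Vᵀ * W = 1 ∧ M * W = 0 := by
  have hJ' := mul_eq_one_comm.mp hJ
  have hJT : Jᵀ = J := by
    have h : (fromBlocks M V Vᵀ 0)ᵀ = fromBlocks M V Vᵀ 0 := by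
      simp [fromBlocks_transpose, hM]
    have h2 := congrArg transpose hJ'
    rw [transpose_mul, h, transpose_one] at h2
    exact left_inv_eq_right_inv h2 hJ'
  have h10 : J (Sum.inr 1) (Sum.inr 0) = 0 := by rw [← hJT]; exact h01
  obtain ⟨A, W, C, D, rfl⟩ : ∃ A B C D, J = fromBlocks A B C D :=
    ⟨_, _, _, _, (fromBlocks_toBlocks J).symm⟩
  have hD : D = 0 := by
    ext i j
    fin_cases i <;> fin_cases j <;> simpa
  subst hD
  rw [fromBlocks_multiply, ← fromBlocks_one, fromBlocks_inj] at hJ'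
  exact ⟨W, by simpa using hJ'.2.2.2, by simpa using hJ'.2.1⟩

end Bordered

open scoped Matrix.Norms.Operator in
theorem exists_mul_eq_zero_of_hasStrictFDerivAt {ι E : Type*} [Fintype ι] [DecidableEq ι]
    [NormedAddCommGroup E] [NormedSpace ℝ E] [CompleteSpace E]
    {M : E × ℝ → Matrix ι ι ℝ} {M' : E × ℝ →L[ℝ] Matrix ι ι ℝ} (hM : HasStrictFDerivAt M M' 0)
    (hsymm : ∀ p, (M p)ᵀ = M p) {U V : Matrix ι (Fin 2) ℝ} (hVU : Vᵀ * U = 1)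
    (hU : M 0 * U = 0) (hker : ∀ x, M 0 *ᵥ x = 0 → ∃ z, x = U *ᵥ z)
    (hsurj : ∀ a b c : ℝ, ∃ s : E, (Uᵀ * M' (s, 0) * U) 0 0 = a ∧
      (Uᵀ * M' (s, 0) * U) 0 1 = b ∧ (Uᵀ * M' (s, 0) * U) 1 1 = c)
    {S : Set (E × ℝ)} (hS : S ∈ nhds 0) :
    ∃ p ∈ S, p.2 ≠ 0 ∧ ∃ W : Matrix ι (Fin 2) ℝ, Vᵀ * W = 1 ∧ M p * W = 0 := by
  let bord : Matrix ι ι ℝ →ₗ[ℝ] Matrix (ι ⊕ Fin 2) (ι ⊕ Fin 2) ℝ :=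
    { toFun := fun N => fromBlocks N 0 0 0
      map_add' := by intro x y; simp [fromBlocks_add]
      map_smul' := by intro c x; simp [fromBlocks_smul] }
  let K : E × ℝ → Matrix (ι ⊕ Fin 2) (ι ⊕ Fin 2) ℝ := fun p => fromBlocks (M p) V Vᵀ 0
  let bordL := bord.toContinuousLinearMap
  have hK' : HasStrictFDerivAt K (bordL.comp M') 0 := by
    have : K = fun p => bordL (M p) + fromBlocks 0 V Vᵀ 0 := by
      funext p; simp [K, bordL, bord, fromBlocks_add]
    rw [this]
    exact (bordL.hasStrictFDerivAt.comp 0 hM).add_const _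
  obtain ⟨u, hu⟩ : IsUnit (K 0) := isUnit_bordered (hsymm 0) hVU hU hker
  have huK : (u⁻¹).val * fromBlocks (M 0) V Vᵀ 0 = 1 := by
    have := u.inv_mul
    rwa [hu] at this
  let cornerLin : Matrix (ι ⊕ Fin 2) (ι ⊕ Fin 2) ℝ →ₗ[ℝ] ℝ × ℝ × ℝ :=
    { toFun := fun N => (N (Sum.inr 0) (Sum.inr 0), N (Sum.inr 0) (Sum.inr 1),
        N (Sum.inr 1) (Sum.inr 1))
      map_add' := by intro x y; simp
      map_smul' := by intro c x; simp }
  let corner := cornerLin.toContinuousLinearMap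
  have hinv : HasStrictFDerivAt (fun p => Ring.inverse (K p)) _ 0 :=
    HasStrictFDerivAt.comp (0 : E × ℝ) (g := Ring.inverse)
      (hu ▸ hasStrictFDerivAt_ringInverse (𝕜 := ℝ) u) hK'
  have hH := (corner.hasStrictFDerivAt.comp 0 hinv).prodMk
    (ContinuousLinearMap.snd ℝ E ℝ).hasStrictFDerivAt
  have hmap := hH.map_nhds_eq_of_surj (by
    rw [LinearMap.range_eq_top]
    rintro ⟨⟨a, b, c⟩, τ⟩
    have hsplit : ∀ s, M' (s, τ) = M' (s, 0) + M' (0, τ) := by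
      intro s; rw [← map_add]; simp
    obtain ⟨s, h1, h2, h3⟩ := hsurj (-a - (Uᵀ * M' (0, τ) * U) 0 0)
      (-b - (Uᵀ * M' (0, τ) * U) 0 1) (-c - (Uᵀ * M' (0, τ) * U) 1 1)
    refine ⟨(s, τ), ?_⟩
    have hc := fun a b => bordered_inv_mul_mul_apply_inr_inr (hsymm 0) hVU hU huK (M' (s, τ)) a b
    have hval : corner (-((u⁻¹).val * fromBlocks (M' (s, τ)) 0 0 0 * (u⁻¹).val)) = (a, b, c) := by
      simp only [map_neg]
      change -(_, _, _) = _
      simp only [hc]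
      rw [hsplit s]
      simp only [Matrix.mul_add, Matrix.add_mul, Matrix.add_apply, h1, h2, h3]
      simp
    exact Prod.ext hval rfl)
  have hunit : {p | IsUnit (K p)} ∈ nhds 0 :=
    hK'.continuousAt.preimage_mem_nhds (Units.isOpen.mem_nhds ⟨u, hu⟩)
  have himg := Filter.image_mem_map (Filter.inter_mem hS hunit) (m := fun p =>
    (corner (Ring.inverse (K p)), p.2))
  replace himg := hmap.ge himg
  have h0 : corner (Ring.inverse (K 0)) = 0 := by
    rw [← hu, Ring.inverse_unit]
    have := bordered_inv_apply_inr_inr hVU hU huK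
    change (_, _, _) = _
    simp [this]
  simp only [h0] at himg
  have hline : Filter.Tendsto (fun τ : ℝ => ((0 : ℝ × ℝ × ℝ), τ)) (nhdsWithin 0 {0}ᶜ)
      (nhds (0, (0 : ℝ))) := by
    refine Filter.Tendsto.mono_left ?_ nhdsWithin_le_nhds
    exact (Continuous.prodMk_right (0 : ℝ × ℝ × ℝ)).tendsto 0
  obtain ⟨τ, ⟨p, ⟨hpS, hpu⟩, hp⟩, hτ⟩ :=
    ((hline.eventually himg).and self_mem_nhdsWithin).exists
  obtain ⟨hp1, hp2⟩ := Prod.ext_iff.mp hp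
  refine ⟨p, hpS, ?_, ?_⟩
  · simp only at hp2
    rw [hp2]; exact hτ
  · have hp1' : (_, _, _) = ((0, 0, 0) : ℝ × ℝ × ℝ) := hp1
    simp only [Prod.mk.injEq] at hp1'
    exact exists_mul_eq_zero_of_bordered_inv (hsymm p) (Ring.inverse_mul_cancel _ hpu)
      hp1'.1 hp1'.2.1 hp1'.2.2

theorem two_le_rootMultiplicity_charpoly {ι : Type*} [Fintype ι] [DecidableEq ι]
    {N : Matrix ι ι ℝ} {μ : ℝ} {V W : Matrix ι (Fin 2) ℝ} (hVW : Vᵀ * W = 1)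
    (hN : N * W = μ • W) : 2 ≤ N.charpoly.rootMultiplicity μ := by
  have h := LinearMap.finrank_eigenspace_le (Matrix.toLin' N) μ
  rw [Matrix.charpoly_toLin'] at h
  refine le_trans ?_ h
  have hmem : ∀ z, W.mulVecLin z ∈ Module.End.eigenspace (Matrix.toLin' N) μ := by
    intro z
    rw [Module.End.mem_eigenspace_iff]
    simp [hN, smul_mulVec]
  have hinj : Function.Injective (W.mulVecLin.codRestrict _ hmem) := by
    intro x y hxy
    have h1 : W *ᵥ x = W *ᵥ y := congrArg Subtype.val hxy
    simpa [hVW] using congrArg (fun v => Vᵀ *ᵥ v) h1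
  simpa using LinearMap.finrank_le_finrank_of_injective hinj

open scoped Matrix.Norms.Operator in
theorem exists_hasPattern_of_perturbation {ι : Type*} [Fintype ι] [DecidableEq ι]
    {P B : Matrix ι ι ℝ} (hP : IsPattern P) (hdiag : ∀ i, P i i = 1)
    (D : (Fin 3 → ℝ) →ₗ[ℝ] Matrix ι ι ℝ) {U V : Matrix ι (Fin 2) ℝ}
    (hB : ∀ i j, i ≠ j → P i j = 0 → B i j = 0)
    (hD : ∀ s i j, i ≠ j → B i j = 0 → D s i j = 0)
    (hVU : Vᵀ * U = 1) (hU : (B + Bᵀ) * U = 0)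
    (hker : ∀ x, (B + Bᵀ) *ᵥ x = 0 → ∃ z, x = U *ᵥ z)
    (hsurj : ∀ a b c : ℝ, ∃ s, (Uᵀ * (D s + (D s)ᵀ) * U) 0 0 = a ∧
      (Uᵀ * (D s + (D s)ᵀ) * U) 0 1 = b ∧ (Uᵀ * (D s + (D s)ᵀ) * U) 1 1 = c) :
    ∃ A, HasPattern A P ∧ 2 ≤ singValMult A 1 := by
  let DL := D.toContinuousLinearMap
  let T : Matrix ι ι ℝ →L[ℝ] Matrix ι ι ℝ :=
    (Matrix.transposeLinearEquiv ι ι ℝ ℝ).toLinearMap.toContinuousLinearMap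
  let C : (Fin 3 → ℝ) × ℝ → Matrix ι ι ℝ := fun p => B + DL p.1 + p.2 • P
  let M : (Fin 3 → ℝ) × ℝ → Matrix ι ι ℝ := fun p => C p + T (C p) + p.2 • (C p * T (C p))
  have hT : ∀ X, T X = Xᵀ := fun X => rfl
  have hCdiff : ContDiff ℝ 1 C :=
    ((contDiff_const.add (DL.contDiff.comp contDiff_fst)).add (contDiff_snd.smul contDiff_const))
  have hTC : ContDiff ℝ 1 (fun p => T (C p)) := T.contDiff.comp hCdiff
  have hMdiff : ContDiff ℝ 1 M :=
    (hCdiff.add hTC).add (contDiff_snd.smul (hCdiff.mul hTC))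
  have hstrict : HasStrictFDerivAt M (fderiv ℝ M 0) 0 :=
    hMdiff.contDiffAt.hasStrictFDerivAt (by simp)
  have hM0 : M 0 = B + Bᵀ := by simp [M, C, hT]
  have hderiv : ∀ s, fderiv ℝ M 0 (s, 0) = D s + (D s)ᵀ := by
    have h1 : HasFDerivAt (fun s : Fin 3 → ℝ => M (s, 0))
        ((fderiv ℝ M 0).comp (ContinuousLinearMap.inl ℝ (Fin 3 → ℝ) ℝ)) 0 :=
      HasFDerivAt.comp (0 : Fin 3 → ℝ) (g := M) (f := fun s => (s, (0 : ℝ)))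
        hstrict.hasFDerivAt (ContinuousLinearMap.inl ℝ (Fin 3 → ℝ) ℝ).hasFDerivAt
    have h2 : HasFDerivAt (fun s : Fin 3 → ℝ => M (s, 0)) (DL + T.comp DL) 0 := by
      have : (fun s : Fin 3 → ℝ => M (s, 0)) = fun s => (DL + T.comp DL) s + (B + Bᵀ) := by
        funext s
        simp [M, C, hT]
        abel
      rw [this]
      exact (DL + T.comp DL).hasFDerivAt.add_const _
    intro s
    exact congrArg (fun L => L s) (h1.unique h2)
  have hdiagev : ∀ᶠ p in nhds (0 : (Fin 3 → ℝ) × ℝ), ∀ i, 1 + p.2 * C p i i ≠ 0 := by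
    rw [Filter.eventually_all]
    intro i
    have hc : Continuous fun p => 1 + p.2 * C p i i :=
      continuous_const.add (continuous_snd.mul (hCdiff.continuous.matrix_elem i i))
    exact hc.continuousAt.eventually_ne (by simp)
  have hoffev : ∀ᶠ p in nhds (0 : (Fin 3 → ℝ) × ℝ), ∀ i j, B i j ≠ 0 → C p i j ≠ 0 := by
    simp only [Filter.eventually_all]
    intro i j hij
    exact (hCdiff.continuous.matrix_elem i j).continuousAt.eventually_ne (by simpa [C] using hij)
  obtain ⟨⟨s, t⟩, ⟨hp1, hp2⟩, ht, W, hVW, hW⟩ := exists_mul_eq_zero_of_hasStrictFDerivAt hstrict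
    (fun p => by simp [M, hT, add_comm]) hVU (by rw [hM0, hU])
    (fun x hx => hker x (by rwa [hM0] at hx)) (by simpa only [hderiv] using hsurj)
    (hdiagev.and hoffev)
  simp only at ht hp1 hp2
  refine ⟨1 + t • C (s, t), ?_, ?_⟩
  · intro i j
    by_cases hij : i = j
    · subst hij
      simpa [hdiag] using hp1 i
    · rcases hP i j with h | h
      · have hb := hB i j hij h
        simp [C, DL, hij, h, hb, hD s i j hij hb]
      · by_cases hb : B i j = 0
        · simp [C, DL, hij, h, hb, hD s i j hij hb, ht]
        · simpa [hij, h, ht] using hp2 i j hb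
  · refine two_le_rootMultiplicity_charpoly hVW ?_
    have : (1 + t • C (s, t)) * (1 + t • C (s, t))ᵀ = 1 + t • M (s, t) := by
      simp only [M, hT, transpose_add, transpose_one, transpose_smul, Matrix.add_mul,
        Matrix.mul_add, Matrix.one_mul, Matrix.mul_one, smul_mul, Matrix.mul_smul, smul_add]
      abel
    rw [this, Matrix.add_mul, smul_mul, hW]
    simp

theorem exists_sum_mul_sq_eq {x₀ y₀ x₁ y₁ x₂ y₂ : ℝ} (h₀₁ : x₀ * y₁ - y₀ * x₁ ≠ 0)
    (h₀₂ : x₀ * y₂ - y₀ * x₂ ≠ 0) (h₁₂ : x₁ * y₂ - y₁ * x₂ ≠ 0) (a b c : ℝ) :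
    ∃ s t w : ℝ, s * (x₀ * x₀) + t * (x₁ * x₁) + w * (x₂ * x₂) = a ∧
      s * (x₀ * y₀) + t * (x₁ * y₁) + w * (x₂ * y₂) = b ∧
      s * (y₀ * y₀) + t * (y₁ * y₁) + w * (y₂ * y₂) = c := by
  obtain ⟨p, hp⟩ : ∃ p, p = x₀ * y₁ - y₀ * x₁ := ⟨_, rfl⟩
  obtain ⟨q, hq⟩ : ∃ q, q = x₀ * y₂ - y₀ * x₂ := ⟨_, rfl⟩
  obtain ⟨r, hr⟩ : ∃ r, r = x₁ * y₂ - y₁ * x₂ := ⟨_, rfl⟩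
  rw [← hp] at h₀₁
  rw [← hq] at h₀₂
  rw [← hr] at h₁₂
  refine ⟨(a * (y₁ * y₂) - b * (x₁ * y₂ + y₁ * x₂) + c * (x₁ * x₂)) / (p * q),
    -(a * (y₀ * y₂) - b * (x₀ * y₂ + y₀ * x₂) + c * (x₀ * x₂)) / (p * r),
    (a * (y₀ * y₁) - b * (x₀ * y₁ + y₀ * x₁) + c * (x₀ * x₁)) / (q * r), ?_, ?_, ?_⟩
  all_goals
    field_simp
    rw [hp, hq, hr]
    ring

theorem exists_hasPattern_of_symmetric {ι : Type*} [Fintype ι] [DecidableEq ι]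
    {P S : Matrix ι ι ℝ} (hP : IsPattern P) (hdiag : ∀ i, P i i = 1) (hS : Sᵀ = S)
    (hSP : ∀ i j, i ≠ j → P i j = 0 → P j i = 0 → S i j = 0) {U V : Matrix ι (Fin 2) ℝ}
    (hVU : Vᵀ * U = 1) (hU : S * U = 0) (hker : ∀ x, S *ᵥ x = 0 → ∃ z, x = U *ᵥ z)
    {i j k : ι} (hij : U i 0 * U j 1 - U i 1 * U j 0 ≠ 0)
    (hik : U i 0 * U k 1 - U i 1 * U k 0 ≠ 0) (hjk : U j 0 * U k 1 - U j 1 * U k 0 ≠ 0) :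
    ∃ A, HasPattern A P ∧ 2 ≤ singValMult A 1 := by
  let B : Matrix ι ι ℝ := fun i j => S i j * P i j / (P i j + P j i)
  have hB : B + Bᵀ = S := by
    ext i j
    have hs : S j i = S i j := congrFun (congrFun hS i) j
    change S i j * P i j / (P i j + P j i) + S j i * P j i / (P j i + P i j) = S i j
    by_cases hij : i = j
    · subst hij
      simp only [hdiag]
      ring
    · rcases hP i j with h1 | h1 <;> rcases hP j i with h2 | h2
      · simp [h1, h2, hSP i j hij h1 h2]
      all_goals
        simp only [h1, h2, hs]
        ring
  let D : (Fin 3 → ℝ) →ₗ[ℝ] Matrix ι ι ℝ :=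
    Fintype.linearCombination ℝ (fun l => diagonal (Pi.single (![i, j, k] l) 1))
  have hDapp : ∀ s, D s = diagonal
      (s 0 • Pi.single i 1 + s 1 • Pi.single j 1 + s 2 • Pi.single k 1) := by
    intro s
    simp [D, Fintype.linearCombination_apply, Fin.sum_univ_three, ← diagonal_smul]
  have hform : ∀ s a b, (Uᵀ * (D s + (D s)ᵀ) * U) a b =
      2 * (s 0 * (U i a * U i b) + s 1 * (U j a * U j b) + s 2 * (U k a * U k b)) := by
    intro s a b
    rw [hDapp, diagonal_transpose, diagonal_add, Matrix.mul_apply]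
    simp only [mul_diagonal, transpose_apply, Pi.add_apply, Pi.smul_apply, smul_eq_mul, mul_add,
      add_mul, Finset.sum_add_distrib, Pi.single_apply]
    simp
    ring
  refine exists_hasPattern_of_perturbation (B := B) hP hdiag D ?_ ?_ hVU (by rwa [hB])
    (by rwa [hB]) ?_
  · intro i j _ h
    simp [B, h]
  · intro s i j h _
    simp [hDapp, h]
  · intro a b c
    simp only [hform]
    obtain ⟨s, t, w, h1, h2, h3⟩ := exists_sum_mul_sq_eq hij hik hjk (a / 2) (b / 2) (c / 2)
    refine ⟨![s, t, w], ?_, ?_, ?_⟩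
    all_goals
      simp only [cons_val_zero, cons_val_one, cons_val]
      linarith

theorem exists_hasPattern_of_two_cycle {ι : Type*} [Fintype ι] [DecidableEq ι]
    {P : Matrix ι ι ℝ} (hP : IsPattern P) (hdiag : ∀ i, P i i = 1) {i j : ι} (hne : i ≠ j)
    (hij : P i j = 1) (hji : P j i = 1) : ∃ A, HasPattern A P ∧ 2 ≤ singValMult A 1 := by
  let d : ι → ℝ := fun l => if l = i ∨ l = j then 0 else 1 / 2
  let B : Matrix ι ι ℝ := single i j 1 - single j i 1 + diagonal d
  have hB : B + Bᵀ = diagonal (fun l => if l = i ∨ l = j then 0 else 1) := by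
    have h1 : diagonal d + diagonal d =
        diagonal (fun l => if l = i ∨ l = j then (0 : ℝ) else 1) := by
      rw [diagonal_add]
      congr 1
      funext l
      simp only [d]
      split_ifs <;> norm_num
    rw [← h1]
    simp only [B, transpose_add, transpose_sub, transpose_single, diagonal_transpose]
    abel
  let D : (Fin 3 → ℝ) →ₗ[ℝ] Matrix ι ι ℝ :=
    Fintype.linearCombination ℝ ![single i i 1, single i j 1, single j j 1]
  have hDapp : ∀ s, D s = s 0 • single i i 1 + s 1 • single i j 1 + s 2 • single j j 1 := by
    intro s
    simp [D, Fintype.linearCombination_apply, Fin.sum_univ_three]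
  let U : Matrix ι (Fin 2) ℝ :=
    Matrix.of fun l a => if l = ![i, j] a then 1 else 0
  have hform : ∀ (N : Matrix ι ι ℝ) a b, (Uᵀ * N * U) a b = N (![i, j] a) (![i, j] b) := by
    intro N a b
    simp [U, Matrix.mul_apply]
  refine exists_hasPattern_of_perturbation (B := B) (U := U) (V := U) hP hdiag D ?_ ?_ ?_ ?_ ?_ ?_
  · intro k l hkl h
    have h1 : ¬(i = k ∧ j = l) := by rintro ⟨rfl, rfl⟩; simp [hij] at h
    have h2 : ¬(j = k ∧ i = l) := by rintro ⟨rfl, rfl⟩; simp [hji] at h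
    simp [B, h1, h2, hkl]
  · intro s k l hkl h
    have h1 : ¬(i = k ∧ j = l) := by
      rintro ⟨rfl, rfl⟩; simp [B, hne, hne.symm] at h
    have h2 : ¬(i = k ∧ i = l) := by rintro ⟨rfl, rfl⟩; exact hkl rfl
    have h3 : ¬(j = k ∧ j = l) := by rintro ⟨rfl, rfl⟩; exact hkl rfl
    simp [hDapp, h1, h2, h3]
  · have h := hform 1
    rw [Matrix.mul_one] at h
    ext a b
    rw [h]
    revert a b
    simp [Fin.forall_fin_two, Matrix.one_apply, hne, hne.symm]
  · rw [hB]
    ext l a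
    rw [diagonal_mul]
    fin_cases a <;> simp +contextual [U]
  · intro x hx
    rw [hB] at hx
    refine ⟨![x i, x j], ?_⟩
    funext l
    have hl := congrFun hx l
    rw [mulVec_diagonal] at hl
    by_cases h1 : l = i
    · subst h1
      simp [U, mulVec, dotProduct, Fin.sum_univ_two, hne]
    · by_cases h2 : l = j
      · subst h2
        simp [U, mulVec, dotProduct, Fin.sum_univ_two, h1]
      · simpa [U, mulVec, dotProduct, Fin.sum_univ_two, h1, h2] using hl
  · intro a b c
    refine ⟨![a / 2, b, c / 2], ?_⟩
    simp only [hform, hDapp]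
    simp [hne, hne.symm]

theorem exists_hasPattern_of_claw {ι : Type*} [Fintype ι] [DecidableEq ι]
    {P : Matrix ι ι ℝ} (hP : IsPattern P) (hdiag : ∀ i, P i i = 1) {o a b c : ι}
    (hoa : o ≠ a) (hob : o ≠ b) (hoc : o ≠ c) (hab : a ≠ b) (hac : a ≠ c) (hbc : b ≠ c)
    (ha : P o a = 1 ∨ P a o = 1) (hb : P o b = 1 ∨ P b o = 1) (hc : P o c = 1 ∨ P c o = 1) :
    ∃ A, HasPattern A P ∧ 2 ≤ singValMult A 1 := by
  let d : ι → ℝ := fun l => if l = o ∨ l = a ∨ l = b ∨ l = c then 0 else 1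
  let w : ι → ℝ := fun l => if l = a ∨ l = b ∨ l = c then 1 else 0
  let S : Matrix ι ι ℝ :=
    diagonal d + vecMulVec (Pi.single o 1) w + vecMulVec w (Pi.single o 1)
  let U : Matrix ι (Fin 2) ℝ := Matrix.of fun l s =>
    ![if l = a then 1 else 0, if l = b then 1 else 0] s - (if l = c then 1 else 0)
  let V : Matrix ι (Fin 2) ℝ := Matrix.of fun l s => if l = ![a, b] s then 1 else 0
  have hw : ∀ x, w ⬝ᵥ x = x a + x b + x c := by
    intro x
    have : w = Pi.single a 1 + Pi.single b 1 + Pi.single c 1 := by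
      funext l
      by_cases h1 : l = a
      · subst h1; simp [w, hab, hac]
      · by_cases h2 : l = b
        · subst h2; simp [w, h1, hbc]
        · simp [w, h1, h2, Pi.single_apply]
    rw [this]
    simp [add_dotProduct]
  have hSx : ∀ x l, (S *ᵥ x) l = d l * x l + (if l = o then x a + x b + x c else 0) +
      w l * x o := by
    intro x l
    simp [S, add_mulVec, vecMulVec_mulVec, mulVec_diagonal, hw, Pi.single_apply, mul_comm]
  have hUz : ∀ z l, (U *ᵥ z) l = (if l = a then z 0 else 0) + (if l = b then z 1 else 0) -
      (if l = c then z 0 + z 1 else 0) := by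
    intro z l
    simp only [U, mulVec, dotProduct, Fin.sum_univ_two, of_apply, cons_val_zero, cons_val_one]
    split_ifs <;> ring
  have hSU : ∀ z, S *ᵥ (U *ᵥ z) = 0 := by
    intro z
    funext l
    rw [hSx]
    simp only [hUz, d, w]
    by_cases h0 : l = o
    · subst h0; simp [hoa, hob, hoc, hab, hac, hbc, hab.symm, hac.symm, hbc.symm]
    · by_cases h1 : l = a
      · subst h1; simp [hoa, hob, hoc, h0]
      · by_cases h2 : l = b
        · subst h2; simp [hoa, hob, hoc, h0]
        · by_cases h3 : l = c
          · subst h3; simp [hoa, hob, hoc, h0]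
          · simp [h0, h1, h2, h3]
  refine exists_hasPattern_of_symmetric (S := S) (U := U) (V := V) (i := a) (j := b) (k := c)
    hP hdiag ?_ ?_ ?_ ?_ ?_ ?_ ?_ ?_
  · simp only [S, transpose_add, diagonal_transpose, transpose_vecMulVec]
    abel
  · intro i j hij h1 h2
    have key : ∀ k l, P k l = 0 → P l k = 0 → (Pi.single o (1 : ℝ) : ι → ℝ) k * w l = 0 := by
      intro k l h1 h2
      by_cases hk : k = o
      · subst hk
        have : ¬(l = a ∨ l = b ∨ l = c) := by
          rintro (rfl | rfl | rfl)
          · simp [h1, h2] at ha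
          · simp [h1, h2] at hb
          · simp [h1, h2] at hc
        simp [w, this]
      · simp [hk]
    have e1 := key i j h1 h2
    have e2 := key j i h2 h1
    simp only [S, Matrix.add_apply, vecMulVec_apply, diagonal_apply_ne _ hij]
    linarith
  · ext s t
    have : ∀ s t, (Vᵀ * U) s t = U (![a, b] s) t := by
      intro s t
      simp [V, Matrix.mul_apply]
    rw [this]
    revert s t
    simp [U, Fin.forall_fin_two, Matrix.one_apply, hab, hab.symm, hac, hbc]
  · refine Matrix.ext_of_mulVec_single fun s => ?_
    rw [← mulVec_mulVec, hSU, zero_mulVec]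
  · intro x hx
    refine ⟨![x a, x b], ?_⟩
    funext l
    have hl := congrFun hx l
    have hxa := congrFun hx a
    have hxo := congrFun hx o
    rw [hSx] at hl hxa hxo
    simp only [hUz]
    simp [d, w, hoa.symm] at hxa
    simp [d, w, hoa, hob, hoc] at hxo
    by_cases h0 : l = o
    · subst h0; simp [hoa, hob, hoc, hxa]
    · by_cases h1 : l = a
      · subst h1; simp [hab, hac]
      · by_cases h2 : l = b
        · subst h2; simp [h1, hbc]
        · by_cases h3 : l = c
          · subst h3; simp [h1, h2]; linarith
          · simpa [d, w, h0, h1, h2, h3] using hl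
  all_goals simp [U, hab, hab.symm, hac, hac.symm, hbc, hbc.symm]

theorem exists_hasPattern_of_hamiltonian_cycle {m : ℕ}
    {P : Matrix (Fin (m + 2 + 1)) (Fin (m + 2 + 1)) ℝ} (hP : IsPattern P)
    (hdiag : ∀ i, P i i = 1)
    (hadj : ∀ i : Fin (m + 2), P i.castSucc i.succ = 1 ∨ P i.succ i.castSucc = 1)
    (hlast : P 0 (Fin.last _) = 1 ∨ P (Fin.last _) 0 = 1) :
    ∃ A, HasPattern A P ∧ 2 ≤ singValMult A 1 := by
  let B : Matrix (Fin (m + 2)) (Fin (m + 2 + 1)) ℝ := Matrix.of fun i k =>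
    (if k = i.succ then 1 else 0) - (if k = i.castSucc then 1 else 0)
  let c : Fin (m + 2 + 1) → ℝ := Bᵀ *ᵥ 1
  let S : Matrix (Fin (m + 2 + 1)) (Fin (m + 2 + 1)) ℝ :=
    ((m : ℝ) + 2)⁻¹ • vecMulVec c c - Bᵀ * B
  let U : Matrix (Fin (m + 2 + 1)) (Fin 2) ℝ := Matrix.of fun k => ![1, (k : ℝ)]
  let V : Matrix (Fin (m + 2 + 1)) (Fin 2) ℝ :=
    Matrix.of fun k => ![if k = 0 then 1 else 0, (if k = 1 then 1 else 0) - if k = 0 then 1 else 0]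
  have hm : (m : ℝ) + 2 ≠ 0 := by positivity
  have hc : ∀ k, c k = (if k = Fin.last _ then 1 else 0) - (if k = 0 then 1 else 0) := by
    intro k
    have h1 := Fin.sum_univ_succ (fun j => if k = j then (1 : ℝ) else 0)
    rw [Fin.sum_univ_castSucc] at h1
    simp only [c, B, mulVec, dotProduct, transpose_apply, of_apply, Pi.one_apply, mul_one,
      Finset.sum_sub_distrib]
    linarith
  have hBx : ∀ x i, (B *ᵥ x) i = x i.succ - x i.castSucc := by
    intro x i
    simp [B, mulVec, dotProduct, sub_mul, Finset.sum_sub_distrib]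
  have hcx : ∀ x, c ⬝ᵥ x = ∑ i, (B *ᵥ x) i := by
    intro x
    simp only [c]
    rw [mulVec_transpose, ← dotProduct_mulVec]
    simp [dotProduct]
  have hSx : ∀ x, S *ᵥ x = ((m + 2 : ℝ)⁻¹ * (c ⬝ᵥ x)) • c - Bᵀ *ᵥ (B *ᵥ x) := by
    intro x
    simp only [S, sub_mulVec, smul_mulVec, vecMulVec_mulVec, mulVec_mulVec]
    simp [smul_smul]
  have hUz : ∀ z k, (U *ᵥ z) k = z 0 + k * z 1 := by
    intro z k
    simp [U, mulVec, dotProduct, Fin.sum_univ_two]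
  refine exists_hasPattern_of_symmetric (S := S) (U := U) (V := V) (i := 0) (j := 1)
    (k := Fin.last _) hP hdiag ?_ ?_ ?_ ?_ ?_ ?_ ?_ ?_
  · simp [S]
  · intro k l hkl h1 h2
    have hBB : ∀ i, B i k * B i l = 0 := by
      intro i
      by_contra hne
      have hk : k = i.succ ∨ k = i.castSucc := by
        by_contra! h
        simp [B, h] at hne
      have hl : l = i.succ ∨ l = i.castSucc := by
        by_contra! h
        simp [B, h] at hne
      rcases hk with rfl | rfl <;> rcases hl with rfl | rfl
      · exact hkl rfl
      · simpa [h1, h2] using hadj i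
      · simpa [h1, h2] using hadj i
      · exact hkl rfl
    have hcc : c k * c l = 0 := by
      by_contra hne
      have hk : k = Fin.last _ ∨ k = 0 := by
        by_contra! h
        simp [hc, h] at hne
      have hl : l = Fin.last _ ∨ l = 0 := by
        by_contra! h
        simp [hc, h] at hne
      rcases hk with rfl | rfl <;> rcases hl with rfl | rfl
      · exact hkl rfl
      · simp [h1, h2] at hlast
      · simp [h1, h2] at hlast
      · exact hkl rfl
    simp [S, vecMulVec_apply, hcc, Matrix.mul_apply, hBB]
  · ext s t
    fin_cases s <;> fin_cases t <;>
      simp [V, U, Matrix.mul_apply, sub_mul, Finset.sum_sub_distrib]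
  · refine Matrix.ext_of_mulVec_single fun s => ?_
    rw [← mulVec_mulVec, zero_mulVec]
    generalize (Pi.single s 1 : Fin 2 → ℝ) = z
    have h1 : B *ᵥ (U *ᵥ z) = z 1 • 1 := by
      funext i
      simp [hBx, hUz]
      ring
    rw [hSx, hcx, h1, mulVec_smul]
    simp [c, hm]
  · intro x hx
    set f := B *ᵥ x with hf
    set μ := (m + 2 : ℝ)⁻¹ * ∑ i, f i with hμ
    have h1 : (m + 2 : ℝ)⁻¹ * (∑ i, f i) ^ 2 - ∑ i, f i ^ 2 = 0 := by
      have h2 := congrArg (fun v => x ⬝ᵥ v) hx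
      simp only [hSx, dotProduct_sub, dotProduct_smul, dotProduct_zero] at h2
      rw [dotProduct_comm x c, hcx, mulVec_transpose, dotProduct_comm x, ← dotProduct_mulVec,
        ← hf] at h2
      simp only [smul_eq_mul, dotProduct, ← pow_two] at h2
      linarith
    have h3 : ∑ i, (f i - μ) ^ 2 = 0 := by
      have hs : ∑ i, f i = (m + 2) * μ := by rw [hμ]; field_simp
      rw [hs] at h1
      simp only [sub_sq, Finset.sum_add_distrib, Finset.sum_sub_distrib, ← Finset.sum_mul,
        ← Finset.mul_sum, hs]
      simp
      field_simp at h1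
      linarith
    have h4 : ∀ i, f i = μ := by
      intro i
      have := (Finset.sum_eq_zero_iff_of_nonneg (fun i _ => sq_nonneg (f i - μ))).mp h3 i
        (Finset.mem_univ i)
      nlinarith
    refine ⟨![x 0, μ], ?_⟩
    funext k
    rw [hUz]
    induction k using Fin.induction with
    | zero => simp
    | succ i ih =>
      have h5 := h4 i
      rw [hf, hBx] at h5
      simp at ih ⊢
      linarith
  all_goals simp [U]
  all_goals
    intro h
    have := m.cast_nonneg (α := ℝ)
    linarith

theorem exists_mul_transpose_mulVec_eq_smul {ι : Type*} [Fintype ι] [DecidableEq ι]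
    {A : Matrix ι ι ℝ} (hA : A ≠ 0) : ∃ μ : ℝ, 0 < μ ∧ ∃ x, x ≠ 0 ∧ (A * Aᵀ) *ᵥ x = μ • x := by
  have hpsd : (A * Aᵀ).PosSemidef := by simpa using posSemidef_self_mul_conjTranspose A
  have hne : hpsd.isHermitian.eigenvalues ≠ 0 := by
    rw [Ne, hpsd.isHermitian.eigenvalues_eq_zero_iff]
    intro h
    exact hA (self_mul_conjTranspose_eq_zero.mp (by simpa using h))
  obtain ⟨i, hi⟩ := Function.ne_iff.mp hne
  refine ⟨_, lt_of_le_of_ne (hpsd.eigenvalues_nonneg i) (Ne.symm hi),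
    hpsd.isHermitian.eigenvectorBasis i, ?_, hpsd.isHermitian.mulVec_eigenvectorBasis i⟩
  intro h
  have := hpsd.isHermitian.eigenvectorBasis.orthonormal.ne_zero i
  apply this
  ext j
  exact congrFun h j

theorem exists_hasPattern_of_separation {ι : Type*} [Fintype ι] [DecidableEq ι]
    {P : Matrix ι ι ℝ} (hP : IsPattern P) (hdiag : ∀ i, P i i = 1) (s : ι → Prop) {a b : ι}
    (ha : s a) (hb : ¬ s b) (hs : ∀ i j, s i → ¬ s j → P i j = 0 ∧ P j i = 0) :
    ∃ A, HasPattern A P ∧ 2 ≤ singValMult A 1 := by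
  classical
  let A₁ : Matrix ι ι ℝ := Matrix.of fun i j => if s i then P i j else 0
  let A₂ : Matrix ι ι ℝ := Matrix.of fun i j => if s i then 0 else P i j
  obtain ⟨μ₁, hμ₁, x₁, hx₁, h₁⟩ := exists_mul_transpose_mulVec_eq_smul (A := A₁) fun h => by
    simpa [A₁, ha, hdiag] using congrFun (congrFun h a) a
  obtain ⟨μ₂, hμ₂, x₂, hx₂, h₂⟩ := exists_mul_transpose_mulVec_eq_smul (A := A₂) fun h => by
    simpa [A₂, hb, hdiag] using congrFun (congrFun h b) b
  have h₁₂ : A₁ * A₂ᵀ = 0 := by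
    ext i j
    rw [Matrix.mul_apply]
    refine Finset.sum_eq_zero fun k _ => ?_
    by_cases hi : s i <;> by_cases hj : s j <;> by_cases hk : s k <;> simp [A₁, A₂, hi, hj]
    · exact .inr (hs k j hk hj).2
    · exact .inl (hs i k hi hk).1
  have h₂₁ : A₂ * A₁ᵀ = 0 := by simpa using congrArg transpose h₁₂
  have hN₁ : (A₂ * A₂ᵀ) *ᵥ x₁ = 0 := by
    have h : (A₂ * A₂ᵀ) *ᵥ (μ₁ • x₁) = 0 := by
      rw [← h₁, mulVec_mulVec, Matrix.mul_assoc, ← Matrix.mul_assoc A₂ᵀ]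
      have : A₂ᵀ * A₁ = 0 := by
        ext i j
        rw [Matrix.mul_apply]
        refine Finset.sum_eq_zero fun k _ => ?_
        by_cases hk : s k <;> simp [A₁, A₂, hk]
      simp [this]
    rw [mulVec_smul] at h
    exact (smul_eq_zero.mp h).resolve_left hμ₁.ne'
  have hN₂ : (A₁ * A₁ᵀ) *ᵥ x₂ = 0 := by
    have h : (A₁ * A₁ᵀ) *ᵥ (μ₂ • x₂) = 0 := by
      rw [← h₂, mulVec_mulVec, Matrix.mul_assoc, ← Matrix.mul_assoc A₁ᵀ]
      have : A₁ᵀ * A₂ = 0 := by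
        ext i j
        rw [Matrix.mul_apply]
        refine Finset.sum_eq_zero fun k _ => ?_
        by_cases hk : s k <;> simp [A₁, A₂, hk]
      simp [this]
    rw [mulVec_smul] at h
    exact (smul_eq_zero.mp h).resolve_left hμ₂.ne'
  have horth : x₂ ⬝ᵥ x₁ = 0 := by
    have h : (μ₂ • x₂) ⬝ᵥ x₁ = 0 := by
      rw [← h₂, dotProduct_comm, dotProduct_mulVec, ← mulVec_transpose]
      simp [hN₁]
    rw [smul_dotProduct] at h
    exact (smul_eq_zero.mp h).resolve_left hμ₂.ne'
  have hn₁ : x₁ ⬝ᵥ x₁ ≠ 0 := by rwa [Ne, dotProduct_self_eq_zero]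
  have hn₂ : x₂ ⬝ᵥ x₂ ≠ 0 := by rwa [Ne, dotProduct_self_eq_zero]
  refine ⟨(√μ₁)⁻¹ • A₁ + (√μ₂)⁻¹ • A₂, ?_, ?_⟩
  · intro i j
    have e₁ := (Real.sqrt_pos.mpr hμ₁).ne'
    have e₂ := (Real.sqrt_pos.mpr hμ₂).ne'
    by_cases hi : s i <;> rcases hP i j with h | h <;> simp [A₁, A₂, hi, h, e₁, e₂]
  · refine two_le_rootMultiplicity_charpoly
      (V := Matrix.of fun i => ![(x₁ ⬝ᵥ x₁)⁻¹ * x₁ i, (x₂ ⬝ᵥ x₂)⁻¹ * x₂ i])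
      (W := Matrix.of fun i => ![x₁ i, x₂ i]) ?_ ?_
    · have horth' := horth
      rw [dotProduct_comm] at horth'
      simp only [dotProduct] at hn₁ hn₂ horth horth'
      ext i j
      fin_cases i <;> fin_cases j <;>
        simp [Matrix.mul_apply, dotProduct, mul_assoc, ← Finset.mul_sum, *]
    · have hAA : ((√μ₁)⁻¹ • A₁ + (√μ₂)⁻¹ • A₂) * ((√μ₁)⁻¹ • A₁ + (√μ₂)⁻¹ • A₂)ᵀ =
          μ₁⁻¹ • (A₁ * A₁ᵀ) + μ₂⁻¹ • (A₂ * A₂ᵀ) := by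
        have e₁ : (√μ₁)⁻¹ * (√μ₁)⁻¹ = μ₁⁻¹ := by rw [← mul_inv, Real.mul_self_sqrt hμ₁.le]
        have e₂ : (√μ₂)⁻¹ * (√μ₂)⁻¹ = μ₂⁻¹ := by rw [← mul_inv, Real.mul_self_sqrt hμ₂.le]
        simp [Matrix.add_mul, Matrix.mul_add, h₁₂, h₂₁, smul_smul, e₁, e₂]
      rw [hAA]
      have e₁ : (μ₁⁻¹ • (A₁ * A₁ᵀ) + μ₂⁻¹ • (A₂ * A₂ᵀ)) *ᵥ x₁ = x₁ := by
        simp [add_mulVec, smul_mulVec, h₁, hN₁, smul_smul, hμ₁.ne']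
      have e₂ : (μ₁⁻¹ • (A₁ * A₁ᵀ) + μ₂⁻¹ • (A₂ * A₂ᵀ)) *ᵥ x₂ = x₂ := by
        simp [add_mulVec, smul_mulVec, h₂, hN₂, smul_smul, hμ₂.ne']
      ext i t
      fin_cases t
      · simpa [Matrix.mul_apply, mulVec, dotProduct] using congrFun e₁ i
      · simpa [Matrix.mul_apply, mulVec, dotProduct] using congrFun e₂ i

theorem exists_hasPattern_of_submatrix {ι κ : Type*} [Fintype ι] [DecidableEq ι] [Fintype κ]
    [DecidableEq κ] {P : Matrix ι ι ℝ} (v : κ ≃ ι) {σ : ℝ} {k : ℕ}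
    (h : ∃ A, HasPattern A (P.submatrix v v) ∧ k ≤ singValMult A σ) :
    ∃ A, HasPattern A P ∧ k ≤ singValMult A σ := by
  obtain ⟨A, hA, hk⟩ := h
  refine ⟨reindex v v A, fun i j => by simpa using hA (v.symm i) (v.symm j), ?_⟩
  have : reindex v v A * (reindex v v A)ᵀ = reindex v v (A * Aᵀ) := by
    simp [submatrix_mul_equiv]
  rwa [singValMult, this, charpoly_reindex]

theorem SimpleGraph.exists_equiv_adj_of_forall_not_claw {n : ℕ} (G : SimpleGraph (Fin n))
    (hsep : ∀ s : Fin n → Prop, (∃ a, s a) → (∃ b, ¬ s b) → ∃ i j, s i ∧ ¬ s j ∧ G.Adj i j)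
    (hclaw : ∀ o a b c, a ≠ b → a ≠ c → b ≠ c → G.Adj o a → G.Adj o b → ¬ G.Adj o c) :
    ∃ v : Fin n ≃ Fin n, (∀ i j : Fin n, (i : ℕ) + 1 = j → G.Adj (v i) (v j)) ∧
      ∀ i j : Fin n, i < j → (i : ℕ) + 1 ≠ j → G.Adj (v i) (v j) →
        (i : ℕ) = 0 ∧ (j : ℕ) + 1 = n := by
  obtain ⟨l, ⟨hnd, hch⟩, hmax⟩ := (measure fun l : List (Fin n) => n - l.length).wf.has_min
    {l | l.Nodup ∧ l.IsChain G.Adj} ⟨[], by simp⟩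
  have hmax' : ∀ l' : List (Fin n), l'.Nodup → l'.IsChain G.Adj → ¬ l.length < l'.length := by
    intro l' h1 h2 hlt
    have hle : l'.length ≤ n := by simpa using h1.length_le_card
    exact hmax l' ⟨h1, h2⟩ (show n - l'.length < n - l.length by omega)
  rw [List.isChain_iff_getElem] at hch
  have hall : ∀ w, w ∈ l := by
    by_contra! hw
    have hne : ∃ a, a ∈ l := by
      by_contra! h
      obtain rfl := List.eq_nil_iff_forall_not_mem.mpr h
      obtain ⟨w, -⟩ := hw
      exact hmax' [w] (by simp) (by simp) (by simp)
    obtain ⟨x, y, hx, hy, hxy⟩ := hsep (· ∈ l) hne hw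
    obtain ⟨k, hk, rfl⟩ := List.getElem_of_mem hx
    by_cases hk0 : k = 0
    · subst hk0
      refine hmax' (y :: l) (by simp [hy, hnd]) ?_ (by simp)
      rw [List.isChain_iff_getElem]
      rintro (_ | i) hi
      · simpa using hxy.symm
      · simpa using hch i (by simpa using hi)
    · by_cases hk1 : k + 1 = l.length
      · refine hmax' (l ++ [y]) ?_ ?_ (by simp)
        · rw [List.nodup_append]
          simp only [hnd, List.nodup_singleton, List.mem_singleton, true_and]
          rintro a ha b rfl rfl
          exact hy ha
        · rw [List.isChain_iff_getElem]
          intro i hi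
          simp only [List.length_append, List.length_singleton] at hi
          rcases Nat.lt_or_ge (i + 1) l.length with h | h
          · rw [List.getElem_append_left (by omega), List.getElem_append_left h]
            exact hch i h
          · obtain rfl : i = k := by omega
            rw [List.getElem_append_left hk, List.getElem_append_right h]
            simpa using hxy
      · obtain ⟨k, rfl⟩ := Nat.exists_eq_succ_of_ne_zero hk0
        have h1 := hch k hk
        have h2 := hch (k + 1) (by omega)
        refine hclaw _ _ _ _ ?_ ?_ ?_ h1.symm h2 hxy
        · rw [Ne, hnd.getElem_inj_iff]
          omega
        · rintro rfl
          exact hy (List.getElem_mem _)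
        · rintro rfl
          exact hy (List.getElem_mem _)
  have hlen : l.length = n := by
    simpa using Fintype.card_congr (hnd.getEquivOfForallMemList l hall)
  let v : Fin n ≃ Fin n := (finCongr hlen.symm).trans (hnd.getEquivOfForallMemList l hall)
  have hv : ∀ i j : Fin n, (i : ℕ) + 1 = j → G.Adj (v i) (v j) := by
    rintro ⟨i, hi⟩ ⟨j, hj⟩ hij
    obtain rfl : i + 1 = j := hij
    exact hch i (by omega)
  refine ⟨v, hv, fun i j hlt hij hadj => ?_⟩
  rw [Fin.lt_def] at hlt
  constructor
  · by_contra h0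
    refine hclaw (v i) (v ⟨i - 1, by omega⟩) (v ⟨i + 1, by omega⟩) (v j) ?_ ?_ ?_
      (hv _ _ (by simp; omega)).symm (hv _ _ rfl) hadj
    all_goals
      rw [v.injective.ne_iff, Ne, Fin.ext_iff]
      simp only
      omega
  · by_contra h0
    refine hclaw (v j) (v ⟨j - 1, by omega⟩) (v ⟨j + 1, by omega⟩) (v i) ?_ ?_ ?_
      (hv _ _ (by simp; omega)).symm (hv _ _ rfl) hadj.symm
    all_goals
      rw [v.injective.ne_iff, Ne, Fin.ext_iff]
      simp only
      omega

/-- If `P` is an `n × n` pattern with term-rank `n` in standard form (all diagonal entries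
equal to `1`) such that no matrix with pattern `P` has a multiple singular value, then the
digraph of `P` is a weak path. -/
theorem weakPath_of_requires_simple {n : ℕ} (P : Matrix (Fin n) (Fin n) ℝ)
    (hP : IsPattern P) (hdiag : ∀ i, P i i = 1)
    (hsimple : ∀ A : Matrix (Fin n) (Fin n) ℝ, HasPattern A P →
      ∀ σ : ℝ, 0 ≤ σ → singValMult A σ ≤ 1) :
    IsWeakPath P := by
  have hnot : ¬ ∃ A, HasPattern A P ∧ 2 ≤ singValMult A 1 := by
    rintro ⟨A, hA, h⟩
    have := hsimple A hA 1 zero_le_one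
    omega
  let G : SimpleGraph (Fin n) :=
    { Adj := fun i j => i ≠ j ∧ (P i j = 1 ∨ P j i = 1)
      symm := ⟨fun _ _ h => ⟨h.1.symm, h.2.symm⟩⟩
      loopless := ⟨fun _ h => h.1 rfl⟩ }
  obtain ⟨v, hv, hchord⟩ := G.exists_equiv_adj_of_forall_not_claw
    (by
      rintro s ⟨a, ha⟩ ⟨b, hb⟩
      by_contra! h
      refine hnot (exists_hasPattern_of_separation hP hdiag s ha hb fun i j hi hj => ?_)
      have hij : ¬(P i j = 1 ∨ P j i = 1) := fun hor =>
        h i j hi hj ⟨fun he => hj (he ▸ hi), hor⟩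
      rw [not_or] at hij
      exact ⟨(hP i j).resolve_right hij.1, (hP j i).resolve_right hij.2⟩)
    (fun o a b c hab hac hbc ha hb hc => hnot (exists_hasPattern_of_claw hP hdiag ha.1 hb.1 hc.1
      hab hac hbc ha.2 hb.2 hc.2))
  have hchord' : ∀ i j : Fin n, i < j → (i : ℕ) + 1 ≠ j → ¬ G.Adj (v i) (v j) := by
    intro i j hlt hij hadj
    obtain ⟨hi, hj⟩ := hchord i j hlt hij hadj
    obtain ⟨m, rfl⟩ : ∃ m, n = m + 2 + 1 := ⟨n - 3, by omega⟩
    obtain rfl : i = 0 := Fin.ext hi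
    obtain rfl : j = Fin.last _ := Fin.ext (by simpa using hj)
    exact hnot (exists_hasPattern_of_submatrix v (exists_hasPattern_of_hamiltonian_cycle
      (fun i j => hP (v i) (v j)) (fun i => hdiag (v i))
      (fun i => (hv i.castSucc i.succ (by simp)).2) hadj.2))
  refine ⟨v, fun a b hab => ⟨fun h => ?_, fun h => ?_⟩⟩
  · have hadj : G.Adj (v a) (v b) := h.elim (hv a b) fun h => (hv b a h).symm
    have h2 : ¬(P (v a) (v b) = 1 ∧ P (v b) (v a) = 1) := fun h =>
      hnot (exists_hasPattern_of_two_cycle hP hdiag hadj.1 h.1 h.2)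
    rcases hadj.2 with h1 | h1
    · exact .inl ⟨h1, fun h3 => h2 ⟨h1, h3⟩⟩
    · exact .inr ⟨h1, fun h3 => h2 ⟨h3, h1⟩⟩
  · refine (hP _ _).resolve_right fun h1 => ?_
    have hadj : G.Adj (v a) (v b) := ⟨v.injective.ne hab, .inl h1⟩
    rw [not_or] at h
    rcases lt_or_gt_of_ne hab with hlt | hlt
    · exact hchord' a b hlt h.1 hadj
    · exact hchord' b a hlt h.2 hadj.symm
end

section
/- Every 4×4 real matrix with pattern [[1,1,0,0],[0,1,0,0],[0,1,1,1],[0,0,0,1]] has four distinct singular values (each singular value has multiplicity 1). -/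
open Matrix Polynomial

/-- An eigenvector of `A * Aᵀ`, for `A` with the given pattern, has nonzero last coordinate. -/
theorem eq_zero_of_mulVec_eq_smul_of_last_eq_zero {A : Matrix (Fin 4) (Fin 4) ℝ}
    (hA : HasPattern A !![1, 1, 0, 0;
                          0, 1, 0, 0;
                          0, 1, 1, 1;
                          0, 0, 0, 1])
    {μ : ℝ} {x : Fin 4 → ℝ} (hx : (A * Aᵀ) *ᵥ x = μ • x) (h3 : x 3 = 0) : x = 0 := by
  have h02 : A 0 2 = 0 := by simpa using hA 0 2
  have h03 : A 0 3 = 0 := by simpa using hA 0 3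
  have h10 : A 1 0 = 0 := by simpa using hA 1 0
  have h12 : A 1 2 = 0 := by simpa using hA 1 2
  have h13 : A 1 3 = 0 := by simpa using hA 1 3
  have h20 : A 2 0 = 0 := by simpa using hA 2 0
  have h30 : A 3 0 = 0 := by simpa using hA 3 0
  have h31 : A 3 1 = 0 := by simpa using hA 3 1
  have h32 : A 3 2 = 0 := by simpa using hA 3 2
  have h00 : A 0 0 ≠ 0 := by simpa using hA 0 0
  have h01 : A 0 1 ≠ 0 := by simpa using hA 0 1
  have h11 : A 1 1 ≠ 0 := by simpa using hA 1 1
  have h21 : A 2 1 ≠ 0 := by simpa using hA 2 1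
  have h23 : A 2 3 ≠ 0 := by simpa using hA 2 3
  have h33 : A 3 3 ≠ 0 := by simpa using hA 3 3
  have e0 := congrFun hx 0
  have e1 := congrFun hx 1
  have e2 := congrFun hx 2
  have e3 := congrFun hx 3
  simp [Matrix.mulVec, dotProduct, Matrix.mul_apply, Fin.sum_univ_four, h02, h03, h10, h12, h13,
    h20, h30, h31, h32, h3] at e0 e1 e2 e3
  have x2 : x 2 = 0 := by tauto
  rw [x2] at e0 e1 e2
  have hs : A 0 1 * x 0 + A 1 1 * x 1 = 0 := by
    apply mul_left_cancel₀ h21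
    linear_combination e2
  have hμ : μ * x 1 = 0 := by linear_combination A 1 1 * hs - e1
  have x1 : x 1 = 0 := by
    rcases mul_eq_zero.1 hμ with h | h
    · have x0 : x 0 = 0 := by
        apply mul_left_cancel₀ (mul_ne_zero h00 h00)
        linear_combination e0 - A 0 1 * hs + x 0 * h
      simpa [x0, h11] using hs
    · exact h
  have x0 : x 0 = 0 := by simpa [x1, h01] using hs
  ext i
  fin_cases i <;> assumption

/-- Every matrix with pattern `[[1,1,0,0],[0,1,0,0],[0,1,1,1],[0,0,0,1]]` has four
distinct singular values: `A * Aᵀ` has four distinct eigenvalues, i.e. its characteristic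
polynomial has four distinct real roots. -/
theorem example_distinct_singular_values (A : Matrix (Fin 4) (Fin 4) ℝ)
    (hA : HasPattern A !![1, 1, 0, 0;
                          0, 1, 0, 0;
                          0, 1, 1, 1;
                          0, 0, 0, 1]) :
    ∃ f : Fin 4 → ℝ, Function.Injective f ∧
      (A * Aᵀ).charpoly = ∏ i, (X - C (f i)) := by
  have hM : (A * Aᵀ).IsHermitian := by
    simpa [conjTranspose_eq_transpose_of_trivial] using isHermitian_mul_conjTranspose_self A
  refine ⟨hM.eigenvalues, fun i j hij => ?_, by simpa using hM.charpoly_eq⟩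
  by_contra hne
  set v := hM.eigenvectorBasis
  have hi := hM.mulVec_eigenvectorBasis i
  have hj := hM.mulVec_eigenvectorBasis j
  rw [← hij] at hj
  have hlast (k : Fin 4) : v k 3 ≠ 0 := fun h =>
    v.orthonormal.ne_zero k <| (WithLp.ofLp_eq_zero 2).1 <|
      eq_zero_of_mulVec_eq_smul_of_last_eq_zero hA (hM.mulVec_eigenvectorBasis k) h
  have hcomb : v j 3 • v i + (-v i 3) • v j = 0 := by
    refine (WithLp.ofLp_eq_zero 2).1 <|
      eq_zero_of_mulVec_eq_smul_of_last_eq_zero (μ := hM.eigenvalues i) hA ?_ ?_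
    · simp only [WithLp.ofLp_add, WithLp.ofLp_smul, mulVec_add, mulVec_smul, smul_add]
      rw [hi, hj, smul_comm, smul_comm (-v i 3)]
    · simp only [PiLp.add_apply, PiLp.smul_apply, smul_eq_mul]
      ring
  have hinner := congrArg (inner ℝ (v i)) hcomb
  simp [inner_add_right, inner_smul_right, v.orthonormal.inner_eq_zero hne, hlast] at hinner
end

section
/- Let P be an n×n pattern with term-rank n in standard form whose digraph is a weak path, and let A be a real matrix in Z(P). Then the singular values of A are distinct, i.e., A·Aᵀ has n distinct eigenvalues. -/
open Matrix Polynomial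

/-- A tridiagonal matrix with nonzero diagonal in which exactly one of each pair of opposite
entries next to the diagonal is nonzero. -/
structure IsWeakPathMatrix {n : ℕ} (B : Matrix (Fin n) (Fin n) ℝ) : Prop where
  diag_ne_zero : ∀ i, B i i ≠ 0
  eq_zero_of_far : ∀ i j : Fin n, i ≠ j → (i : ℕ) + 1 ≠ j → (j : ℕ) + 1 ≠ i → B i j = 0
  xor_succ : ∀ i j : Fin n, (i : ℕ) + 1 = j → Xor (B i j ≠ 0) (B j i ≠ 0)

namespace IsWeakPathMatrix

variable {n : ℕ} {B : Matrix (Fin n) (Fin n) ℝ}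

theorem transpose (hB : IsWeakPathMatrix B) : IsWeakPathMatrix Bᵀ where
  diag_ne_zero i := hB.diag_ne_zero i
  eq_zero_of_far i j h h1 h2 := hB.eq_zero_of_far j i h.symm h2 h1
  xor_succ i j h := by simpa [xor_comm] using hB.xor_succ i j h

theorem perm_eq_one (hB : IsWeakPathMatrix B) (σ : Equiv.Perm (Fin n))
    (hσ : ∀ i, B (σ i) i ≠ 0) : σ = 1 := by
  ext1 i
  rw [Equiv.Perm.one_apply]
  induction i using WellFoundedLT.induction with
  | ind i ih =>
    by_contra hne
    have succ_of : ∀ k, k ≠ i → (∀ j, j < i → k ≠ j) → B k i ≠ 0 ∨ B i k ≠ 0 →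
        (i : ℕ) + 1 = k := by
      intro k hk hlt hB0
      have h1 : ¬ k < i := fun h => hlt k h rfl
      by_contra h
      have h2 : (k : ℕ) + 1 ≠ i := fun h2 => h1 (Fin.lt_def.2 (by omega))
      exact hB0.elim (fun h0 => h0 (hB.eq_zero_of_far k i hk h2 h))
        (fun h0 => h0 (hB.eq_zero_of_far i k hk.symm h h2))
    have hsymm : σ.symm i ≠ i := fun h => hne (by rw [Equiv.symm_apply_eq] at h; exact h.symm)
    have h1 := succ_of (σ i) hne
      (fun j hj h => hj.ne (σ.injective ((ih j hj).trans h.symm))) (Or.inl (hσ i))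
    have h0 : B i (σ.symm i) ≠ 0 := by simpa using hσ (σ.symm i)
    have h2 := succ_of (σ.symm i) hsymm
      (fun j hj h => hj.ne (by rw [Equiv.symm_apply_eq, ih j hj] at h; exact h.symm)) (Or.inr h0)
    have h3 : σ.symm i = σ i := Fin.ext (by omega)
    rw [h3] at h0
    have := hB.xor_succ i (σ i) h1
    simp [Xor, h0, hσ i] at this

theorem det_ne_zero (hB : IsWeakPathMatrix B) : B.det ≠ 0 := by
  rw [Matrix.det_apply, Finset.sum_eq_single 1]
  · simpa [Finset.prod_eq_zero_iff] using hB.diag_ne_zero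
  · intro σ _ hσ
    have : ∃ i, B (σ i) i = 0 := by
      by_contra! h
      exact hσ (hB.perm_eq_one σ h)
    obtain ⟨i, hi⟩ := this
    have h0 : ∏ i, B (σ i) i = 0 := Finset.prod_eq_zero (Finset.mem_univ i) hi
    exact (congrArg _ h0).trans (smul_zero _)
  · simp

theorem mulVec_eq_succ (hB : IsWeakPathMatrix B) {i k : Fin n} (hik : (i : ℕ) + 1 = k)
    {w : Fin n → ℝ} (hw : ∀ j, j < k → w j = 0) : (B *ᵥ w) i = B i k * w k := by
  rw [Matrix.mulVec, dotProduct]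
  refine Finset.sum_eq_single k (fun j _ hj => ?_) (fun h => absurd (Finset.mem_univ _) h)
  rcases lt_or_gt_of_ne hj with h | h
  · rw [hw j h, mul_zero]
  · rw [Fin.lt_def] at h
    rw [hB.eq_zero_of_far i j (fun h' => by omega) (by omega) (by omega), zero_mul]

theorem mulVec_eq_diag {i : Fin n} (hi : ∀ j, i < j → B i j = 0)
    {w : Fin n → ℝ} (hw : ∀ j, j < i → w j = 0) : (B *ᵥ w) i = B i i * w i := by
  rw [Matrix.mulVec, dotProduct]
  refine Finset.sum_eq_single i (fun j _ hj => ?_) (fun h => absurd (Finset.mem_univ _) h)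
  rcases lt_or_gt_of_ne hj with h | h
  · rw [hw j h, mul_zero]
  · rw [hi j h, zero_mul]

theorem row_or_col_eq_zero (hB : IsWeakPathMatrix B) (i : Fin n) :
    (∀ j, i < j → B i j = 0) ∨ (∀ j, i < j → Bᵀ i j = 0) := by
  by_contra! h
  obtain ⟨⟨j, hj, h1⟩, k, hk, h2⟩ := h
  rw [Fin.lt_def] at hj hk
  have hj' : (i : ℕ) + 1 = j := by
    by_contra h
    exact h1 (hB.eq_zero_of_far i j (fun h' => by omega) h (by omega))
  have hk' : (i : ℕ) + 1 = k := by
    by_contra h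
    exact h2 (hB.transpose.eq_zero_of_far i k (fun h' => by omega) h (by omega))
  obtain rfl : j = k := Fin.ext (by omega)
  rw [Matrix.transpose_apply] at h2
  have := hB.xor_succ i j hj'
  simp [Xor, h1, h2] at this

/-- A solution of `B w = l u`, `Bᵀ u = w` is determined by the first entry of `u`. -/
theorem eq_zero_of_first_eq_zero (hB : IsWeakPathMatrix B) {l : ℝ} (hl : l ≠ 0)
    {u w : Fin n → ℝ} (hw : B *ᵥ w = l • u) (hu : Bᵀ *ᵥ u = w)
    (h0 : ∀ i : Fin n, (i : ℕ) = 0 → u i = 0) : u = 0 := by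
  suffices h : ∀ i, u i = 0 ∧ w i = 0 from funext fun i => (h i).1
  intro i
  induction i using WellFoundedLT.induction with
  | ind i ih =>
    have huj : ∀ j, j < i → u j = 0 := fun j hj => (ih j hj).1
    have hwj : ∀ j, j < i → w j = 0 := fun j hj => (ih j hj).2
    have hor : u i = 0 ∨ w i = 0 := by
      rcases Nat.eq_zero_or_pos (i : ℕ) with hi | hi
      · exact Or.inl (h0 i hi)
      · obtain ⟨k, hk⟩ : ∃ k : Fin n, (k : ℕ) + 1 = i :=
          ⟨⟨i - 1, by omega⟩, by simp only; omega⟩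
        have hki : k < i := Fin.lt_def.2 (by omega)
        have e1 := hB.mulVec_eq_succ hk hwj
        have e2 := hB.transpose.mulVec_eq_succ hk huj
        rw [hw, Pi.smul_apply, huj k hki, smul_zero] at e1
        rw [hu, hwj k hki, Matrix.transpose_apply] at e2
        rcases hB.xor_succ k i hk with h | h
        · exact Or.inr ((mul_eq_zero.1 e1.symm).resolve_left h.1)
        · exact Or.inl ((mul_eq_zero.1 e2.symm).resolve_left h.1)
    have hd := hB.diag_ne_zero i
    rcases hB.row_or_col_eq_zero i with h | h
    · have e := mulVec_eq_diag h hwj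
      rw [hw, Pi.smul_apply, smul_eq_mul] at e
      rcases hor with h' | h' <;> simp_all
    · have e := mulVec_eq_diag h huj
      rw [hu, Matrix.transpose_apply] at e
      rcases hor with h' | h' <;> simp_all

theorem eigenvector_eq_zero (hB : IsWeakPathMatrix B) {l : ℝ}
    {u : Fin n → ℝ} (hu : (B * Bᵀ) *ᵥ u = l • u)
    (h0 : ∀ i : Fin n, (i : ℕ) = 0 → u i = 0) : u = 0 := by
  rcases eq_or_ne l 0 with rfl | hl
  · rw [zero_smul] at hu
    refine Matrix.eq_zero_of_mulVec_eq_zero ?_ hu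
    rw [Matrix.det_mul, Matrix.det_transpose]
    exact mul_ne_zero hB.det_ne_zero hB.det_ne_zero
  · exact hB.eq_zero_of_first_eq_zero hl (by rw [Matrix.mulVec_mulVec, hu]) rfl h0

theorem eigenvalues_injective (hB : IsWeakPathMatrix B) (hM : (B * Bᵀ).IsHermitian) :
    Function.Injective hM.eigenvalues := by
  intro i j hij
  by_contra hne
  have hn : 0 < n := i.pos
  let z : Fin n := ⟨0, hn⟩
  have hz : ∀ k : Fin n, (k : ℕ) = 0 → k = z := fun k hk => Fin.ext hk
  let e := hM.eigenvectorBasis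
  have he : ∀ k, (e k : Fin n → ℝ) z ≠ 0 := by
    intro k hk
    have h := hB.eigenvector_eq_zero (hM.mulVec_eigenvectorBasis k)
      (fun m hm => by rw [hz m hm]; exact hk)
    exact e.orthonormal.ne_zero k ((WithLp.ofLp_eq_zero 2).1 h)
  have hc : (e j) z • (e i) - (e i) z • (e j) = 0 := by
    refine (WithLp.ofLp_eq_zero 2).1
      (hB.eigenvector_eq_zero (l := hM.eigenvalues i) ?_ (fun m hm => ?_))
    · have hi := hM.mulVec_eigenvectorBasis i
      have hj := hM.mulVec_eigenvectorBasis j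
      rw [← hij] at hj
      simp only [WithLp.ofLp_sub, WithLp.ofLp_smul, Matrix.mulVec_sub, Matrix.mulVec_smul, e]
      rw [hi, hj, smul_sub, smul_comm, smul_comm (_ : ℝ) (hM.eigenvalues i)]
    · rw [hz m hm]
      simp [mul_comm]
  have h := congrArg (fun x => inner ℝ (e i) x) hc
  simp only [inner_sub_right, inner_smul_right, inner_zero_right,
    e.inner_eq_zero hne, e.inner_eq_one i] at h
  exact he j (by simpa using h)

end IsWeakPathMatrix

/-- If `P` is an `n × n` pattern with term-rank `n` in standard form (all diagonal
entries `1`) whose digraph is a weak path, then every matrix `A` with pattern `P` has `n`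
distinct singular values: `A * Aᵀ` has `n` distinct eigenvalues. -/
theorem weakPath_distinct_singular_values {n : ℕ} (P : Matrix (Fin n) (Fin n) ℝ)
    (hP : IsPattern P) (hdiag : ∀ i, P i i = 1) (hpath : IsWeakPath P)
    (A : Matrix (Fin n) (Fin n) ℝ) (hA : HasPattern A P) :
    ∃ f : Fin n → ℝ, Function.Injective f ∧
      (A * Aᵀ).charpoly = ∏ i, (X - C (f i)) := by
  obtain ⟨v, hv⟩ := hpath
  have hB : IsWeakPathMatrix (A.submatrix v v) :=
    { diag_ne_zero := fun i => (hA _ _).2 (hdiag _)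
      eq_zero_of_far := fun i j hij h1 h2 => by
        have h := (hv i j hij).2 (by tauto)
        by_contra h0
        have := (hA _ _).1 h0
        rw [h] at this
        exact zero_ne_one this
      xor_succ := fun i j hij => by
        have h := (hv i j (fun h => by subst h; omega)).1 (Or.inl hij)
        simp only [Matrix.submatrix_apply, hA _ _]
        exact h }
  have hM : (A.submatrix v v * (A.submatrix v v)ᵀ).IsHermitian := by
    simpa using Matrix.isHermitian_mul_conjTranspose_self (A.submatrix v v)
  refine ⟨hM.eigenvalues, hB.eigenvalues_injective hM, ?_⟩
  refine Eq.trans ?_ hM.charpoly_eq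
  rw [Matrix.transpose_submatrix, Matrix.submatrix_mul_equiv]
  exact (Matrix.charpoly_reindex v.symm (A * Aᵀ)).symm
end
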